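/- Let M₁, M₂, … be n-dimensional Alexandrov spaces with curvature ≥ κ, diameter ≤ D, and volume ≥ v > 0, converging in the Gromov–Hausdorff topology to M (necessarily n-dimensional). Let Eᵢ ⊆ Mᵢ be m-dimensional extremal subsets converging under this convergence to an m-dimensional extremal subset E ⊆ M. Then lim_{i→∞} vol_m(Eᵢ) = vol_m(E), where vol_m denotes the m-dimensional Hausdorff measure (in the extrinsic metric). -/

import Mathlib

open Real Metric Set
open scoped ENNReal NNReal

noncomputable section

/-- The comparison angle in the `κ`-plane at the vertex between sides of
lengths `s` and `t`, opposite side of length `d`. -/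
def cangleK (κ s t d : ℝ) : ℝ :=
  if 0 < κ then
    Real.arccos ((Real.cos (Real.sqrt κ * d) - Real.cos (Real.sqrt κ * s) * Real.cos (Real.sqrt κ * t)) /
      (Real.sin (Real.sqrt κ * s) * Real.sin (Real.sqrt κ * t)))
  else if κ < 0 then
    Real.arccos ((Real.cosh (Real.sqrt (-κ) * s) * Real.cosh (Real.sqrt (-κ) * t) -
      Real.cosh (Real.sqrt (-κ) * d)) /
      (Real.sinh (Real.sqrt (-κ) * s) * Real.sinh (Real.sqrt (-κ) * t)))
  else Real.arccos ((s ^ 2 + t ^ 2 - d ^ 2) / (2 * s * t))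

/-- The comparison angle `∠̃ q p r` at `p` in the `κ`-plane. -/
def cangle {X : Type*} [MetricSpace X] (κ : ℝ) (q p r : X) : ℝ :=
  cangleK κ (dist p q) (dist p r) (dist q r)

/-- A `(k,δ)`-strainer at `p` (comparison angles taken in the `κ`-plane). -/
def IsStrainer {X : Type*} [MetricSpace X] (κ : ℝ) {k : ℕ} (a b : Fin k → X) (p : X)
    (δ : ℝ) : Prop :=
  (∀ i, π - δ < cangle κ (a i) p (b i)) ∧
  ∀ i j, i ≠ j →
    π / 2 - δ < cangle κ (a i) p (a j) ∧
    π / 2 - δ < cangle κ (a i) p (b j) ∧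
    π / 2 - δ < cangle κ (b i) p (b j)

/-- A `(k,δ)`-strained point. -/
def IsStrainedPt {X : Type*} [MetricSpace X] (κ : ℝ) (k : ℕ) (δ : ℝ) (p : X) : Prop :=
  ∃ a b : Fin k → X, IsStrainer κ a b p δ

/-- An Alexandrov space of curvature `≥ κ`: complete, geodesic (via midpoints), and the
sum of the three `κ`-comparison angles of any quadruple is at most `2π`. -/
def IsAlexandrov (X : Type*) [MetricSpace X] (κ : ℝ) : Prop :=
  CompleteSpace X ∧
  (∀ x y : X, ∃ z : X, dist x z = dist x y / 2 ∧ dist z y = dist x y / 2) ∧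
  ∀ p q r s : X, q ≠ p → r ≠ p → s ≠ p →
    cangle κ q p r + cangle κ r p s + cangle κ s p q ≤ 2 * π

/-- `p` is a critical point of `dist q`. -/
def IsCriticalPt {X : Type*} [MetricSpace X] (κ : ℝ) (q p : X) : Prop :=
  ∀ x : X, x ≠ p → cangle κ q p x ≤ π / 2

/-- An extremal subset: closed, and every local minimum point `p ∈ E` of `dist q|_E`
with `q ∉ E` is a critical point of `dist q`. -/
def IsExtremal {X : Type*} [MetricSpace X] (κ : ℝ) (E : Set X) : Prop :=
  IsClosed E ∧
  ∀ q ∉ E, ∀ p ∈ E, IsLocalMinOn (fun x => dist q x) E p → IsCriticalPt κ q p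

/-- A primitive extremal subset: an extremal subset containing no proper extremal
subset with nonempty relative interior. -/
def IsPrimitiveExtremal {X : Type*} [MetricSpace X] (κ : ℝ) (E : Set X) : Prop :=
  IsExtremal κ E ∧
  ∀ F : Set X, IsExtremal κ F → F ⊆ E → F ≠ E →
    ∀ x ∈ F, ¬ ∃ r > (0:ℝ), Metric.ball x r ∩ E ⊆ F

/-- `p` is a regular point of `E` of dimension `m`: the tangent cone of `E` at `p`
(with the extrinsic metric) is isometric to `ℝ^m`, expressed through blow-ups:
balls of `E` around `p` at scale `r` are `εr`-approximated by `r`-balls of `ℝ^m`. -/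
def IsRegularPt {X : Type*} [MetricSpace X] (E : Set X) (m : ℕ) (p : X) : Prop :=
  ∀ ε > (0:ℝ), ∃ r₀ > (0:ℝ), ∀ r, 0 < r → r < r₀ →
    ∃ f : X → EuclideanSpace ℝ (Fin m),
      f p = 0 ∧
      (∀ x ∈ E ∩ Metric.closedBall p r, ∀ y ∈ E ∩ Metric.closedBall p r,
        |dist (f x) (f y) - dist x y| ≤ ε * r) ∧
      (∀ v ∈ Metric.closedBall (0 : EuclideanSpace ℝ (Fin m)) r,
        ∃ x ∈ E ∩ Metric.closedBall p r, dist (f x) v ≤ ε * r)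

/-- The intrinsic (induced length) extended distance on a subset `E`. -/
def intrinsicEDist {X : Type*} [MetricSpace X] (E : Set X) (x y : X) : ℝ≥0∞ :=
  ⨅ (γ : ℝ → X) (_ : ContinuousOn γ (Set.Icc 0 1)) (_ : γ 0 = x) (_ : γ 1 = y)
    (_ : ∀ t ∈ Set.Icc (0:ℝ) 1, γ t ∈ E), eVariationOn γ (Set.Icc 0 1)

/-- Diameter of a set with respect to an abstract extended distance. -/
def ediamOn {X : Type*} (ρ : X → X → ℝ≥0∞) (s : Set X) : ℝ≥0∞ :=
  ⨆ x ∈ s, ⨆ y ∈ s, ρ x y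

/-- The `m`-dimensional Hausdorff measure of `S` with respect to an abstract
extended distance `ρ`. -/
def hMeas {X : Type*} (ρ : X → X → ℝ≥0∞) (m : ℝ) (S : Set X) : ℝ≥0∞ :=
  ⨆ (ε : ℝ≥0∞) (_ : 0 < ε),
    ⨅ (t : ℕ → Set X) (_ : S ⊆ ⋃ n, t n) (_ : ∀ n, ediamOn ρ (t n) ≤ ε),
      ∑' n, ediamOn ρ (t n) ^ m

end

/-- Abstract trigonometry of the `κ`-plane: `S` is the modified sine and `m` the modified
half-squared distance. -/
structure PlaneTrig (κ : ℝ) (S m : ℝ → ℝ) : Prop where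
  ang : ∀ s t d, cangleK κ s t d = Real.arccos ((m s + m t - κ * m s * m t - m d) / (S s * S t))
  sq : ∀ x, S x ^ 2 = 2 * m x - κ * m x ^ 2
  ssub : ∀ x y, S (x - y) = S x * (1 - κ * m y) - (1 - κ * m x) * S y
  msub : ∀ x y, m (x - y) = m x + m y - κ * m x * m y - S x * S y
  diff : ∀ x y, m x - m y = 2 * S ((x + y) / 2) * S ((x - y) / 2)
  near : ∀ ω > 0, ∃ r > 0, ∀ x, 0 ≤ x → x ≤ r → (1 - ω) * x ≤ S x ∧ S x ≤ (1 + ω) * x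

theorem near_of_hasDerivAt {S : ℝ → ℝ} (h0 : S 0 = 0) (h : HasDerivAt S 1 0) :
    ∀ ω > 0, ∃ r > 0, ∀ x, 0 ≤ x → x ≤ r → (1 - ω) * x ≤ S x ∧ S x ≤ (1 + ω) * x := by
  intro ω hω
  have h1 := h.isLittleO.def hω
  rw [Metric.eventually_nhds_iff] at h1
  obtain ⟨r, hr, h1⟩ := h1
  refine ⟨r / 2, by positivity, fun x hx hxr => ?_⟩
  have h2 := h1 (y := x) (by rw [Real.dist_eq, sub_zero, abs_of_nonneg hx]; linarith)
  simp only [h0, sub_zero, smul_eq_mul, mul_one, Real.norm_eq_abs, abs_of_nonneg hx] at h2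
  rw [abs_le] at h2
  constructor <;> nlinarith [h2.1, h2.2]

theorem exists_planeTrig (κ : ℝ) : ∃ S m : ℝ → ℝ, PlaneTrig κ S m := by
  rcases lt_trichotomy κ 0 with hκ | rfl | hκ
  · obtain ⟨a, ha, haκ⟩ : ∃ a : ℝ, 0 < a ∧ κ = -a ^ 2 :=
      ⟨√(-κ), Real.sqrt_pos.2 (by linarith), by rw [Real.sq_sqrt (by linarith)]; ring⟩
    have hsq : √(-κ) = a := by rw [haκ, neg_neg, Real.sqrt_sq ha.le]
    have hcs := fun x : ℝ => Real.cosh_sq x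
    refine ⟨fun x => Real.sinh (a * x) / a, fun x => (Real.cosh (a * x) - 1) / a ^ 2, ?_, ?_, ?_,
      ?_, ?_, ?_⟩
    · intro s t d
      rw [cangleK, if_neg (by linarith), if_pos hκ, hsq, haκ]
      congr 1
      by_cases h1 : Real.sinh (a * s) = 0
      · simp [h1]
      by_cases h2 : Real.sinh (a * t) = 0
      · simp [h2]
      field_simp
      ring
    · intro x
      have := hcs (a * x)
      simp only [haκ]
      field_simp
      nlinarith
    · intro x y
      simp only [haκ, mul_sub, Real.sinh_sub]
      field_simp
      ring
    · intro x y
      simp only [haκ, mul_sub, Real.cosh_sub]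
      field_simp
      ring
    · intro x y
      have h1 : a * x = a * ((x + y) / 2) + a * ((x - y) / 2) := by ring
      have h2 : a * y = a * ((x + y) / 2) - a * ((x - y) / 2) := by ring
      simp only [h1, h2, Real.cosh_sub, Real.cosh_add]
      field_simp
      ring
    · refine near_of_hasDerivAt (by simp) ?_
      have h1 : HasDerivAt (fun x : ℝ => a * x) a 0 := by simpa using (hasDerivAt_id (0:ℝ)).const_mul a
      have h2 := (h1.sinh).div_const a
      simpa [ha.ne'] using h2
  · refine ⟨fun x => x, fun x => x ^ 2 / 2, ?_, ?_, ?_, ?_, ?_, ?_⟩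
    · intro s t d
      rw [cangleK, if_neg (by norm_num), if_neg (by norm_num)]
      congr 1
      by_cases h1 : s = 0
      · simp [h1]
      by_cases h2 : t = 0
      · simp [h2]
      field_simp
      ring
    · intro x; ring
    · intro x y; ring
    · intro x y; ring
    · intro x y; ring
    · exact near_of_hasDerivAt rfl (hasDerivAt_id 0)
  · obtain ⟨a, ha, haκ⟩ : ∃ a : ℝ, 0 < a ∧ κ = a ^ 2 :=
      ⟨√κ, Real.sqrt_pos.2 (by linarith), by rw [Real.sq_sqrt (by linarith)]⟩
    have hsq : √κ = a := by rw [haκ, Real.sqrt_sq ha.le]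
    have hcs := fun x : ℝ => Real.sin_sq_add_cos_sq x
    refine ⟨fun x => Real.sin (a * x) / a, fun x => (1 - Real.cos (a * x)) / a ^ 2, ?_, ?_, ?_,
      ?_, ?_, ?_⟩
    · intro s t d
      rw [cangleK, if_pos hκ, hsq, haκ]
      congr 1
      by_cases h1 : Real.sin (a * s) = 0
      · simp [h1]
      by_cases h2 : Real.sin (a * t) = 0
      · simp [h2]
      field_simp
      ring
    · intro x
      have := hcs (a * x)
      simp only [haκ]
      field_simp
      nlinarith
    · intro x y
      simp only [haκ, mul_sub, Real.sin_sub]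
      field_simp
      ring
    · intro x y
      simp only [haκ, mul_sub, Real.cos_sub]
      field_simp
      ring
    · intro x y
      have h1 : a * x = a * ((x + y) / 2) + a * ((x - y) / 2) := by ring
      have h2 : a * y = a * ((x + y) / 2) - a * ((x - y) / 2) := by ring
      simp only [h1, h2, Real.cos_sub, Real.cos_add]
      field_simp
      ring
    · refine near_of_hasDerivAt (by simp) ?_
      have h1 : HasDerivAt (fun x : ℝ => a * x) a 0 := by simpa using (hasDerivAt_id (0:ℝ)).const_mul a
      have h2 := (h1.sin).div_const a
      simpa [ha.ne'] using h2

/-- The cosine of the comparison angle before truncation by `arccos`. -/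
noncomputable def planeCos (κ : ℝ) (S m : ℝ → ℝ) (s t d : ℝ) : ℝ :=
  (m s + m t - κ * m s * m t - m d) / (S s * S t)

namespace PlaneTrig

variable {κ : ℝ} {S m : ℝ → ℝ}

theorem one_sub (h : PlaneTrig κ S m) {s t d : ℝ} (hs : 0 < S s) (ht : 0 < S t) :
    1 - planeCos κ S m s t d = 2 * S ((d + (s - t)) / 2) * S ((d - (s - t)) / 2) / (S s * S t) := by
  rw [← h.diff, h.msub, planeCos]
  field_simp
  ring

theorem one_add (h : PlaneTrig κ S m) {s t d : ℝ} (hs : 0 < S s) (ht : 0 < S t) :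
    1 + planeCos κ S m s t d =
      2 * S ((s + t + d) / 2) * S ((s + t - d) / 2) / (S s * S t) := by
  have hz : m 0 = 0 := by
    have := h.msub 0 0
    have h2 := h.sq 0
    simp at this
    nlinarith
  have hz' : S 0 = 0 := by
    have := h.sq 0
    rw [hz] at this
    simpa using this
  have h1 : m (s + t) = m s + m t - κ * m s * m t + S s * S t := by
    have := h.msub s (-t)
    have h2 := h.msub 0 t
    have h3 := h.ssub 0 t
    simp only [zero_sub, hz, hz'] at h2 h3
    rw [sub_neg_eq_add] at this
    rw [this, h2, h3]
    ring
  rw [← h.diff, h1, planeCos]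
  field_simp
  ring

/-- Adjacent comparison angles with nonnegative cosine sum give monotonicity. -/
theorem mono (h : PlaneTrig κ S m) {t l d A B : ℝ} (ht : 0 < S t) (hl : 0 < S l)
    (hlt : 0 < S (l - t)) (hd : 0 < S d) (hA : 0 < S A)
    (hsum : 0 ≤ planeCos κ S m t d A + planeCos κ S m (l - t) d B) :
    planeCos κ S m t A d ≤ planeCos κ S m l A B := by
  have h1 : 0 ≤ S (l - t) * (m t + m d - κ * m t * m d - m A) +
      S t * (m (l - t) + m d - κ * m (l - t) * m d - m B) := by
    have : S (l - t) * (m t + m d - κ * m t * m d - m A) +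
      S t * (m (l - t) + m d - κ * m (l - t) * m d - m B) =
      (planeCos κ S m t d A + planeCos κ S m (l - t) d B) * (S t * S d * S (l - t)) := by
      unfold planeCos
      field_simp
    rw [this]
    positivity
  unfold planeCos
  rw [div_le_div_iff₀ (by positivity) (by positivity)]
  have e1 := h.ssub l t
  have e2 := h.msub l t
  have e3 := h.sq t
  have key : S l * (m t + m A - κ * m t * m A - m d) ≤ S t * (m l + m A - κ * m l * m A - m B) := by
    rw [e1, e2] at h1
    refine le_of_sub_nonneg (h1.trans_eq ?_)
    linear_combination (S l * (κ * m d - 1)) * e3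
  nlinarith [mul_le_mul_of_nonneg_right key hA.le]

end PlaneTrig

theorem ratio_lower {ω w : ℝ} (h : ω = 16 * w) (h0 : 0 ≤ w) :
    (1 - ω) * (1 + w) ^ 2 ≤ (1 - w) ^ 2 := by
  have : (1 - w) ^ 2 - (1 - ω) * (1 + w) ^ 2 = 12 * w + 32 * w ^ 2 + 16 * w ^ 3 := by
    rw [h]; ring
  have h2 : 0 ≤ 12 * w + 32 * w ^ 2 + 16 * w ^ 3 := by positivity
  linarith

theorem ratio_upper {ω w : ℝ} (h : ω = 16 * w) (h0 : 0 ≤ w) (h1 : w ≤ 1 / 16) :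
    (1 + w) ^ 2 ≤ (1 + ω) * (1 - w) ^ 2 := by
  have : (1 + ω) * (1 - w) ^ 2 - (1 + w) ^ 2 = 4 * w * (3 - 8 * w) + 16 * w ^ 3 := by
    rw [h]; ring
  have h2 : 0 ≤ 4 * w * (3 - 8 * w) := mul_nonneg (by linarith) (by linarith)
  have h3 : 0 ≤ 16 * w ^ 3 := by positivity
  linarith

theorem PlaneTrig.compare {κ : ℝ} {S m : ℝ → ℝ} (h : PlaneTrig κ S m) {ω : ℝ} (hω : 0 < ω)
    (hω1 : ω ≤ 1) : ∃ r > 0, (∀ y, 0 < y → y ≤ 2 * r → 0 < S y) ∧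
      ∀ s t d, 0 < s → s ≤ r → 0 < t → t ≤ r → |s - t| ≤ d → d ≤ s + t →
        (1 - ω) * (1 - (s ^ 2 + t ^ 2 - d ^ 2) / (2 * s * t)) ≤ 1 - planeCos κ S m s t d ∧
        1 - planeCos κ S m s t d ≤ (1 + ω) * (1 - (s ^ 2 + t ^ 2 - d ^ 2) / (2 * s * t)) ∧
        -1 ≤ planeCos κ S m s t d := by
  obtain ⟨r, hr, hS⟩ := h.near (ω / 16) (by positivity)
  have hpos : ∀ y, 0 < y → y ≤ r → 0 < S y := fun y hy hyr => by
    have := (hS y hy.le hyr).1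
    nlinarith
  have hnn : ∀ y, 0 ≤ y → y ≤ r → 0 ≤ S y := fun y hy hyr => by
    have := (hS y hy hyr).1
    nlinarith
  refine ⟨r / 2, by positivity, fun y hy hyr => hpos y hy (by linarith), ?_⟩
  intro s t d hs hsr ht htr hd1 hd2
  have hSs := hpos s hs (by linarith)
  have hSt := hpos t ht (by linarith)
  rw [abs_le] at hd1
  rw [h.one_sub hSs hSt]
  have e0 : 1 - (s ^ 2 + t ^ 2 - d ^ 2) / (2 * s * t) =
      2 * ((d + (s - t)) / 2 * ((d - (s - t)) / 2)) / (s * t) := by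
    field_simp
    ring
  rw [e0]
  set p := (d + (s - t)) / 2 with hp
  set q := (d - (s - t)) / 2 with hq
  have hp0 : 0 ≤ p := by rw [hp]; linarith
  have hq0 : 0 ≤ q := by rw [hq]; linarith
  have hpr : p ≤ r := by rw [hp]; linarith
  have hqr : q ≤ r := by rw [hq]; linarith
  obtain ⟨p1, p2⟩ := hS p hp0 hpr
  obtain ⟨q1, q2⟩ := hS q hq0 hqr
  obtain ⟨s1, s2⟩ := hS s hs.le (by linarith)
  obtain ⟨t1, t2⟩ := hS t ht.le (by linarith)
  have hp' := hnn p hp0 hpr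
  have hq' := hnn q hq0 hqr
  set w := ω / 16 with hw
  have hw0 : 0 < w := by positivity
  have hw1 : w ≤ 1 / 16 := by rw [hw]; linarith
  have hωw : ω = 16 * w := by rw [hw]; ring
  have hw1' : 0 ≤ 1 - w := by linarith
  have pq1 : (1 - w) ^ 2 * (p * q) ≤ S p * S q := by
    calc (1 - w) ^ 2 * (p * q) = ((1 - w) * p) * ((1 - w) * q) := by ring
      _ ≤ _ := mul_le_mul p1 q1 (by positivity) hp'
  have pq2 : S p * S q ≤ (1 + w) ^ 2 * (p * q) := by
    calc S p * S q ≤ ((1 + w) * p) * ((1 + w) * q) := mul_le_mul p2 q2 hq' (by positivity)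
      _ = _ := by ring
  have st1 : (1 - w) ^ 2 * (s * t) ≤ S s * S t := by
    calc (1 - w) ^ 2 * (s * t) = ((1 - w) * s) * ((1 - w) * t) := by ring
      _ ≤ _ := mul_le_mul s1 t1 (by positivity) hSs.le
  have st2 : S s * S t ≤ (1 + w) ^ 2 * (s * t) := by
    calc S s * S t ≤ ((1 + w) * s) * ((1 + w) * t) := mul_le_mul s2 t2 hSt.le (by positivity)
      _ = _ := by ring
  have hst : 0 < s * t := by positivity
  have hSst : 0 < S s * S t := by positivity
  have hpq : 0 ≤ p * q := by positivity
  refine ⟨?_, ?_, ?_⟩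
  · rw [← mul_div_assoc, div_le_div_iff₀ hst hSst]
    have c1 : (1 - ω) * (1 + w) ^ 2 ≤ (1 - w) ^ 2 := ratio_lower hωw hw0.le
    have hneg : 0 ≤ 1 - ω := by linarith
    calc (1 - ω) * (2 * (p * q)) * (S s * S t)
        ≤ (1 - ω) * (2 * (p * q)) * ((1 + w) ^ 2 * (s * t)) := by gcongr
      _ = ((1 - ω) * (1 + w) ^ 2) * (2 * (p * q) * (s * t)) := by ring
      _ ≤ (1 - w) ^ 2 * (2 * (p * q) * (s * t)) := by gcongr
      _ = 2 * ((1 - w) ^ 2 * (p * q)) * (s * t) := by ring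
      _ ≤ 2 * (S p * S q) * (s * t) := by gcongr
      _ = _ := by ring
  · rw [← mul_div_assoc, div_le_div_iff₀ hSst hst]
    have c1 : (1 + w) ^ 2 ≤ (1 + ω) * (1 - w) ^ 2 := ratio_upper hωw hw0.le hw1
    calc 2 * S p * S q * (s * t) = 2 * (S p * S q) * (s * t) := by ring
      _ ≤ 2 * ((1 + w) ^ 2 * (p * q)) * (s * t) := by gcongr
      _ = (1 + w) ^ 2 * (2 * (p * q) * (s * t)) := by ring
      _ ≤ ((1 + ω) * (1 - w) ^ 2) * (2 * (p * q) * (s * t)) := by gcongr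
      _ = (1 + ω) * (2 * (p * q)) * ((1 - w) ^ 2 * (s * t)) := by ring
      _ ≤ _ := by gcongr
  · have h1 : 0 ≤ 1 + planeCos κ S m s t d := by
      rw [h.one_add hSs hSt]
      have a1 := hnn ((s + t + d) / 2) (by linarith) (by linarith)
      have a2 := hnn ((s + t - d) / 2) (by linarith) (by linarith)
      positivity
    linarith

section Metric
variable {X : Type} [MetricSpace X]

/-- Cosine of the Euclidean comparison angle at `x`. -/
noncomputable def cosC (x a b : X) : ℝ :=
  (dist x a ^ 2 + dist x b ^ 2 - dist a b ^ 2) / (2 * dist x a * dist x b)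

theorem cosC_comm (x a b : X) : cosC x a b = cosC x b a := by
  unfold cosC
  rw [dist_comm a b]
  ring

theorem cosC_mul {x a b : X} (ha : a ≠ x) (hb : b ≠ x) :
    dist a b ^ 2 = dist x a ^ 2 + dist x b ^ 2 - 2 * dist x a * dist x b * cosC x a b := by
  have h1 : 0 < dist x a := dist_pos.2 ha.symm
  have h2 : 0 < dist x b := dist_pos.2 hb.symm
  unfold cosC
  field_simp
  ring

theorem cosC_le_one {x a b : X} (ha : a ≠ x) (hb : b ≠ x) : cosC x a b ≤ 1 := by
  have h1 : 0 < dist x a := dist_pos.2 ha.symm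
  have h2 : 0 < dist x b := dist_pos.2 hb.symm
  have h3 : |dist x a - dist x b| ≤ dist a b := by
    rw [dist_comm x a, dist_comm x b]
    exact abs_dist_sub_le a b x
  rw [cosC, div_le_one (by positivity)]
  have := sq_abs (dist x a - dist x b)
  nlinarith [abs_nonneg (dist x a - dist x b)]

theorem neg_one_le_cosC {x a b : X} (ha : a ≠ x) (hb : b ≠ x) : -1 ≤ cosC x a b := by
  have h1 : 0 < dist x a := dist_pos.2 ha.symm
  have h2 : 0 < dist x b := dist_pos.2 hb.symm
  have h3 : dist a b ≤ dist x a + dist x b := dist_triangle_left a b x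
  rw [cosC, le_div_iff₀ (by positivity)]
  nlinarith [dist_nonneg (x := a) (y := b)]

/-- Local Alexandrov-type axioms at scale `R`, up to the error `e`, in Euclidean terms. -/
structure LAlex (X : Type) [MetricSpace X] (e R : ℝ) : Prop where
  geo : ∀ (x y : X) (t : ℝ), 0 ≤ t → t ≤ dist x y → ∃ z, dist x z = t ∧ dist z y = dist x y - t
  opp : ∀ θ : ℝ, 0 ≤ θ → ∀ x a b y : X, a ≠ x → b ≠ x → y ≠ x → dist x a ≤ R → dist x b ≤ R →
    dist x y ≤ R → cosC x a b ≤ -1 + θ ^ 2 → -(e + 3 * θ) ≤ cosC x a y + cosC x b y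
  hom : ∀ (x a b u v : X) (l : ℝ), dist x a ≤ R → dist x b ≤ R → 0 ≤ l → l ≤ 1 →
    dist x u = l * dist x a → dist u a = (1 - l) * dist x a →
    dist x v = l * dist x b → dist v b = (1 - l) * dist x b → l / 2 * dist a b ≤ dist u v

/-- Nearest points of `E` are almost critical at scale `R`. -/
def AlmostExt (e R : ℝ) (E : Set X) : Prop :=
  IsClosed E ∧ ∀ q ∉ E, ∀ p ∈ E, (∀ y ∈ E, dist q p ≤ dist q y) → ∀ w, w ≠ p →
    dist p q ≤ R → dist p w ≤ R → -e ≤ cosC p q w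

theorem exists_point_between [CompactSpace X]
    (hmid : ∀ x y : X, ∃ z : X, dist x z = dist x y / 2 ∧ dist z y = dist x y / 2)
    (x y : X) (t : ℝ) (ht : 0 ≤ t) (hty : t ≤ dist x y) :
    ∃ z, dist x z = t ∧ dist z y = dist x y - t := by
  let P : Set (X × X) := {p | dist x p.1 + dist p.1 p.2 + dist p.2 y = dist x y ∧
    dist x p.1 ≤ t ∧ t ≤ dist x p.1 + dist p.1 p.2}
  have hPc : IsCompact P := by
    apply IsClosed.isCompact
    have c1 : IsClosed {p : X × X | dist x p.1 + dist p.1 p.2 + dist p.2 y = dist x y} :=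
      isClosed_eq (by fun_prop) (by fun_prop)
    have c2 : IsClosed {p : X × X | dist x p.1 ≤ t} := isClosed_le (by fun_prop) (by fun_prop)
    have c3 : IsClosed {p : X × X | t ≤ dist x p.1 + dist p.1 p.2} :=
      isClosed_le (by fun_prop) (by fun_prop)
    exact c1.inter (c2.inter c3)
  have hPne : P.Nonempty := ⟨(x, y), by simp [P, ht, hty]⟩
  obtain ⟨p, ⟨hp1, hp2, hp3⟩, hpm⟩ := hPc.exists_isMinOn hPne
    (f := fun p => dist p.1 p.2) (by fun_prop)
  have h0 : dist p.1 p.2 = 0 := by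
    by_contra hne
    have hpos : 0 < dist p.1 p.2 := lt_of_le_of_ne dist_nonneg (Ne.symm hne)
    obtain ⟨u, hu1, hu2⟩ := hmid p.1 p.2
    have t1 := dist_triangle x p.1 u
    have t2 := dist_triangle u p.2 y
    have t3 := dist_triangle x u y
    rcases le_total t (dist x p.1 + dist p.1 u) with hc | hc
    · have : (p.1, u) ∈ P := ⟨by dsimp only; linarith, hp2, hc⟩
      have := hpm this
      simp only [mem_ofPred_eq] at this
      linarith
    · have : (u, p.2) ∈ P := ⟨by dsimp only; linarith, by dsimp only; linarith,
        by dsimp only; linarith⟩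
      have := hpm this
      simp only [mem_ofPred_eq] at this
      linarith
  have h1 : dist x p.1 = t := by linarith
  refine ⟨p.1, h1, ?_⟩
  have h2 := dist_eq_zero.1 h0
  rw [← h2, dist_self] at hp1
  linarith

end Metric

theorem cos_cangle_compare (κ : ℝ) {ω : ℝ} (hω : 0 < ω) (hω1 : ω ≤ 1) :
    ∃ S m : ℝ → ℝ, ∃ r > 0, PlaneTrig κ S m ∧ (∀ y, 0 < y → y ≤ 2 * r → 0 < S y) ∧
      ∀ (X : Type) [MetricSpace X] (x a b : X), a ≠ x → b ≠ x → dist x a ≤ r → dist x b ≤ r →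
        Real.cos (cangle κ a x b) = planeCos κ S m (dist x a) (dist x b) (dist a b) ∧
        (1 - ω) * (1 - cosC x a b) ≤ 1 - planeCos κ S m (dist x a) (dist x b) (dist a b) ∧
        1 - planeCos κ S m (dist x a) (dist x b) (dist a b) ≤ (1 + ω) * (1 - cosC x a b) := by
  obtain ⟨S, m, h⟩ := exists_planeTrig κ
  obtain ⟨r, hr, hS, hc⟩ := h.compare hω hω1
  refine ⟨S, m, r, hr, h, hS, ?_⟩
  intro X _ x a b ha hb har hbr
  have h3 : |dist x a - dist x b| ≤ dist a b := by
    rw [dist_comm x a, dist_comm x b]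
    exact abs_dist_sub_le a b x
  obtain ⟨h1, h2, h4⟩ := hc _ _ _ (dist_pos.2 ha.symm) har (dist_pos.2 hb.symm) hbr h3
    (dist_triangle_left a b x)
  refine ⟨?_, h1, h2⟩
  rw [cangle, h.ang]
  refine Real.cos_arccos h4 ?_
  have h5 := cosC_le_one ha hb
  have h6 : 0 ≤ (1 - ω) * (1 - cosC x a b) := mul_nonneg (by linarith) (by linarith)
  have h7 : 0 ≤ 1 - planeCos κ S m (dist x a) (dist x b) (dist a b) := le_trans h6 h1
  unfold planeCos at h7
  linarith

theorem add_cos_ge_of_add_add_le {α β γ u : ℝ} (hγ0 : 0 ≤ γ) (hγ : γ ≤ π) (hα0 : 0 ≤ α)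
    (hα : α ≤ π) (hβ0 : 0 ≤ β) (hβ : β ≤ π) (h : α + β + γ ≤ 2 * π) (hu : 0 ≤ u)
    (hc : (1 + Real.cos γ) / 2 ≤ u ^ 2) : -(2 * u) ≤ Real.cos α + Real.cos β := by
  have h1 : Real.cos (γ / 2) ≤ u := by
    have h2 : Real.cos (γ / 2) ^ 2 ≤ u ^ 2 := by
      rw [Real.cos_sq, mul_div_cancel₀ _ two_ne_zero]
      linarith
    exact abs_le_of_sq_le_sq' h2 hu |>.2
  have h3 : 0 ≤ Real.cos (γ / 2) := Real.cos_nonneg_of_mem_Icc ⟨by linarith, by linarith⟩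
  have h4 : -Real.cos (γ / 2) ≤ Real.cos ((α + β) / 2) := by
    rw [← Real.cos_pi_sub]
    apply Real.cos_le_cos_of_nonneg_of_le_pi <;> linarith
  have h5 : 0 ≤ Real.cos ((α - β) / 2) := Real.cos_nonneg_of_mem_Icc ⟨by linarith, by linarith⟩
  have h6 := Real.cos_le_one ((α - β) / 2)
  rw [Real.cos_add_cos]
  nlinarith

theorem cangle_nonneg {X : Type*} [MetricSpace X] (κ : ℝ) (q p r : X) : 0 ≤ cangle κ q p r := by
  unfold cangle cangleK
  split_ifs <;> exact Real.arccos_nonneg _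

theorem cangle_le_pi {X : Type*} [MetricSpace X] (κ : ℝ) (q p r : X) : cangle κ q p r ≤ π := by
  unfold cangle cangleK
  split_ifs <;> exact Real.arccos_le_pi _

/-- One-sided monotonicity of comparison angles along a geodesic. -/
theorem planeCos_mono_of_between {κ : ℝ} {S m : ℝ → ℝ} {r : ℝ} (h : PlaneTrig κ S m)
    (hS : ∀ y, 0 < y → y ≤ 2 * r → 0 < S y)
    {X : Type} [MetricSpace X]
    (hcos : ∀ x a b : X, a ≠ x → b ≠ x → dist x a ≤ 2 * r → dist x b ≤ 2 * r →
        Real.cos (cangle κ a x b) = planeCos κ S m (dist x a) (dist x b) (dist a b))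
    (hquad : ∀ p q r s : X, q ≠ p → r ≠ p → s ≠ p →
      cangle κ q p r + cangle κ r p s + cangle κ s p q ≤ 2 * π)
    {x a b u : X} (hb : b ≠ x) (hu : u ≠ x) (hua : u ≠ a) (hra : dist x a ≤ r)
    (hrb : dist x b ≤ r) (hxua : dist x u + dist u a = dist x a) :
    planeCos κ S m (dist x u) (dist x b) (dist u b) ≤
      planeCos κ S m (dist x a) (dist x b) (dist a b) := by
  have pu : 0 < dist x u := dist_pos.2 hu.symm
  have pa : 0 < dist u a := dist_pos.2 hua
  have pb : 0 < dist x b := dist_pos.2 hb.symm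
  have Su := hS _ pu (by linarith)
  have Sb := hS _ pb (by linarith)
  have Sa := hS (dist x a) (by linarith) (by linarith)
  have Sua := hS (dist u a) pa (by linarith)
  have hS0 : S 0 = 0 := by
    have := h.ssub 0 0
    simp only [sub_self] at this
    linear_combination this
  by_cases hub : u = b
  · have e1 : planeCos κ S m (dist x u) (dist x b) (dist u b) = 1 := by
      have := h.one_sub (s := dist x u) (t := dist x b) (d := dist u b) Su Sb
      rw [hub] at this ⊢
      simp [hS0] at this
      rw [dist_self]
      linarith
    have e2 : planeCos κ S m (dist x a) (dist x b) (dist a b) = 1 := by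
      have := h.one_sub (s := dist x a) (t := dist x b) (d := dist a b) Sa Sb
      have h0 : dist a b - (dist x a - dist x b) = 0 := by
        rw [← hub, dist_comm a u]
        linarith
      rw [h0] at this
      simp [hS0] at this
      linarith
    rw [e1, e2]
  · have pub : 0 < dist u b := dist_pos.2 hub
    have tub : dist u b ≤ dist x u + dist x b := dist_triangle_left u b x
    have Sub := hS _ pub (by linarith)
    refine h.mono Su Sa (by rwa [show dist x a - dist x u = dist u a by linarith]) Sub Sb ?_
    have hpi : Real.cos (cangle κ x u a) = -1 := by
      have hc := hcos u x a hu.symm hua.symm (by rw [dist_comm]; linarith) (by linarith)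
      rw [hc]
      have := h.one_add (s := dist u x) (t := dist u a) (d := dist x a)
        (by rwa [dist_comm]) Sua
      rw [dist_comm u x, show dist x u + dist u a - dist x a = 0 by linarith] at this
      simp [hS0] at this
      rw [dist_comm u x]
      linarith
    have hpi' : cangle κ x u a = π := by
      have h0 := cangle_nonneg κ x u a
      have h1 := cangle_le_pi κ x u a
      apply Real.injOn_cos ⟨h0, h1⟩ ⟨Real.pi_pos.le, le_rfl⟩
      rw [hpi, Real.cos_pi]
    have hq := hquad u x a b hu.symm hua.symm (Ne.symm hub)
    rw [hpi'] at hq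
    have h1 := cangle_nonneg κ a u b
    have h2 := cangle_nonneg κ b u x
    have c1 := hcos u b x (Ne.symm hub) hu.symm (by linarith) (by rw [dist_comm]; linarith)
    have c2 := hcos u a b hua.symm (Ne.symm hub) (by linarith) (by linarith)
    have h3 : Real.cos (π - cangle κ a u b) ≤ Real.cos (cangle κ b u x) :=
      Real.cos_le_cos_of_nonneg_of_le_pi h2 (by linarith) (by linarith)
    rw [Real.cos_pi_sub, c1, c2] at h3
    have e1 : planeCos κ S m (dist u b) (dist u x) (dist b x) =
        planeCos κ S m (dist x u) (dist u b) (dist x b) := by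
      rw [dist_comm u x, dist_comm b x]
      unfold planeCos
      ring
    rw [show dist x a - dist x u = dist u a by linarith]
    rw [e1] at h3
    linarith

/-- An Alexandrov space satisfies the almost-Euclidean axioms at a uniform small scale. -/
theorem exists_scale (κ : ℝ) {e : ℝ} (he : 0 < e) : ∃ R > 0, ∀ (X : Type) [MetricSpace X]
    [CompactSpace X], IsAlexandrov X κ → LAlex X e R ∧ ∀ E : Set X, IsExtremal κ E →
      AlmostExt e R E := by
  set η : ℝ := min (e / 10) (1 / 4) with hη
  have hη0 : 0 < η := lt_min (by positivity) (by norm_num)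
  have hη1 : η ≤ e / 10 := min_le_left _ _
  have hη2 : η ≤ 1 / 4 := min_le_right _ _
  set ω : ℝ := η ^ 2 with hω
  have hω0 : 0 < ω := by positivity
  have hωη : ω ≤ η / 4 := by rw [hω]; nlinarith
  obtain ⟨S, m, r, hr, h, hS, hcmp⟩ := cos_cangle_compare κ hω0 (by linarith)
  refine ⟨r / 2, by positivity, ?_⟩
  intro X _ _ hX
  obtain ⟨-, hmid, hquad⟩ := hX
  have hup : ∀ x a b : X, a ≠ x → b ≠ x → dist x a ≤ r → dist x b ≤ r →
      Real.cos (cangle κ a x b) ≤ cosC x a b + 2 * ω ∧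
      cosC x a b ≤ Real.cos (cangle κ a x b) + 2 * ω := by
    intro x a b ha hb h1 h2
    obtain ⟨c1, c2, c3⟩ := hcmp X x a b ha hb h1 h2
    have := neg_one_le_cosC ha hb
    rw [c1]
    constructor <;> nlinarith [cosC_le_one ha hb]
  refine ⟨⟨?_, ?_, ?_⟩, ?_⟩
  · intro x y t ht hty
    exact exists_point_between hmid x y t ht hty
  · intro θ hθ x a b y ha hb hy hxa hxb hxy hab
    have u1 := (hup x a b ha hb (by linarith) (by linarith)).1
    have u2 := (hup x a y ha hy (by linarith) (by linarith)).1
    have u3 := (hup x b y hb hy (by linarith) (by linarith)).1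
    have q := hquad x a y b ha hy hb
    have hc : cangle κ y x b = cangle κ b x y := by
      unfold cangle
      rw [dist_comm y b]
      unfold cangleK
      simp only [add_comm, mul_comm]
      split_ifs <;> ring_nf
    have hc2 : cangle κ b x a = cangle κ a x b := by
      unfold cangle
      rw [dist_comm b a]
      unfold cangleK
      simp only [add_comm, mul_comm]
      split_ifs <;> ring_nf
    rw [hc, hc2] at q
    have := add_cos_ge_of_add_add_le (u := θ + η) (cangle_nonneg κ a x b) (cangle_le_pi κ a x b)
      (cangle_nonneg κ a x y) (cangle_le_pi κ a x y) (cangle_nonneg κ b x y)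
      (cangle_le_pi κ b x y) q (by positivity)
      (by nlinarith)
    linarith
  · intro x a b u v l hxa hxb hl0 hl1 hxu hua hxv hvb
    by_cases ha : a = x
    · subst ha
      rw [dist_self, mul_zero] at hxu
      rw [dist_eq_zero.1 hxu] at hxv ⊢
      rw [hxv]
      nlinarith [mul_nonneg hl0 (dist_nonneg (x := u) (y := b))]
    by_cases hb : b = x
    · subst hb
      rw [dist_self, mul_zero] at hxv
      rw [dist_eq_zero.1 hxv] at hxu ⊢
      rw [dist_comm u v, hxu, dist_comm a v]
      nlinarith [mul_nonneg hl0 (dist_nonneg (x := v) (y := a))]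
    rcases hl0.eq_or_lt with rfl | hl0
    · simp
    rcases hl1.eq_or_lt with rfl | hl1
    · rw [sub_self, zero_mul] at hua hvb
      rw [dist_eq_zero.1 hua, dist_eq_zero.1 hvb]
      linarith [dist_nonneg (x := a) (y := b)]
    have pa : 0 < dist x a := dist_pos.2 (Ne.symm ha)
    have pb : 0 < dist x b := dist_pos.2 (Ne.symm hb)
    have hux : u ≠ x := by
      rintro rfl
      rw [dist_self] at hxu
      nlinarith
    have hvx : v ≠ x := by
      rintro rfl
      rw [dist_self] at hxv
      nlinarith
    have hua' : u ≠ a := by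
      rintro rfl
      rw [dist_self] at hua
      nlinarith
    have hvb' : v ≠ b := by
      rintro rfl
      rw [dist_self] at hvb
      nlinarith
    have hlu : dist x u ≤ dist x a := by rw [hxu]; nlinarith
    have hlv : dist x v ≤ dist x b := by rw [hxv]; nlinarith
    have m1 := planeCos_mono_of_between (r := r / 2) h (fun y hy hy2 => hS y hy (by linarith))
      (fun x a b ha hb h1 h2 => (hcmp X x a b ha hb (by linarith) (by linarith)).1) hquad
      (x := x) (a := a) (b := b) (u := u) hb hux hua' (by linarith) (by linarith)
      (by rw [hxu, hua]; ring)
    have m2 := planeCos_mono_of_between (r := r / 2) h (fun y hy hy2 => hS y hy (by linarith))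
      (fun x a b ha hb h1 h2 => (hcmp X x a b ha hb (by linarith) (by linarith)).1) hquad
      (x := x) (a := b) (b := u) (u := v) hux hvx hvb' (by linarith) (by linarith)
      (by rw [hxv, hvb]; ring)
    have pc : ∀ s t d, planeCos κ S m s t d = planeCos κ S m t s d := by
      intro s t d
      unfold planeCos
      ring
    rw [pc, dist_comm v u, pc (dist x b), dist_comm b u] at m2
    obtain ⟨-, -, k1⟩ := hcmp X x u v hux hvx (by linarith) (by linarith)
    obtain ⟨-, k2, -⟩ := hcmp X x a b ha hb (by linarith) (by linarith)
    have hab1 := cosC_le_one ha hb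
    have huv1 := cosC_le_one hux hvx
    have key : (1 - cosC x a b) / 2 ≤ 1 - cosC x u v := by
      have : (1 - ω) * (1 - cosC x a b) ≤ (1 + ω) * (1 - cosC x u v) := by linarith
      nlinarith
    have d1 := cosC_mul hux hvx
    have d2 := cosC_mul ha hb
    have hsq : (l / 2 * dist a b) ^ 2 ≤ dist u v ^ 2 := by
      rw [mul_pow, d2, d1, hxu, hxv]
      have hst : 0 ≤ l ^ 2 * (dist x a * dist x b) := by positivity
      have h1 := mul_le_mul_of_nonneg_left key hst
      nlinarith [mul_nonneg (sq_nonneg l) (sq_nonneg (dist x a - dist x b)),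
        mul_nonneg hst (sub_nonneg.2 hab1)]
    exact abs_le_of_sq_le_sq' hsq dist_nonneg |>.2
  · intro E hE
    refine ⟨hE.1, ?_⟩
    intro q hq p hp hmin w hw hpq hpw
    have hqp : q ≠ p := fun hh => hq (hh ▸ hp)
    have hcr := hE.2 q hq p hp (by
      filter_upwards [self_mem_nhdsWithin] with y hy using hmin y hy) w hw
    have u1 := (hup p q w hqp hw (by linarith) (by linarith)).1
    have : 0 ≤ Real.cos (cangle κ q p w) :=
      Real.cos_nonneg_of_mem_Icc ⟨by linarith [cangle_nonneg κ q p w, Real.pi_pos], hcr⟩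
    linarith

section Basic
variable {X : Type} [MetricSpace X] {e R : ℝ}

theorem cosC_bounds {x a y : X} (ha : a ≠ x) (hy : y ≠ x) :
    (dist x a - dist y a) / dist x y ≤ cosC x a y ∧
      cosC x a y ≤ (dist x a - dist y a) / dist x y + dist x y / (2 * dist x a) := by
  have h1 : 0 < dist x a := dist_pos.2 ha.symm
  have h2 : 0 < dist x y := dist_pos.2 hy.symm
  have h3 : |dist x a - dist y a| ≤ dist x y := abs_dist_sub_le x y a
  have h4 := abs_le_iff_mul_self_le.1 (h3.trans (le_abs_self _))
  have e1 : cosC x a y = (dist x a - dist y a) / dist x y +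
      (dist x y ^ 2 - (dist x a - dist y a) ^ 2) / (2 * dist x a * dist x y) := by
    unfold cosC
    rw [dist_comm a y]
    field_simp
    ring
  have e2 : dist x y / (2 * dist x a) = dist x y ^ 2 / (2 * dist x a * dist x y) := by
    field_simp
  rw [e1, e2]
  constructor
  · have : 0 ≤ (dist x y ^ 2 - (dist x a - dist y a) ^ 2) / (2 * dist x a * dist x y) := by
      apply div_nonneg _ (by positivity)
      nlinarith
    linarith
  · gcongr
    nlinarith [sq_nonneg (dist x a - dist y a)]

theorem cosC_eq_neg_one {x y z : X} (hx : x ≠ z) (hy : y ≠ z)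
    (h : dist x z + dist z y = dist x y) : cosC z x y = -1 := by
  have h1 : 0 < dist z x := dist_pos.2 hx.symm
  have h2 : 0 < dist z y := dist_pos.2 hy.symm
  unfold cosC
  rw [← h, dist_comm x z]
  field_simp
  ring

/-- Almost-concavity of the squared distance along a geodesic. -/
theorem LAlex.sq_dist_between (H : LAlex X e R) {x y z : X} (w : X)
    (h : dist x z + dist z y = dist x y) (hxy : dist x y ≤ R) (hzw : dist z w ≤ R) :
    dist z y * dist x w ^ 2 + dist x z * dist y w ^ 2 - dist x z * dist z y * dist x y -
      2 * e * dist z w * (dist x z * dist z y) ≤ dist x y * dist z w ^ 2 := by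
  by_cases h1 : x = z
  · subst h1
    rw [dist_self] at h ⊢
    nlinarith
  by_cases h2 : y = z
  · subst h2
    rw [dist_self] at h ⊢
    nlinarith
  by_cases h3 : w = z
  · subst h3
    rw [← h, dist_self, dist_comm y w]
    nlinarith
  have p1 : 0 < dist x z := dist_pos.2 h1
  have p2 : 0 < dist z y := dist_pos.2 (Ne.symm h2)
  have p3 : 0 < dist z w := dist_pos.2 (Ne.symm h3)
  have := H.opp 0 le_rfl z x y w h1 h2 h3 (by rw [dist_comm]; linarith) (by linarith) hzw
    (by rw [cosC_eq_neg_one h1 h2 h]; norm_num)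
  have c1 := cosC_mul h1 h3
  have c2 := cosC_mul h2 h3
  rw [dist_comm z x] at c1
  rw [← h, c1, c2]
  have h4 : 0 ≤ dist x z * dist z y * dist z w * (e + (cosC z x w + cosC z y w)) := by
    apply mul_nonneg (by positivity)
    linarith
  nlinarith

/-- Comparison angles at `x` essentially increase when one shortens a side. -/
theorem LAlex.cosC_shorten (H : LAlex X e R) {x a q w : X} (hq : q ≠ x) (hw : w ≠ x)
    (h : dist x q + dist q a = dist x a) (hxa : dist x a ≤ R) (hqw : dist q w ≤ R) (he : 0 ≤ e) :
    cosC x q w ≤ cosC x a w + e * (dist q w / dist x w) := by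
  have p1 : 0 < dist x q := dist_pos.2 hq.symm
  have p3 : 0 < dist x w := dist_pos.2 hw.symm
  have p2 : 0 < dist x a := by linarith [dist_nonneg (x := q) (y := a)]
  have hax : a ≠ x := (dist_pos.1 p2).symm
  have h1 := H.sq_dist_between w h hxa hqw
  rw [cosC_mul hq hw, cosC_mul hax hw] at h1
  have h2 : e * (dist q w / dist x w) * dist x w = e * dist q w := by field_simp
  have h3 : 0 ≤ e * dist q w * dist x q ^ 2 := by positivity
  by_contra! hcon
  have h4 := mul_lt_mul_of_pos_right hcon (show 0 < dist x q * dist x w * dist x a by positivity)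
  have h5 : dist q a = dist x a - dist x q := by linarith
  rw [h5] at h1
  have h6 : e * (dist q w / dist x w) * (dist x q * dist x w * dist x a) =
      e * dist q w * (dist x q * dist x a) := by
    linear_combination (dist x q * dist x a) * h2
  linarith

end Basic

/-- Compatibility conditions between the error `e`, the scale `R` of validity, the strainer
quality `η` and the strainer length `σ`. -/
structure SmallParam (e R η σ : ℝ) : Prop where
  e0 : 0 ≤ e
  e1 : e ≤ η ^ 2
  η0 : 0 < η
  η1 : η ≤ 1 / 1000
  σ0 : 0 < σ
  σR : 4 * σ ≤ R

/-- `k` pairs of points at distance about `σ` from `p` in almost orthogonal directions. -/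
structure Strainer {X : Type} [MetricSpace X] {k : ℕ} (η σ : ℝ) (p : X) (c : Fin k → Bool → X) :
    Prop where
  rad : ∀ i b, |dist p (c i b) - σ| ≤ η ^ 2 * σ
  opp : ∀ i b, (4 - η ^ 2) * σ ^ 2 ≤ dist (c i b) (c i !b) ^ 2
  cross : ∀ i j, i ≠ j → ∀ b b', (2 - η ^ 2) * σ ^ 2 ≤ dist (c i b) (c j b') ^ 2

section Str
variable {X : Type} [MetricSpace X] {e R η σ : ℝ} {k : ℕ} {p : X} {c : Fin k → Bool → X}

theorem SmallParam.sq_le (hP : SmallParam e R η σ) : η ^ 2 ≤ η / 1000 := by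
  nlinarith [hP.η0, hP.η1]

theorem Strainer.dist_near (hP : SmallParam e R η σ) (hc : Strainer η σ p c) {x : X}
    (hx : dist p x ≤ η ^ 2 * σ) (i : Fin k) (b : Bool) :
    (1 - 2 * η ^ 2) * σ ≤ dist x (c i b) ∧ dist x (c i b) ≤ (1 + 2 * η ^ 2) * σ := by
  have h1 := abs_le.1 (hc.rad i b)
  have h2 := dist_triangle_left x (c i b) p
  have h3 := dist_triangle p x (c i b)
  constructor <;> nlinarith

theorem Strainer.dist_near' (hP : SmallParam e R η σ) (hc : Strainer η σ p c) {x : X}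
    (hx : dist p x ≤ η ^ 2 * σ) (i : Fin k) (b : Bool) :
    (99 / 100) * σ ≤ dist x (c i b) ∧ dist x (c i b) ≤ (101 / 100) * σ := by
  obtain ⟨h1, h2⟩ := hc.dist_near hP hx i b
  have h3 := hP.sq_le
  have h4 := hP.η1
  have h5 := hP.σ0
  constructor <;> nlinarith

theorem Strainer.ne_near (hP : SmallParam e R η σ) (hc : Strainer η σ p c) {x : X}
    (hx : dist p x ≤ η ^ 2 * σ) (i : Fin k) (b : Bool) : c i b ≠ x := by
  have h := (hc.dist_near' hP hx i b).1
  have := hP.σ0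
  exact (dist_pos.1 (by linarith)).symm

theorem Strainer.opp_cos (hP : SmallParam e R η σ) (hc : Strainer η σ p c) {x : X}
    (hx : dist p x ≤ η ^ 2 * σ) (i : Fin k) (b : Bool) :
    cosC x (c i b) (c i !b) ≤ -1 + 9 * η ^ 2 := by
  obtain ⟨a1, a2⟩ := hc.dist_near hP hx i b
  obtain ⟨b1, b2⟩ := hc.dist_near hP hx i !b
  have h0 := hc.opp i b
  have h3 := hP.sq_le
  have h4 := hP.η1
  have hσ := hP.σ0
  have hη := hP.η0
  set A := dist x (c i b)
  set B := dist x (c i !b)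
  set D := dist (c i b) (c i !b)
  set d := η ^ 2
  have hd0 : 0 < d := by positivity
  have hd1 : d ≤ 1 / 1000 := by linarith
  have l0 : 0 < (1 - 2 * d) * σ := mul_pos (by linarith) hσ
  have hA : 0 < A := lt_of_lt_of_le l0 a1
  have hB : 0 < B := lt_of_lt_of_le l0 b1
  have hAB : (1 - 4 * d) * σ ^ 2 ≤ A * B := by
    calc (1 - 4 * d) * σ ^ 2 ≤ ((1 - 2 * d) * σ) * ((1 - 2 * d) * σ) := by nlinarith [sq_nonneg (d * σ)]
      _ ≤ _ := mul_le_mul a1 b1 l0.le hA.le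
  have hs : (A + B) ^ 2 ≤ (4 + 17 * d) * σ ^ 2 := by
    calc (A + B) ^ 2 ≤ (2 * ((1 + 2 * d) * σ)) ^ 2 := by gcongr; linarith
      _ = 4 * (1 + 4 * d + 4 * d * d) * σ ^ 2 := by ring
      _ ≤ _ := by gcongr; nlinarith
  rw [show cosC x (c i b) (c i !b) = (A ^ 2 + B ^ 2 - D ^ 2) / (2 * A * B) from rfl,
    div_le_iff₀ (by positivity)]
  have : 0 ≤ d * σ ^ 2 := by positivity
  have hd2 : d * (A * B) ≥ d * ((1 - 4 * d) * σ ^ 2) := by gcongr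
  nlinarith

theorem Strainer.opp_sum (H : LAlex X e R) (hP : SmallParam e R η σ) (hc : Strainer η σ p c) {x y : X}
    (hx : dist p x ≤ η ^ 2 * σ) (hy : y ≠ x) (hxy : dist x y ≤ R) (i : Fin k) (b : Bool) :
    -(10 * η) ≤ cosC x (c i b) y + cosC x (c i !b) y := by
  have h1 := hc.dist_near' hP hx i b
  have h2 := hc.dist_near' hP hx i !b
  have h3 := hP.σR
  have h4 := hP.σ0
  have h5 := hc.opp_cos hP hx i b
  have := H.opp (3 * η) (by linarith [hP.η0]) x (c i b) (c i !b) y (hc.ne_near hP hx i b)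
    (hc.ne_near hP hx i !b) hy (by linarith) (by linarith) hxy (by linarith)
  linarith [hP.e1, hP.sq_le, hP.η0]

theorem Strainer.half_ratio (hP : SmallParam e R η σ) (hc : Strainer η σ p c) {x : X}
    (hx : dist p x ≤ η ^ 2 * σ) {s : ℝ} (hs : s ≤ 2 * (η ^ 2 * σ)) (i : Fin k) (b : Bool) :
    s / (2 * dist x (c i b)) ≤ η / 500 := by
  have h1 := (hc.dist_near' hP hx i b).1
  have h2 := hP.sq_le
  have h4 := hP.σ0
  have hη := hP.η0
  rw [div_le_iff₀ (by linarith)]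
  have h5 : η ^ 2 * σ ≤ η / 1000 * σ := by gcongr
  have h6 : η * ((99 / 100) * σ) ≤ η * dist x (c i b) := by gcongr
  have h7 : 0 < η * σ := by positivity
  linarith

theorem Strainer.sum_sub_le (H : LAlex X e R) (hP : SmallParam e R η σ) (hc : Strainer η σ p c)
    {x y : X} (hx : dist p x ≤ η ^ 2 * σ) (hy : dist p y ≤ η ^ 2 * σ) (i : Fin k) (b : Bool) :
    dist y (c i b) + dist y (c i !b) - (dist x (c i b) + dist x (c i !b)) ≤ 11 * η * dist x y := by
  by_cases hyx : y = x
  · subst hyx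
    simp
  have hs : 0 < dist x y := dist_pos.2 (Ne.symm hyx)
  have hs2 : dist x y ≤ 2 * (η ^ 2 * σ) := by linarith [dist_triangle_left x y p]
  have h4 := hP.σ0
  have hη := hP.η0
  have hR : dist x y ≤ R := by
    have := hP.σR
    have h2 := hP.sq_le
    have h3 := hP.η1
    nlinarith
  have h1 := hc.opp_sum H hP hx hyx hR i b
  have h2 := (cosC_bounds (hc.ne_near hP hx i b) hyx).2
  have h3 := (cosC_bounds (hc.ne_near hP hx i !b) hyx).2
  have h5 := hc.half_ratio hP hx hs2 i b
  have h6 := hc.half_ratio hP hx hs2 i !b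
  have h7 : (dist x (c i b) - dist y (c i b)) / dist x y +
      (dist x (c i !b) - dist y (c i !b)) / dist x y ≥ -(11 * η) := by linarith
  rw [← add_div, ge_iff_le, le_div_iff₀ hs] at h7
  linarith

/-- Distance coordinate to the positive strainer point. -/
noncomputable def strCoord {k : ℕ} (c : Fin k → Bool → X) (x : X) (i : Fin k) : ℝ :=
  dist x (c i true)

theorem abs_strCoord_sub_le (c : Fin k → Bool → X) (x y : X) (i : Fin k) :
    |strCoord c x i - strCoord c y i| ≤ dist x y := abs_dist_sub_le x y _

theorem Strainer.sum_le' (H : LAlex X e R) (hP : SmallParam e R η σ) (hc : Strainer η σ p c)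
    {x y : X} (hx : dist p x ≤ η ^ 2 * σ) (hy : dist p y ≤ η ^ 2 * σ) (i : Fin k) :
    |dist y (c i false) - dist x (c i false) + (strCoord c y i - strCoord c x i)| ≤
      11 * η * dist x y := by
  have h1 := hc.sum_sub_le H hP hx hy i true
  have h2 := hc.sum_sub_le H hP hy hx i true
  rw [dist_comm y x] at h2
  simp only [Bool.not_true] at h1 h2
  unfold strCoord
  rw [abs_le]
  constructor <;> linarith

/-- If all strained distances decrease at most slowly, then the coordinates change slowly. -/
theorem Strainer.coord_of_forall (H : LAlex X e R) (hP : SmallParam e R η σ)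
    (hc : Strainer η σ p c) {x y : X} (hx : dist p x ≤ η ^ 2 * σ) (hy : dist p y ≤ η ^ 2 * σ)
    (i : Fin k) {K : ℝ} (h : ∀ b, dist x (c i b) - dist y (c i b) ≤ K * dist x y) (hK : K ≤ η) :
    |strCoord c x i - strCoord c y i| ≤ 12 * η * dist x y := by
  have h1 := abs_le.1 (hc.sum_le' H hP hx hy i)
  have h2 := h true
  have h3 := h false
  have h4 : K * dist x y ≤ η * dist x y := by gcongr
  have h5 := mul_nonneg hP.η0.le (dist_nonneg (x := x) (y := y))
  unfold strCoord at *
  rw [abs_le]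
  constructor <;> linarith

theorem Strainer.coord_nearest (H : LAlex X e R) (hP : SmallParam e R η σ) (hc : Strainer η σ p c)
    {E : Set X} (hE : AlmostExt e R E) {x q : X} (hx : dist p x ≤ η ^ 2 * σ)
    (hq : dist p q ≤ η ^ 2 * σ) (hxE : x ∈ E) (hqE : q ∉ E) (hmin : ∀ y ∈ E, dist q x ≤ dist q y)
    (i : Fin k) : |strCoord c q i - strCoord c x i| ≤ 12 * η * dist q x := by
  have hqx : q ≠ x := fun h => hqE (h ▸ hxE)
  have hs : 0 < dist x q := dist_pos.2 hqx.symm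
  have hs2 : dist x q ≤ 2 * (η ^ 2 * σ) := by linarith [dist_triangle_left x q p]
  have hR1 := hP.σR
  have hσ := hP.σ0
  have hR : dist x q ≤ R := by
    have h2 := hP.sq_le
    have h3 := hP.η1
    nlinarith
  rw [abs_sub_comm, dist_comm q x]
  rw [abs_sub_comm]
  have key := hc.coord_of_forall H hP hq hx i (K := η) ?_ le_rfl
  · rwa [dist_comm q x] at key
  intro b
  have h1 := hE.2 q hqE x hxE hmin (c i b) (hc.ne_near hP hx i b) hR
    (by linarith [(hc.dist_near' hP hx i b).2])
  rw [cosC_comm] at h1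
  have h2 := (cosC_bounds (hc.ne_near hP hx i b) hqx).2
  have h5 := hc.half_ratio hP hx hs2 i b
  have h6 := hP.e1
  have h7 := hP.sq_le
  have hη := hP.η0
  have h8 : -η ≤ (dist x (c i b) - dist q (c i b)) / dist x q := by linarith
  rw [le_div_iff₀ hs] at h8
  rw [dist_comm q x]
  linarith

end Str

section Str
variable {X : Type} [MetricSpace X] {e R η σ : ℝ} {k : ℕ} {p : X} {c : Fin k → Bool → X}

theorem hinge_lower_aux {e η t l D F Q : ℝ} (he : e ≤ η) (ht : 0 ≤ t) (hl : 0 < l) (hD : 0 ≤ D)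
    (hη : 0 ≤ η) (hDl : D ≤ η * l) (hQ0 : 0 ≤ Q) (hQ : Q ≤ t + D) (htl : t ≤ l)
    (h : (l - t) * D ^ 2 + t * F ^ 2 - t * (l - t) * l - 2 * e * Q * (t * (l - t)) ≤ l * Q ^ 2) :
    t ^ 2 + D ^ 2 - 2 * t * (l - F) - 50 * η * t * (t + D) ≤ Q ^ 2 := by
  have h1 : e * Q * (t * (l - t)) ≤ η * (t + D) * (t * l) := by
    calc e * Q * (t * (l - t)) ≤ η * Q * (t * (l - t)) := by
          have : 0 ≤ Q * (t * (l - t)) := mul_nonneg hQ0 (mul_nonneg ht (by linarith))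
          nlinarith
      _ ≤ η * (t + D) * (t * l) := by
          apply mul_le_mul _ _ (mul_nonneg ht (by linarith)) (by positivity)
          · gcongr
          · gcongr
            linarith
  have h2 : t * D ^ 2 ≤ η * t * D * l := by
    have := mul_le_mul_of_nonneg_left hDl (mul_nonneg ht hD)
    linarith
  have h3 : 0 ≤ t * (F - l) ^ 2 := by positivity
  have h4 : 0 ≤ η * t * t * l := by positivity
  have h5 : 0 ≤ η * t * D * l := by positivity
  have : l * (t ^ 2 + D ^ 2 - 2 * t * (l - F) - 50 * η * t * (t + D)) ≤ l * Q ^ 2 := by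
    refine le_trans ?_ h
    linarith
  exact le_of_mul_le_mul_left this hl

theorem Strainer.ne_self (hP : SmallParam e R η σ) (hc : Strainer η σ p c) {x : X}
    (hx : dist p x ≤ η ^ 2 * σ) (i : Fin k) (b : Bool) : 0 < dist x (c i b) := by
  have h := (hc.dist_near' hP hx i b).1
  have := hP.σ0
  linarith

theorem SmallParam.rad_le (hP : SmallParam e R η σ) : η ^ 2 * σ ≤ η * σ / 1000 := by
  have := mul_le_mul_of_nonneg_right hP.sq_le hP.σ0.le
  linarith

theorem SmallParam.rad_le' (hP : SmallParam e R η σ) : η ^ 2 * σ ≤ σ / 1000000 := by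
  have h1 := hP.rad_le
  have h2 := mul_le_mul_of_nonneg_right hP.η1 hP.σ0.le
  linarith

theorem Strainer.hinge_lower (H : LAlex X e R) (hP : SmallParam e R η σ) (hc : Strainer η σ p c)
    {z z' w : X} {t : ℝ} (ht : 0 ≤ t) (hz : dist p z + t ≤ η ^ 2 * σ) (hw : dist p w ≤ η ^ 2 * σ)
    (i : Fin k) (b : Bool) (hzt : dist z z' = t) (hzc : dist z' (c i b) = dist z (c i b) - t) :
    t ^ 2 + dist z w ^ 2 - 2 * t * (dist z (c i b) - dist w (c i b)) -
      50 * η * t * (t + dist z w) ≤ dist z' w ^ 2 := by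
  have hz0 : dist p z ≤ η ^ 2 * σ := by linarith
  have hz' : dist p z' ≤ η ^ 2 * σ := by linarith [dist_triangle p z z']
  have hσ := hP.σ0
  have hσR := hP.σR
  have hr := hP.rad_le
  have hr' := hP.rad_le'
  obtain ⟨n1, n2⟩ := hc.dist_near' hP hz0 i b
  have hD : dist z w ≤ 2 * (η ^ 2 * σ) := by linarith [dist_triangle_left z w p]
  have hQ : dist z' w ≤ 2 * (η ^ 2 * σ) := by linarith [dist_triangle_left z' w p]
  have h := H.sq_dist_between (x := z) (y := c i b) (z := z') w (by rw [hzt, hzc]; ring)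
    (by linarith) (by linarith)
  rw [hzc, hzt, dist_comm (c i b) w] at h
  have hηl : η * ((99 / 100) * σ) ≤ η * dist z (c i b) := by have := hP.η0; gcongr
  refine hinge_lower_aux (l := dist z (c i b)) (e := e) ?_ ht (hc.ne_self hP hz0 i b) dist_nonneg
    hP.η0.le ?_ dist_nonneg ?_ ?_ ?_
  · linarith [hP.e1, hP.sq_le, hP.η0]
  · linarith [mul_pos hP.η0 hσ]
  · rw [← hzt]; exact dist_triangle_left _ _ _
  · linarith [dist_nonneg (x := p) (y := z)]
  · linarith

theorem Strainer.hinge_upper (H : LAlex X e R) (hP : SmallParam e R η σ) (hc : Strainer η σ p c)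
    {z z' w : X} {t : ℝ} (ht : 0 ≤ t) (hz : dist p z + t ≤ η ^ 2 * σ) (hw : dist p w ≤ η ^ 2 * σ)
    (i : Fin k) (b : Bool) (hzt : dist z z' = t) (hzc : dist z' (c i b) = dist z (c i b) - t) :
    dist z' w ^ 2 ≤ t ^ 2 + dist z w ^ 2 - 2 * t * (dist z (c i b) - dist w (c i b)) +
      50 * η * t * (t + dist z w) := by
  have hη := hP.η0
  rcases ht.eq_or_lt with rfl | ht
  · rw [dist_eq_zero.1 hzt]
    simp
  by_cases hwz : w = z
  · subst hwz
    rw [dist_comm z', hzt, dist_self]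
    nlinarith [mul_nonneg hη.le (sq_nonneg t)]
  have hz0 : dist p z ≤ η ^ 2 * σ := by linarith
  have hz' : dist p z' ≤ η ^ 2 * σ := by linarith [dist_triangle p z z']
  have hσ := hP.σ0
  have hσR := hP.σR
  have hr' := hP.rad_le'
  have hzz' : z' ≠ z := (dist_pos.1 (by rw [hzt]; exact ht)).symm
  have hD0 : 0 < dist z w := dist_pos.2 (Ne.symm hwz)
  have hD : dist z w ≤ 2 * (η ^ 2 * σ) := by linarith [dist_triangle_left z w p]
  obtain ⟨n1, n2⟩ := hc.dist_near' hP hz0 i b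
  obtain ⟨m1, m2⟩ := hc.dist_near' hP hz0 i !b
  have hzm : dist z' (c i !b) ≤ (101 / 100) * σ := (hc.dist_near' hP hz' i !b).2
  have s1 := H.cosC_shorten (x := z) (a := c i b) (q := z') (w := c i !b) hzz'
    (hc.ne_near hP hz0 i !b) (by rw [hzt, hzc]; ring) (by linarith) (by linarith) hP.e0
  have s2 := hc.opp_cos hP hz0 i b
  have s3 : dist z' (c i !b) / dist z (c i !b) ≤ 2 := by
    rw [div_le_iff₀ (by linarith)]
    linarith
  have s4 : e * (dist z' (c i !b) / dist z (c i !b)) ≤ η ^ 2 * 2 :=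
    mul_le_mul hP.e1 s3 (by positivity) (by positivity)
  have s5 := H.opp (7 / 2 * η) (by positivity) z z' (c i !b) w hzz' (hc.ne_near hP hz0 i !b)
    hwz (by rw [hzt]; linarith [dist_nonneg (x := p) (y := z)]) (by linarith) (by linarith)
    (by linarith [sq_nonneg η])
  have s6 := (cosC_bounds (hc.ne_near hP hz0 i !b) hwz).2
  have s7 := hc.half_ratio hP hz0 hD i !b
  have s8 := hP.e1
  have s9 := hP.sq_le
  have u1 := hc.sum_sub_le H hP hw hz0 i b
  have u2 : (dist z (c i !b) - dist w (c i !b)) / dist z w ≤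
      (dist w (c i b) - dist z (c i b)) / dist z w + 11 * η := by
    rw [div_add' _ _ _ hD0.ne']
    gcongr
    rw [dist_comm w z] at u1
    linarith
  have u3 : (dist z (c i b) - dist w (c i b)) / dist z w - 23 * η ≤ cosC z z' w := by
    have : (dist z (c i b) - dist w (c i b)) / dist z w =
        -((dist w (c i b) - dist z (c i b)) / dist z w) := by ring
    linarith
  rw [cosC_mul hzz' hwz, hzt]
  have u4 := mul_le_mul_of_nonneg_left u3 (show 0 ≤ 2 * t * dist z w by positivity)
  have u5 : 2 * t * dist z w * ((dist z (c i b) - dist w (c i b)) / dist z w - 23 * η) =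
      2 * t * (dist z (c i b) - dist w (c i b)) - 46 * η * t * dist z w := by
    field_simp
    ring
  have u6 : 0 ≤ η * t * dist z w := by positivity
  have u7 : 0 ≤ η * t * t := by positivity
  linarith

theorem Strainer.cross_change (H : LAlex X e R) (hP : SmallParam e R η σ) (hc : Strainer η σ p c)
    {z z' : X} {t : ℝ} (ht : 0 ≤ t) (hz : dist p z + t ≤ η ^ 2 * σ)
    (i : Fin k) (b : Bool) (hzt : dist z z' = t) (hzc : dist z' (c i b) = dist z (c i b) - t)
    {j : Fin k} (hj : i ≠ j) : |strCoord c z' j - strCoord c z j| ≤ 12 * η * t := by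
  have hη := hP.η0
  have hz0 : dist p z ≤ η ^ 2 * σ := by linarith
  have hz' : dist p z' ≤ η ^ 2 * σ := by linarith [dist_triangle p z z']
  have hσ := hP.σ0
  have hσR := hP.σR
  have hr' := hP.rad_le'
  rw [abs_sub_comm]
  have key := hc.coord_of_forall H hP hz0 hz' j (K := η) ?_ le_rfl
  · rwa [hzt] at key
  intro b'
  rw [hzt]
  obtain ⟨n1, n2⟩ := hc.dist_near hP hz0 i b
  obtain ⟨n1', n2'⟩ := hc.dist_near' hP hz0 i b
  obtain ⟨m1, m2⟩ := hc.dist_near hP hz0 j b'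
  obtain ⟨m1', m2'⟩ := hc.dist_near' hP hz0 j b'
  obtain ⟨m3, m4⟩ := hc.dist_near' hP hz' j b'
  have h := H.sq_dist_between (x := z) (y := c i b) (z := z') (c j b')
    (by rw [hzt, hzc]; ring) (by linarith) (by linarith)
  rw [hzc, hzt] at h
  have hx := hc.cross i j hj b b'
  have he1 := hP.e1
  have he0 := hP.e0
  have hs := hP.sq_le
  have hs1 := hP.η1
  set l := dist z (c i b)
  set A := dist z (c j b')
  set A' := dist z' (c j b')
  set d := η ^ 2
  have hd0 : 0 < d := by positivity
  have hd1 : d ≤ 1 / 1000 := by linarith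
  have htl : t ≤ l := by linarith [dist_nonneg (x := p) (y := z)]
  have hdd : d * d ≤ d * (1 / 1000) := by gcongr
  have q1 : l ^ 2 ≤ (1 + 5 * d) * σ ^ 2 := by
    calc l ^ 2 ≤ ((1 + 2 * d) * σ) ^ 2 := by gcongr
      _ = (1 + 4 * d + 4 * d * d) * σ ^ 2 := by ring
      _ ≤ _ := mul_le_mul_of_nonneg_right (by linarith) (sq_nonneg σ)
  have q2 : A ^ 2 ≤ (1 + 5 * d) * σ ^ 2 := by
    calc A ^ 2 ≤ ((1 + 2 * d) * σ) ^ 2 := by gcongr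
      _ = (1 + 4 * d + 4 * d * d) * σ ^ 2 := by ring
      _ ≤ _ := mul_le_mul_of_nonneg_right (by linarith) (sq_nonneg σ)
  have q3 : l * A ^ 2 - 11 * d * t * σ ^ 2 - 2 * e * A' * (t * (l - t)) ≤ l * A' ^ 2 := by
    refine le_trans ?_ h
    have a1 := mul_le_mul_of_nonneg_left hx ht
    have a2 := mul_le_mul_of_nonneg_left q1 ht
    have a3 := mul_le_mul_of_nonneg_left q2 ht
    have a4 : 0 ≤ t * t * l := by positivity
    linarith
  have q4 : e * A' * (t * (l - t)) ≤ d * ((101 / 100) * σ) * (t * l) := by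
    apply mul_le_mul _ _ (mul_nonneg ht (by linarith)) (by positivity)
    · exact mul_le_mul he1 m4 dist_nonneg hd0.le
    · gcongr; linarith
  have q5 : l * A ^ 2 - 15 * d * t * σ * l ≤ l * A' ^ 2 := by
    have := mul_le_mul_of_nonneg_left n1' (show 0 ≤ d * t * σ by positivity)
    have : 0 ≤ d * t * σ * l := by positivity
    linarith
  have q6 : A ^ 2 - 15 * d * t * σ ≤ A' ^ 2 := by
    have hl : 0 < l := by linarith
    refine le_of_mul_le_mul_left ?_ hl
    linarith
  by_contra! hcon
  have q7 : (A - A') * σ ≤ (A - A') * (A + A') :=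
    mul_le_mul_of_nonneg_left (by linarith) (by linarith [show 0 ≤ η * t by positivity])
  have q8 : η * t * σ < (A - A') * σ := by gcongr
  have q9 : d * t * σ ≤ η / 1000 * t * σ := by gcongr
  linarith [show 0 ≤ η * t * σ by positivity]

/-- Change the `i`-th coordinate by `u`. -/
theorem Strainer.exists_move (H : LAlex X e R) (hP : SmallParam e R η σ) (hc : Strainer η σ p c)
    {z : X} {u : ℝ} (hz : dist p z + |u| ≤ η ^ 2 * σ) (i : Fin k) :
    ∃ z', dist z z' = |u| ∧
      (∀ j, |strCoord c z' j - strCoord c z j - (if j = i then u else 0)| ≤ 12 * η * |u|) ∧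
      ∀ w, dist p w ≤ η ^ 2 * σ →
        |dist z' w ^ 2 - (dist z w ^ 2 + (u ^ 2 + 2 * u * (strCoord c z i - strCoord c w i)))| ≤
          75 * η * |u| * (dist z w + |u|) := by
  have hη := hP.η0
  have hσ := hP.σ0
  have hr' := hP.rad_le'
  have hz0 : dist p z ≤ η ^ 2 * σ := by linarith [abs_nonneg u]
  have hp := dist_nonneg (x := p) (y := z)
  rcases le_total 0 u with hu | hu
  · rw [abs_of_nonneg hu] at *
    have n1 := (hc.dist_near' hP hz0 i false).1
    obtain ⟨z', h1, h2⟩ := H.geo z (c i false) u hu (by linarith)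
    have hz' : dist p z' ≤ η ^ 2 * σ := by linarith [dist_triangle p z z']
    refine ⟨z', h1, ?_, ?_⟩
    · intro j
      split_ifs with hj
      · subst hj
        have h3 := abs_le.1 (hc.sum_le' H hP hz0 hz' j)
        rw [h1, h2] at h3
        have : 0 ≤ η * u := by positivity
        rw [abs_le]
        constructor <;> linarith
      · rw [sub_zero]
        exact hc.cross_change H hP hu hz i false h1 h2 (Ne.symm hj)
    · intro w hw
      have l1 := hc.hinge_lower H hP hu hz hw i false h1 h2
      have l2 := hc.hinge_upper H hP hu hz hw i false h1 h2
      have h3 := abs_le.1 (hc.sum_le' H hP hw hz0 i)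
      rw [dist_comm w z] at h3
      have k1 := mul_le_mul_of_nonneg_left h3.1 hu
      have k2 := mul_le_mul_of_nonneg_left h3.2 hu
      have : 0 ≤ η * u * dist z w := by positivity
      have : 0 ≤ η * u * u := by positivity
      rw [abs_le]
      constructor <;> linarith
  · obtain ⟨t, rfl⟩ : ∃ t, u = -t := ⟨-u, by ring⟩
    have ht : 0 ≤ t := by linarith
    rw [abs_neg, abs_of_nonneg ht] at *
    have n1 := (hc.dist_near' hP hz0 i true).1
    obtain ⟨z', h1, h2⟩ := H.geo z (c i true) t ht (by linarith)
    have hz' : dist p z' ≤ η ^ 2 * σ := by linarith [dist_triangle p z z']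
    have : 0 ≤ η * t := by positivity
    refine ⟨z', h1, ?_, ?_⟩
    · intro j
      split_ifs with hj
      · subst hj
        unfold strCoord
        rw [h2, abs_le]
        constructor <;> linarith
      · rw [sub_zero]
        exact hc.cross_change H hP ht hz i true h1 h2 (Ne.symm hj)
    · intro w hw
      have l1 := hc.hinge_lower H hP ht hz hw i true h1 h2
      have l2 := hc.hinge_upper H hP ht hz hw i true h1 h2
      have : 0 ≤ η * t * dist z w := by positivity
      have : 0 ≤ η * t * t := by positivity
      unfold strCoord
      rw [abs_le]
      constructor <;> linarith

end Str

section Str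
variable {X : Type} [MetricSpace X] {e R η σ : ℝ} {k : ℕ} {p : X} {c : Fin k → Bool → X}

theorem Strainer.exists_multi_move_aux (H : LAlex X e R) (hP : SmallParam e R η σ)
    (hc : Strainer η σ p c) {x : X} {v : Fin k → ℝ} {T : ℝ} (hT : dist p x + T ≤ η ^ 2 * σ)
    (s : Finset (Fin k)) (hs : ∑ i ∈ s, |v i| ≤ T) :
    ∃ q, dist x q ≤ ∑ i ∈ s, |v i| ∧
      (∀ j, |strCoord c q j - strCoord c x j - (if j ∈ s then v j else 0)| ≤
        12 * η * ∑ i ∈ s, |v i|) ∧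
      ∀ w, dist p w ≤ η ^ 2 * σ →
        |dist q w ^ 2 - (dist x w ^ 2 +
          ∑ i ∈ s, (v i ^ 2 + 2 * v i * (strCoord c x i - strCoord c w i)))| ≤
          175 * η * (∑ i ∈ s, |v i|) * (dist x w + T) := by
  have hη := hP.η0
  induction s using Finset.induction_on with
  | empty => exact ⟨x, by simp, by simp, by simp⟩
  | insert i s hi ih =>
    rw [Finset.sum_insert hi] at hs
    have hs0 : 0 ≤ ∑ i ∈ s, |v i| := Finset.sum_nonneg fun _ _ => abs_nonneg _
    have hv := abs_nonneg (v i)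
    obtain ⟨q, q1, q2, q3⟩ := ih (by linarith)
    obtain ⟨q', m1, m2, m3⟩ := hc.exists_move H hP (z := q) (u := v i)
      (by linarith [dist_triangle p x q]) i
    rw [Finset.sum_insert hi]
    refine ⟨q', by linarith [dist_triangle x q q'], ?_, ?_⟩
    · intro j
      have a1 := abs_le.1 (m2 j)
      have a2 := abs_le.1 (q2 j)
      have : (if j ∈ insert i s then v j else 0) =
          (if j = i then v i else 0) + (if j ∈ s then v j else 0) := by
        by_cases hj : j = i
        · subst hj
          simp [hi]
        · simp [hj]
      rw [this, abs_le]
      constructor <;> linarith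
    · intro w hw
      rw [Finset.sum_insert hi]
      have a1 := q3 w hw
      have a2 := m3 w hw
      have a3 := q2 i
      rw [if_neg hi, sub_zero] at a3
      have a4 : dist q w ≤ dist x w + T := by linarith [dist_triangle_left q w x]
      have a5 : |2 * v i * (strCoord c q i - strCoord c x i)| ≤ 24 * η * |v i| * T := by
        rw [abs_mul, abs_mul, abs_two]
        calc 2 * |v i| * |strCoord c q i - strCoord c x i|
            ≤ 2 * |v i| * (12 * η * T) := by
              gcongr
              refine a3.trans ?_
              gcongr
              linarith
          _ = _ := by ring
      have a6 : 75 * η * |v i| * (dist q w + |v i|) ≤ 75 * η * |v i| * (dist x w + 2 * T) :=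
        mul_le_mul_of_nonneg_left (by linarith) (by positivity)
      have a7 := abs_le.1 (a2.trans a6)
      have a8 := abs_le.1 a5
      have a9 := abs_le.1 a1
      have a10 : 0 ≤ η * |v i| * dist x w := by positivity
      have a11 : 0 ≤ η * |v i| * T := by
        have : 0 ≤ T := by linarith
        positivity
      rw [abs_le]
      constructor <;> linarith

/-- Move a point so that its coordinates change by approximately `v`, with control on all
distances. -/
theorem Strainer.exists_multi_move (H : LAlex X e R) (hP : SmallParam e R η σ)
    (hc : Strainer η σ p c) {x : X} {v : Fin k → ℝ} (hT : dist p x + ∑ i, |v i| ≤ η ^ 2 * σ) :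
    ∃ q, dist x q ≤ ∑ i, |v i| ∧
      (∀ j, |strCoord c q j - strCoord c x j - v j| ≤ 12 * η * ∑ i, |v i|) ∧
      ∀ w, dist p w ≤ η ^ 2 * σ →
        |dist q w ^ 2 - (dist x w ^ 2 +
          ∑ i, (v i ^ 2 + 2 * v i * (strCoord c x i - strCoord c w i)))| ≤
          175 * η * (∑ i, |v i|) * (dist x w + ∑ i, |v i|) := by
  obtain ⟨q, h1, h2, h3⟩ := hc.exists_multi_move_aux H hP hT Finset.univ le_rfl
  exact ⟨q, h1, by simpa using h2, h3⟩

theorem sum_abs_sub_le_mul (c : Fin k → Bool → X) (x y : X) :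
    ∑ i, |strCoord c x i - strCoord c y i| ≤ k * dist x y := by
  have := Finset.sum_le_sum fun i (_ : i ∈ Finset.univ) => abs_strCoord_sub_le c x y i
  simpa using this

/-- The coordinates are almost `1`-Lipschitz for the Euclidean norm. -/
theorem Strainer.sum_sq_le (H : LAlex X e R) (hP : SmallParam e R η σ) (hc : Strainer η σ p c)
    {x y : X} (hx : dist p x ≤ η ^ 2 * σ) (hy : dist p y + k * dist x y ≤ η ^ 2 * σ) :
    ∑ i, (strCoord c x i - strCoord c y i) ^ 2 ≤
      (1 + 175 * η * k * (k + 1)) * dist x y ^ 2 := by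
  have hη := hP.η0
  have hT := sum_abs_sub_le_mul c x y
  obtain ⟨q, -, -, h3⟩ := hc.exists_multi_move H hP (x := y)
    (v := fun i => strCoord c x i - strCoord c y i) (by linarith)
  have h5 : ∑ i, ((strCoord c x i - strCoord c y i) ^ 2 +
      2 * (strCoord c x i - strCoord c y i) * (strCoord c y i - strCoord c x i)) =
      -∑ i, (strCoord c x i - strCoord c y i) ^ 2 := by
    rw [← Finset.sum_neg_distrib]
    exact Finset.sum_congr rfl fun i _ => by ring
  have h7 : 175 * η * (∑ i, |strCoord c x i - strCoord c y i|) *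
      (dist x y + ∑ i, |strCoord c x i - strCoord c y i|) ≤
      175 * η * (k * dist x y) * (dist x y + k * dist x y) := by
    have : 0 ≤ ∑ i, |strCoord c x i - strCoord c y i| := Finset.sum_nonneg fun _ _ => abs_nonneg _
    gcongr
  have h6 := (abs_le.1 (h3 x hx)).2
  rw [h5, dist_comm y x] at h6
  have := sq_nonneg (dist q x)
  linarith

/-- Openness of the coordinates on an almost extremal set. -/
theorem Strainer.exists_coord_eq [CompactSpace X] (H : LAlex X e R) (hP : SmallParam e R η σ)
    (hc : Strainer η σ p c) {E : Set X} (hE : AlmostExt e R E) (hk : 100 * η * k ≤ 1) {x : X}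
    (hxE : x ∈ E) {v : Fin k → ℝ} (hT : dist p x + 8 * ∑ i, |v i| ≤ η ^ 2 * σ) :
    ∃ y ∈ E, (∀ j, strCoord c y j = strCoord c x j + v j) ∧ dist x y ≤ 4 * ∑ i, |v i| := by
  have hη := hP.η0
  have hcont : ∀ j, Continuous fun y => strCoord c y j := fun j => by
    unfold strCoord
    fun_prop
  obtain ⟨y, hyE, hy⟩ := hE.1.isCompact.exists_isMinOn ⟨x, hxE⟩
    (f := fun y => ∑ j, |strCoord c y j - (strCoord c x j + v j)| + 1 / 4 * dist x y)
    (by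
      apply Continuous.continuousOn
      apply Continuous.add
      · exact continuous_finsetSum _ fun j _ => ((hcont j).sub continuous_const).abs
      · fun_prop)
  set T0 := ∑ i, |v i| with hT0
  set T := ∑ j, |strCoord c y j - (strCoord c x j + v j)| with hTdef
  have hTnn : 0 ≤ T := Finset.sum_nonneg fun _ _ => abs_nonneg _
  have hT0nn : 0 ≤ T0 := Finset.sum_nonneg fun _ _ => abs_nonneg _
  have hdxy := dist_nonneg (x := x) (y := y)
  have h0 : T + 1 / 4 * dist x y ≤ T0 := by
    have := isMinOn_iff.1 hy x hxE
    simpa using this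
  have hTz : T = 0 := by
    by_contra hne
    have hTpos : 0 < T := lt_of_le_of_ne hTnn (Ne.symm hne)
    have hpy : dist p y + 2 * T ≤ η ^ 2 * σ := by linarith [dist_triangle p x y]
    set u : Fin k → ℝ := fun j => strCoord c x j + v j - strCoord c y j with hu
    have huT : ∑ i, |u i| = T := Finset.sum_congr rfl fun i _ => by rw [abs_sub_comm]
    obtain ⟨q, q1, q2, -⟩ := hc.exists_multi_move H hP (x := y) (v := u) (by rw [huT]; linarith)
    rw [huT] at q1 q2
    have key : ∃ z ∈ E, dist y z ≤ 2 * T ∧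
        ∀ j, |strCoord c z j - (strCoord c x j + v j)| ≤ 24 * η * T := by
      by_cases hqE : q ∈ E
      · refine ⟨q, hqE, by linarith, fun j => ?_⟩
        have := q2 j
        simp only [hu] at this
        rw [show strCoord c q j - (strCoord c x j + v j) = strCoord c q j - strCoord c y j -
          (strCoord c x j + v j - strCoord c y j) by ring]
        have : 0 ≤ η * T := by positivity
        linarith
      · obtain ⟨z, hzE, hz⟩ := hE.1.isCompact.exists_isMinOn ⟨x, hxE⟩
          (f := fun z => dist q z) (by fun_prop)
        have hz' := isMinOn_iff.1 hz
        have hqz : dist q z ≤ T := (hz' y hyE).trans (by rw [dist_comm]; exact q1)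
        have hyz : dist y z ≤ 2 * T := by linarith [dist_triangle y q z]
        refine ⟨z, hzE, hyz, fun j => ?_⟩
        have n := hc.coord_nearest H hP hE (x := z) (q := q) (by linarith [dist_triangle p y z])
          (by linarith [dist_triangle p y q]) hzE hqE hz' j
        have n1 := abs_le.1 n
        have n2 := abs_le.1 (q2 j)
        simp only [hu] at n2
        have : η * dist q z ≤ η * T := by gcongr
        rw [abs_le]
        constructor <;> linarith
    obtain ⟨z, hzE, hz1, hz2⟩ := key
    have hmin := isMinOn_iff.1 hy z hzE
    have hsum : ∑ j, |strCoord c z j - (strCoord c x j + v j)| ≤ k * (24 * η * T) := by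
      have := Finset.sum_le_sum fun j (_ : j ∈ Finset.univ) => hz2 j
      simpa using this
    have : 100 * η * k * T ≤ 1 * T := by gcongr
    have := dist_triangle x y z
    linarith
  refine ⟨y, hyE, fun j => ?_, by linarith⟩
  have := (Finset.sum_eq_zero_iff_of_nonneg fun _ _ => abs_nonneg _).1 hTz j (Finset.mem_univ j)
  linarith [abs_eq_zero.1 this]

end Str

section Str
variable {X : Type} [MetricSpace X] {e R η σ : ℝ} {k : ℕ} {p : X} {c : Fin k → Bool → X}

theorem lipschitzWith_strCoord (c : Fin k → Bool → X) : LipschitzWith 1 (strCoord c) :=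
  LipschitzWith.of_dist_le_mul fun x y => by
    rw [NNReal.coe_one, one_mul, dist_pi_le_iff dist_nonneg]
    intro i
    rw [Real.dist_eq]
    exact abs_strCoord_sub_le c x y i

/-- An almost extremal set with a strained point of rank `k` has dimension at least `k`. -/
theorem Strainer.le_dimH [CompactSpace X] (H : LAlex X e R) (hP : SmallParam e R η σ)
    (hc : Strainer η σ p c) {E : Set X} (hE : AlmostExt e R E) (hk : 100 * η * k ≤ 1)
    (hpE : p ∈ E) : (k : ℝ≥0∞) ≤ dimH E := by
  have hr : 0 < η ^ 2 * σ := mul_pos (pow_pos hP.η0 2) hP.σ0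
  have hsub : Metric.ball (strCoord c p) (η ^ 2 * σ / (8 * (k + 1))) ⊆ strCoord c '' E := by
    intro y hy
    rw [Metric.mem_ball, dist_pi_lt_iff (by positivity)] at hy
    obtain ⟨z, hzE, hz, -⟩ := hc.exists_coord_eq H hP hE hk hpE (v := fun j => y j - strCoord c p j)
      (by
        have : ∑ i, |y i - strCoord c p i| ≤ ∑ _i : Fin k, η ^ 2 * σ / (8 * (k + 1)) :=
          Finset.sum_le_sum fun i _ => (hy i).le
        rw [Finset.sum_const, Finset.card_univ, Fintype.card_fin, nsmul_eq_mul] at this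
        have h2 : (k : ℝ) * (η ^ 2 * σ / (8 * (k + 1))) ≤ η ^ 2 * σ / 8 := by
          rw [mul_div_assoc', div_le_div_iff₀ (by positivity) (by positivity)]
          nlinarith
        rw [dist_self]
        linarith)
    exact ⟨z, hzE, funext fun j => by rw [hz]; ring⟩
  have h1 : dimH (strCoord c '' E) = Module.finrank ℝ (Fin k → ℝ) := by
    apply Real.dimH_of_nonempty_interior
    exact ⟨_, mem_interior.2 ⟨_, hsub, Metric.isOpen_ball, Metric.mem_ball_self (by positivity)⟩⟩
  rw [Module.finrank_fin_fun] at h1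
  rw [← h1]
  exact (lipschitzWith_strCoord c).dimH_image_le E

/-- A new strainer of one higher rank at a point which is almost interior to a
geodesic on which the old coordinates are almost constant. -/
theorem Strainer.extend (H : LAlex X e R) (hP : SmallParam e R η σ) (hc : Strainer η σ p c)
    {x w z : X} {η' : ℝ} (hη' : 300 * η ≤ η' ^ 2)
    (hx : dist p x + dist x w ≤ η ^ 2 * σ) (hxw : x ≠ w) (hf : ∀ i, |strCoord c w i - strCoord c x i| ≤
      30 * η * dist x w) (hz : dist x w ≤ dist x z)
    (hcos : cosC x w z ≤ -1 + η ^ 2) :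
    ∃ c' : Fin (k + 1) → Bool → X, Strainer η' (dist x w) x c' := by
  have hη := hP.η0
  have hη1 := hP.η1
  have hsq := hP.sq_le
  have he := hP.e1
  have hσ := hP.σ0
  have hσR := hP.σR
  have hr := hP.rad_le'
  have hs : 0 < dist x w := dist_pos.2 hxw
  obtain ⟨s, hsdef⟩ : ∃ s, s = dist x w := ⟨_, rfl⟩
  rw [← hsdef] at hs hx hf hz ⊢
  have hx0 : dist p x ≤ η ^ 2 * σ := by linarith
  have hs2 : s ≤ 2 * (η ^ 2 * σ) := by linarith [dist_nonneg (x := p) (y := x)]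
  have near : ∀ y, dist x y = s → dist p y ≤ η ^ 2 * σ := fun y hy => by
    linarith [dist_triangle p x y]
  -- the old directions at the new scale
  have hd : ∀ i b, ∃ d, dist x d = s ∧ dist d (c i b) = dist x (c i b) - s := fun i b =>
    H.geo x (c i b) s hs.le (by linarith [(hc.dist_near' hP hx0 i b).1])
  choose d hd1 hd2 using hd
  have hng : 0 < η * s := by positivity
  have low : ∀ i b y K, dist x y = s → dist x (c i b) - dist y (c i b) ≤ K * η * s → K ≤ 60 →
      (2 - 220 * η) * s ^ 2 ≤ dist (d i b) y ^ 2 := fun i b y K hy hK hK' => by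
    have h := hc.hinge_lower H hP hs.le hx (near y hy) i b (hd1 i b) (hd2 i b)
    rw [hy] at h
    have h1 : s * (dist x (c i b) - dist y (c i b)) ≤ s * (60 * (η * s)) :=
      mul_le_mul_of_nonneg_left (by nlinarith) hs.le
    linarith
  -- the far endpoint
  obtain ⟨z', hz1, hz2⟩ := H.geo x z s hs.le hz
  have hwx : w ≠ x := hxw.symm
  have hzx : z ≠ x := fun h => by rw [h, dist_self] at hz; linarith
  have hz'x : z' ≠ x := fun h => by rw [h, dist_self] at hz1; linarith
  have hwz : (4 - 8 * η ^ 2) * s ^ 2 ≤ dist w z' ^ 2 := by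
    have h := cosC_mul hwx hzx
    obtain ⟨L, hL⟩ : ∃ L, L = dist x z := ⟨_, rfl⟩
    rw [← hsdef, ← hL] at h
    rw [← hL] at hz hz2
    have h3 : dist w z ≤ dist w z' + (L - s) := by linarith [dist_triangle w z' z]
    have h4 : s * L * cosC x w z ≤ s * L * (-1 + η ^ 2) :=
      mul_le_mul_of_nonneg_left hcos (by nlinarith)
    have h5 : (s + L) ^ 2 - 2 * (s * L) * η ^ 2 ≤ dist w z ^ 2 := by linarith
    by_contra! hcon
    have h6 : dist w z' < 2 * s - 2 * η ^ 2 * s + 0 := by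
      apply lt_of_pow_lt_pow_left₀ 2 (by nlinarith)
      refine lt_of_lt_of_le hcon ?_
      have : 0 ≤ (η ^ 2 * s) ^ 2 := by positivity
      linarith
    have h7 : dist w z ≤ s + L - 2 * η ^ 2 * s := by linarith
    have h8 : dist w z ^ 2 ≤ (s + L - 2 * η ^ 2 * s) ^ 2 :=
      pow_le_pow_left₀ dist_nonneg h7 2
    have h10 : η ^ 2 * s ≤ s / 1000 := by nlinarith
    have h9 : 0 ≤ (η ^ 2 * s) * (L - s) := mul_nonneg (by positivity) (by linarith)
    have h11 : (η ^ 2 * s) * (η ^ 2 * s) ≤ (η ^ 2 * s) * (s / 1000) :=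
      mul_le_mul_of_nonneg_left h10 (by positivity)
    have h12 : 0 < η ^ 2 * s * s := by positivity
    linarith
  have hcos' : cosC x w z' ≤ -1 + (2 * η) ^ 2 := by
    unfold cosC
    rw [hz1, ← hsdef, div_le_iff₀ (by positivity)]
    linarith
  -- change of all the strained distances at `w`
  have hw : ∀ i b, |dist w (c i b) - dist x (c i b)| ≤ 41 * η * s := by
    intro i b
    have h1 := abs_le.1 (hf i)
    have h2 := abs_le.1 (hc.sum_le' H hP hx0 (near w hsdef.symm) i)
    rw [← hsdef] at h2
    unfold strCoord at h1 h2
    rw [abs_le]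
    cases b <;> constructor <;> linarith
  have hz' : ∀ i b, dist x (c i b) - dist z' (c i b) ≤ 60 * η * s := by
    intro i b
    have n1 := (hc.dist_near' hP hx0 i !b).2
    have o := H.opp (2 * η) (by linarith) x w z' (c i !b) hwx hz'x (hc.ne_near hP hx0 i !b)
      (by linarith) (by linarith) (by linarith) hcos'
    have b1 := (cosC_bounds (hc.ne_near hP hx0 i !b) hwx).2
    have b2 := (cosC_bounds (hc.ne_near hP hx0 i !b) hz'x).2
    rw [cosC_comm] at b1 b2
    rw [← hsdef] at b1
    rw [hz1] at b2
    have hh := hc.half_ratio hP hx0 hs2 i !b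
    have hw1 := (abs_le.1 (hw i !b)).1
    have b3 : (dist x (c i !b) - dist w (c i !b)) / s ≤ 41 * η := by
      rw [div_le_iff₀ hs]
      linarith
    have b4 : -(49 * η) ≤ (dist x (c i !b) - dist z' (c i !b)) / s := by linarith
    rw [le_div_iff₀ hs] at b4
    have h := hc.sum_sub_le H hP (near z' hz1) hx0 i b
    rw [dist_comm z' x, hz1] at h
    linarith
  have hdd : ∀ i j b b', i ≠ j → (2 - 220 * η) * s ^ 2 ≤ dist (d i b) (d j b') ^ 2 := by
    intro i j b b' hij
    have h1 := abs_le.1 (hc.cross_change H hP hs.le hx j b' (hd1 j b') (hd2 j b') hij.symm)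
    have h2 := abs_le.1 (hc.sum_le' H hP hx0 (near _ (hd1 j b')) i)
    rw [hd1] at h2
    unfold strCoord at h1 h2
    refine low i b _ 23 (hd1 j b') ?_ (by norm_num)
    cases b <;> linarith
  have hop : ∀ i b, (4 - 130 * η) * s ^ 2 ≤ dist (d i b) (d i !b) ^ 2 := by
    intro i b
    have h := hc.hinge_lower H hP hs.le hx (near _ (hd1 i !b)) i b (hd1 i b) (hd2 i b)
    rw [hd1] at h
    have h1 := hc.sum_sub_le H hP (near _ (hd1 i !b)) hx0 i b
    rw [dist_comm _ x, hd1, hd2] at h1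
    have h2 : s * (dist x (c i b) - dist (d i !b) (c i b)) ≤ s * (-s + 11 * η * s) :=
      mul_le_mul_of_nonneg_left (by linarith) hs.le
    have : 0 < η * s * s := by positivity
    linarith
  have hss : 0 ≤ s ^ 2 := by positivity
  have hfin2 : (2 - η' ^ 2) * s ^ 2 ≤ (2 - 220 * η) * s ^ 2 :=
    mul_le_mul_of_nonneg_right (by linarith) hss
  have hfin4 : (4 - η' ^ 2) * s ^ 2 ≤ (4 - 130 * η) * s ^ 2 :=
    mul_le_mul_of_nonneg_right (by linarith) hss
  have hfin4' : (4 - η' ^ 2) * s ^ 2 ≤ (4 - 8 * η ^ 2) * s ^ 2 :=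
    mul_le_mul_of_nonneg_right (by linarith) hss
  have hdw : ∀ (i : Fin k) (b b' : Bool), (2 - η' ^ 2) * s ^ 2 ≤ dist (d i b) (if b' then w else z') ^ 2 := by
    intro i b b'
    refine hfin2.trans ?_
    cases b'
    · exact low i b z' 60 hz1 (hz' i b) le_rfl
    · exact low i b w 41 hsdef.symm (by linarith [(abs_le.1 (hw i b)).1]) (by norm_num)
  refine ⟨Fin.cons (fun b => if b then w else z') d, ?_, ?_, ?_⟩
  · intro i b
    refine Fin.cases ?_ (fun i => ?_) i
    · cases b <;> simp [hz1, ← hsdef] <;> positivity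
    · simp [hd1]
      positivity
  · intro i b
    refine Fin.cases ?_ (fun i => ?_) i
    · cases b
      · simpa [dist_comm z' w] using hfin4'.trans hwz
      · simpa using hfin4'.trans hwz
    · simpa using hfin4.trans (hop i b)
  · intro i j hij b b'
    induction i using Fin.cases with
    | zero =>
      induction j using Fin.cases with
      | zero => exact absurd rfl hij
      | succ j =>
        rw [Fin.cons_zero, Fin.cons_succ, dist_comm]
        exact hdw j b' b
    | succ i =>
      induction j using Fin.cases with
      | zero =>
        rw [Fin.cons_zero, Fin.cons_succ]
        exact hdw i b b'
      | succ j =>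
        rw [Fin.cons_succ, Fin.cons_succ]
        exact hfin2.trans (hdd i j b b' fun h => hij (by rw [h]))

/-- Either the coordinates separate two points or their midpoint is strained of higher rank. -/
theorem Strainer.exists_midpoint_strainer (H : LAlex X e R) (hP : SmallParam e R η σ)
    (hc : Strainer η σ p c) {η' : ℝ} (hη' : 300 * η ≤ η' ^ 2) {u v : X} (huv : u ≠ v)
    (hu : dist p u ≤ η ^ 2 * σ / 4) (hv : dist p v ≤ η ^ 2 * σ / 4)
    (hf : ∀ i, |strCoord c u i - strCoord c v i| ≤ η * dist u v) :
    ∃ (x : X) (c' : Fin (k + 1) → Bool → X), dist u x = dist u v / 2 ∧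
      Strainer η' (dist u v / 2) x c' := by
  have hη := hP.η0
  have hσ := hP.σ0
  have hσR := hP.σR
  have hr := hP.rad_le'
  have hsq := hP.sq_le
  have he := hP.e1
  have hd : 0 < dist u v := dist_pos.2 huv
  obtain ⟨x, hx1, hx2⟩ := H.geo u v (dist u v / 2) (by linarith) (by linarith)
  obtain ⟨s, hs⟩ : ∃ s, dist u v = 2 * s := ⟨dist u v / 2, by ring⟩
  have huvl : dist u v ≤ η ^ 2 * σ / 2 := by linarith [dist_triangle_left u v p]
  have hx1' : dist x u = s := by rw [dist_comm, hx1]; linarith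
  have hx2' : dist x v = s := by rw [hx2]; linarith
  have hs0 : 0 < s := by linarith
  have hux : u ≠ x := fun h => by rw [h, dist_self] at hx1'; linarith
  have hvx : v ≠ x := fun h => by rw [h, dist_self] at hx2'; linarith
  have hpx : dist p x ≤ η ^ 2 * σ / 2 := by linarith [dist_triangle p u x]
  have hx0 : dist p x ≤ η ^ 2 * σ := by linarith
  have hu0 : dist p u ≤ η ^ 2 * σ := by linarith
  have hv0 : dist p v ≤ η ^ 2 * σ := by linarith
  have hcos : cosC x u v = -1 := cosC_eq_neg_one hux hvx (by rw [hx1, hx2]; ring)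
  have hng : 0 < η * s := by positivity
  have key : ∀ i b, -(η * s) ≤ 2 * dist x (c i b) - dist u (c i b) - dist v (c i b) := by
    intro i b
    have o := H.opp 0 le_rfl x u v (c i b) hux hvx (hc.ne_near hP hx0 i b) (by linarith)
      (by linarith) (by linarith [(hc.dist_near' hP hx0 i b).2]) (by rw [hcos]; norm_num)
    have b1 := (cosC_bounds (hc.ne_near hP hx0 i b) hux).2
    have b2 := (cosC_bounds (hc.ne_near hP hx0 i b) hvx).2
    rw [cosC_comm] at b1 b2
    rw [hx1'] at b1
    rw [hx2'] at b2
    have hh := hc.half_ratio hP hx0 (s := s) (by linarith) i b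
    have b4 : -η ≤ (dist x (c i b) - dist u (c i b)) / s + (dist x (c i b) - dist v (c i b)) / s := by
      linarith
    rw [← add_div, le_div_iff₀ hs0] at b4
    linarith
  obtain ⟨c', hc'⟩ := hc.extend H hP hη' (x := x) (w := u) (z := v) (by rw [hx1']; linarith) hux.symm
    (fun i => by
      have k1 := key i true
      have k2 := key i false
      have f1 := abs_le.1 (hf i)
      have m1 := abs_le.1 (hc.sum_le' H hP hu0 hv0 i)
      have m2 := abs_le.1 (hc.sum_le' H hP hu0 hx0 i)
      rw [hs] at f1 m1
      rw [dist_comm u x, hx1'] at m2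
      rw [hx1']
      unfold strCoord at *
      rw [abs_le]
      constructor <;> linarith)
    (by rw [hx1', hx2']) (by rw [hcos]; nlinarith)
  rw [hx1'] at hc'
  rw [show dist u v / 2 = s by linarith]
  exact ⟨x, c', by rw [dist_comm, hx1'], hc'⟩

end Str

section Count
variable {X : Type} [MetricSpace X]

/-- A finite set whose distinct points have distances larger than `r`. -/
def FarApart (r : ℝ) (S : Finset X) : Prop := ∀ u ∈ S, ∀ v ∈ S, u ≠ v → r < dist u v

theorem FarApart.subset {r : ℝ} {S N : Finset X} (h : FarApart r S) (hN : N ⊆ S) : FarApart r N :=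
  fun u hu v hv => h u (hN hu) v (hN hv)

theorem FarApart.anti {r r' : ℝ} {S : Finset X} (h : FarApart r S) (hr : r' ≤ r) : FarApart r' S :=
  fun u hu v hv huv => hr.trans_lt (h u hu v hv huv)

theorem exists_sep_net (S : Finset X) {r : ℝ} (hr : 0 ≤ r) :
    ∃ N ⊆ S, FarApart r N ∧ ∀ u ∈ S, ∃ q ∈ N, dist u q ≤ r := by
  classical
  obtain ⟨N, hN, hmax⟩ := (S.powerset.filter fun N => FarApart r N).exists_max_image Finset.card
    ⟨∅, Finset.mem_filter.2 ⟨Finset.empty_mem_powerset _, fun u hu =>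
      absurd hu (Finset.notMem_empty u)⟩⟩
  rw [Finset.mem_filter, Finset.mem_powerset] at hN
  refine ⟨N, hN.1, hN.2, fun u hu => ?_⟩
  by_contra! hcon
  have huN : u ∉ N := fun h => by
    have := hcon u h
    rw [dist_self] at this
    linarith
  have := hmax (insert u N) (by
    rw [Finset.mem_filter, Finset.mem_powerset]
    refine ⟨Finset.insert_subset hu hN.1, ?_⟩
    intro a ha b hb hab
    rcases Finset.mem_insert.1 ha with rfl | ha' <;> rcases Finset.mem_insert.1 hb with rfl | hb'
    · exact absurd rfl hab
    · exact hcon b hb'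
    · rw [dist_comm]
      exact hcon a ha'
    · exact hN.2 a ha' b hb' hab)
  rw [Finset.card_insert_of_notMem huN] at this
  omega

theorem exists_sep_net_fiber (S : Finset X) {r : ℝ} (hr : 0 ≤ r) :
    ∃ N ⊆ S, FarApart r N ∧ ∃ φ : X → X, ∀ u ∈ S, φ u ∈ N ∧ dist u (φ u) ≤ r := by
  obtain ⟨N, h1, h2, h3⟩ := exists_sep_net S hr
  have : ∀ u, ∃ q, u ∈ S → q ∈ N ∧ dist u q ≤ r := fun u => by
    by_cases hu : u ∈ S
    · obtain ⟨q, hq⟩ := h3 u hu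
      exact ⟨q, fun _ => hq⟩
    · exact ⟨u, fun h => absurd h hu⟩
  choose φ hφ using this
  exact ⟨N, h1, h2, φ, hφ⟩

/-- Counting points in two steps: clusters, and points in each cluster. -/
theorem card_le_of_net (S : Finset X) {r a b : ℝ} (hr : 0 ≤ r) (hb : 0 ≤ b)
    (hN : ∀ N ⊆ S, FarApart r N → (N.card : ℝ) ≤ a)
    (hS : ∀ q ∈ S, ∀ S' ⊆ S, (∀ u ∈ S', dist q u ≤ r) → (S'.card : ℝ) ≤ b) :
    (S.card : ℝ) ≤ a * b := by
  classical
  obtain ⟨N, h1, h2, φ, h3⟩ := exists_sep_net_fiber S hr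
  have := Finset.card_le_mul_card_image_of_maps_to (s := S) (t := N) (f := φ)
    (fun u hu => (h3 u hu).1) ⌊b⌋₊ (fun q hq => Nat.le_floor (hS q (h1 hq) _
      (Finset.filter_subset _ _) fun u hu => by
        rw [Finset.mem_filter] at hu
        have := (h3 u hu.1).2
        rwa [hu.2, dist_comm] at this))
  calc (S.card : ℝ) ≤ (⌊b⌋₊ * N.card : ℕ) := by exact_mod_cast this
    _ = ⌊b⌋₊ * N.card := by push_cast; ring
    _ ≤ b * a := mul_le_mul (Nat.floor_le hb) (hN N h1 h2) (by positivity) hb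
    _ = a * b := mul_comm _ _

end Count

/-- Counting points through the cells of a coordinate map. -/
theorem card_le_of_cells {X : Type} {k : ℕ} (f : X → Fin k → ℝ) (S : Finset X) (y : Fin k → ℝ) {t h b : ℝ}
    (hb : 0 ≤ b) (ht : 0 ≤ t) (hh : 0 < h) (hf : ∀ u ∈ S, ∀ i, |f u i - y i| ≤ t)
    (hS : ∀ S' ⊆ S, (∀ u ∈ S', ∀ v ∈ S', ∀ i, |f u i - f v i| ≤ h) → (S'.card : ℝ) ≤ b) :
    (S.card : ℝ) ≤ b * (2 * t / h + 1) ^ k := by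
  classical
  let φ : X → Fin k → ℕ := fun u i => ⌊(f u i - y i + t) / h⌋₊
  have hnn : ∀ u ∈ S, ∀ i, 0 ≤ (f u i - y i + t) / h := fun u hu i =>
    div_nonneg (by linarith [(abs_le.1 (hf u hu i)).1]) hh.le
  have := Finset.card_le_mul_card_image_of_maps_to (s := S)
    (t := Fintype.piFinset fun _ => Finset.range (⌊2 * t / h⌋₊ + 1)) (f := φ)
    (fun u hu => by
      rw [Fintype.mem_piFinset]
      intro i
      rw [Finset.mem_range, Nat.lt_succ_iff]
      apply Nat.floor_le_floor
      gcongr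
      linarith [(abs_le.1 (hf u hu i)).2]) ⌊b⌋₊ (fun q hq => Nat.le_floor (hS _
      (Finset.filter_subset _ _) fun u hu v hv i => by
        rw [Finset.mem_filter] at hu hv
        have h1 : ⌊(f u i - y i + t) / h⌋₊ = ⌊(f v i - y i + t) / h⌋₊ := by
          have h1 := congrFun hu.2 i
          have h2 := congrFun hv.2 i
          exact h1.trans h2.symm
        have a1 := Nat.floor_le (hnn u hu.1 i)
        have a2 := Nat.lt_floor_add_one ((f u i - y i + t) / h)
        have a3 := Nat.floor_le (hnn v hv.1 i)
        have a4 := Nat.lt_floor_add_one ((f v i - y i + t) / h)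
        rw [h1] at a1 a2
        have a5 : |(f u i - y i + t) / h - (f v i - y i + t) / h| ≤ 1 := by
          rw [abs_le]
          constructor <;> linarith
        rw [← sub_div, abs_div, abs_of_pos hh, div_le_one hh] at a5
        rwa [show f u i - f v i = f u i - y i + t - (f v i - y i + t) by ring]))
  rw [Fintype.card_piFinset_const, Finset.card_range] at this
  calc (S.card : ℝ) ≤ (⌊b⌋₊ * (⌊2 * t / h⌋₊ + 1) ^ k : ℕ) := by exact_mod_cast this
    _ = ⌊b⌋₊ * (⌊2 * t / h⌋₊ + 1) ^ k := by push_cast; ring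
    _ ≤ b * (2 * t / h + 1) ^ k := by
      have h1 := Nat.floor_le hb
      have h2 : (⌊2 * t / h⌋₊ : ℝ) ≤ 2 * t / h := Nat.floor_le (by positivity)
      gcongr

/-- Strainer qualities which deteriorate with the rank. -/
structure Ladder (n : ℕ) (η : ℕ → ℝ) : Prop where
  pos : ∀ k ≤ n + 1, 0 < η k
  le : ∀ k ≤ n + 1, η k ≤ 1 / 1000
  step : ∀ k ≤ n, 300 * η k ≤ η (k + 1) ^ 2

/-- A space satisfying the local axioms, without strainers of rank `n + 1`. -/
structure Model (X : Type) [MetricSpace X] (n : ℕ) (e R : ℝ) (η : ℕ → ℝ) : Prop where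
  lad : Ladder n η
  e0 : 0 ≤ e
  he : ∀ k ≤ n + 1, 16 * e ≤ η k ^ 2
  R0 : 0 < R
  lalex : LAlex X e R
  nostr : ∀ (p : X) (s : ℝ) (c : Fin (n + 1) → Bool → X), 0 < s → 4 * s ≤ R →
    ¬ Strainer (η (n + 1)) s p c

theorem Model.small {X : Type} [MetricSpace X] {n : ℕ} {e R : ℝ} {η : ℕ → ℝ}
    (hM : Model X n e R η) {k : ℕ} (hk : k ≤ n + 1) {s : ℝ} (hs : 0 < s) (hsR : 4 * s ≤ R) :
    SmallParam e R (η k) s :=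
  ⟨hM.e0, by linarith [hM.he k hk, hM.e0], hM.lad.pos k hk, hM.lad.le k hk, hs, hsR⟩

theorem LAlex.exists_contract {X : Type} [MetricSpace X] {e R : ℝ} (H : LAlex X e R) (p : X)
    (S : Finset X) {r l a : ℝ} (hS : ∀ u ∈ S, dist p u ≤ r) (hr : r ≤ R) (hl : 0 < l) (hl1 : l ≤ 1)
    (ha : 0 ≤ a) (hsep : FarApart a S) : ∃ S' : Finset X, S'.card = S.card ∧
      (∀ u ∈ S', dist p u ≤ l * r) ∧ FarApart (l / 2 * a) S' := by
  classical
  have hg : ∀ u, ∃ z, dist p z = l * dist p u ∧ dist z u = (1 - l) * dist p u := fun u => by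
    have hd := dist_nonneg (x := p) (y := u)
    obtain ⟨z, h1, h2⟩ := H.geo p u (l * dist p u) (by positivity) (by nlinarith)
    exact ⟨z, h1, by rw [h2]; ring⟩
  choose φ h1 h2 using hg
  have key : ∀ u ∈ S, ∀ v ∈ S, u ≠ v → l / 2 * a < dist (φ u) (φ v) := fun u hu v hv huv =>
    lt_of_lt_of_le (mul_lt_mul_of_pos_left (hsep u hu v hv huv) (by positivity))
      (H.hom p u v (φ u) (φ v) l ((hS u hu).trans hr) ((hS v hv).trans hr) hl.le hl1 (h1 u) (h2 u)
        (h1 v) (h2 v))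
  refine ⟨S.image φ, Finset.card_image_of_injOn ?_, ?_, ?_⟩
  · intro u hu v hv huv
    by_contra hne
    have := key u hu v hv hne
    rw [huv, dist_self] at this
    have : 0 ≤ l / 2 * a := by positivity
    linarith
  · intro u hu
    obtain ⟨v, hv, rfl⟩ := Finset.mem_image.1 hu
    rw [h1]
    exact mul_le_mul_of_nonneg_left (hS v hv) hl.le
  · intro u hu v hv huv
    obtain ⟨u', hu', rfl⟩ := Finset.mem_image.1 hu
    obtain ⟨v', hv', rfl⟩ := Finset.mem_image.1 hv
    exact key u' hu' v' hv' fun h => huv (by rw [h])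

theorem exists_pack_aux (n : ℕ) (η : ℕ → ℝ) (hη : Ladder n η) (j : ℕ) (hj : j ≤ n + 1) :
    ∃ C : ℝ, 1 ≤ C ∧ ∀ (X : Type) [MetricSpace X] (e R : ℝ), Model X n e R η →
      ∀ (k : ℕ), k + j = n + 1 → ∀ (p : X) (σ : ℝ) (c : Fin k → Bool → X), 0 < σ → 4 * σ ≤ R →
      Strainer (η k) σ p c → ∀ r : ℝ, 0 < r → 2 ^ j * r ≤ R → ∀ ε : ℝ, 0 < ε → ε ≤ 1 →
      ∀ S : Finset X, (∀ u ∈ S, dist p u ≤ r) → FarApart (ε * r) S →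
      (S.card : ℝ) ≤ C * (1 / ε) ^ n := by
  induction j with
  | zero =>
    refine ⟨1, le_rfl, fun X _ e R hM k hk p σ c hσ hσR hc => ?_⟩
    obtain rfl : k = n + 1 := by omega
    exact absurd hc (hM.nostr p σ c hσ hσR)
  | succ j ih =>
    obtain ⟨C, hC1, hC⟩ := ih (by omega)
    have hη0 := hη.pos (n - j) (by omega)
    refine ⟨C * 2 ^ n + (5 / η (n - j)) ^ n, ?_, ?_⟩
    · have : 0 ≤ (5 / η (n - j)) ^ n := by positivity
      have : (1 : ℝ) ≤ 2 ^ n := one_le_pow₀ (by norm_num)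
      nlinarith
    intro X _ e R hM k hk p σ c hσ hσR hc r hr hrR ε hε hε1 S hS hsep
    obtain rfl : k = n - j := by omega
    have hrR' : 2 ^ j * (2 * r) ≤ R := by
      rw [pow_succ] at hrR
      linarith
    have hrR2 : r ≤ R := by
      have : (1 : ℝ) ≤ 2 ^ (j + 1) := one_le_pow₀ (by norm_num)
      nlinarith
    have hε' : (0 : ℝ) ≤ (1 / ε) ^ n := by positivity
    by_cases hx : ∃ (x : X) (s : ℝ) (c' : Fin (n - j + 1) → Bool → X), dist p x ≤ r ∧ 0 < s ∧
        4 * s ≤ R ∧ Strainer (η (n - j + 1)) s x c'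
    · obtain ⟨x, s, c', hx, hs, hsR, hc'⟩ := hx
      have := hC X e R hM (n - j + 1) (by omega) x s c' hs hsR hc' (2 * r) (by linarith) hrR'
        (ε / 2) (by linarith) (by linarith) S (fun u hu => by
          linarith [dist_triangle_left x u p, hS u hu])
        (hsep.anti (by linarith))
      have h0 : 0 ≤ (5 / η (n - j)) ^ n * (1 / ε) ^ n := by positivity
      calc (S.card : ℝ) ≤ C * (1 / (ε / 2)) ^ n := this
        _ = C * 2 ^ n * (1 / ε) ^ n := by
          rw [show 1 / (ε / 2) = 2 * (1 / ε) by field_simp, mul_pow]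
          ring
        _ ≤ _ := by linarith
    · push Not at hx
      have hP := hM.small (k := n - j) (by omega) hσ hσR
      obtain ⟨t, ht, ht1, ht2⟩ : ∃ t, 0 < t ∧ 2 * t ≤ r ∧ t ≤ η (n - j) ^ 2 * σ / 4 :=
        ⟨min (r / 2) (η (n - j) ^ 2 * σ / 4), lt_min (by linarith) (by positivity),
          by linarith [min_le_left (r / 2) (η (n - j) ^ 2 * σ / 4)], min_le_right _ _⟩
      obtain ⟨S', hS'c, hS'd, hS's⟩ := hM.lalex.exists_contract p S hS hrR2 (l := t / r)
        (by positivity) (by rw [div_le_one hr]; linarith) (by positivity) hsep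
      rw [div_mul_cancel₀ _ hr.ne'] at hS'd
      rw [show t / r / 2 * (ε * r) = t * ε / 2 by field_simp] at hS's
      have := card_le_of_cells (strCoord c) S' (strCoord c p) (b := 1) (t := t)
        (h := η (n - j) * (t * ε / 2)) zero_le_one ht.le (by positivity)
        (fun u hu i => by
          have := abs_strCoord_sub_le c u p i
          rw [dist_comm] at this
          exact this.trans (hS'd u hu))
        (fun T hT hTf => by
          rw [Nat.cast_le_one, Finset.card_le_one]
          intro u hu v hv
          by_contra huv
          have hd := hS's u (hT hu) v (hT hv) huv
          obtain ⟨x, c', hx1, hx2⟩ := hc.exists_midpoint_strainer hM.lalex hP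
            (hη.step (n - j) (by omega)) huv ((hS'd u (hT hu)).trans ht2)
            ((hS'd v (hT hv)).trans ht2) (fun i => (hTf u hu v hv i).trans (by gcongr))
          have hduv : dist u v ≤ 2 * t := by
            linarith [dist_triangle_left u v p, hS'd u (hT hu), hS'd v (hT hv)]
          have := hP.rad_le'
          refine hx x (dist u v / 2) c' ?_ ?_ ?_ hx2
          · linarith [dist_triangle p u x, hS'd u (hT hu)]
          · have := dist_pos.2 huv
            linarith
          · linarith)
      rw [hS'c, one_mul] at this
      have h5 : 2 * t / (η (n - j) * (t * ε / 2)) + 1 ≤ 5 / η (n - j) * (1 / ε) := by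
        have h1 : 2 * t / (η (n - j) * (t * ε / 2)) = 4 / η (n - j) * (1 / ε) := by
          field_simp
          norm_num
        have h2 : 1 ≤ 1 / η (n - j) * (1 / ε) := by
          have a1 : 1 ≤ 1 / η (n - j) := by
            rw [le_div_iff₀ hη0]
            linarith [hP.η1]
          have a2 : 1 ≤ 1 / ε := by
            rw [le_div_iff₀ hε]
            linarith
          nlinarith
        rw [h1, show 5 / η (n - j) = 4 / η (n - j) + 1 / η (n - j) by ring]
        linarith
      have h6 : 0 ≤ C * 2 ^ n * (1 / ε) ^ n := by positivity
      have h7 : 1 ≤ 2 * t / (η (n - j) * (t * ε / 2)) + 1 := by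
        have : 0 ≤ 2 * t / (η (n - j) * (t * ε / 2)) := by positivity
        linarith
      calc (S.card : ℝ) ≤ (2 * t / (η (n - j) * (t * ε / 2)) + 1) ^ (n - j) := this
        _ ≤ (2 * t / (η (n - j) * (t * ε / 2)) + 1) ^ n := pow_le_pow_right₀ h7 (by omega)
        _ ≤ (5 / η (n - j) * (1 / ε)) ^ n := pow_le_pow_left₀ (by linarith) h5 n
        _ ≤ _ := by
          rw [mul_pow]
          linarith

/-- The packing property of an `n`-dimensional space, with constant `C`. -/
def Packing (X : Type) [MetricSpace X] (n : ℕ) (C r₀ : ℝ) : Prop :=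
  ∀ (p : X) (r : ℝ), 0 < r → r ≤ r₀ → ∀ ε : ℝ, 0 < ε → ε ≤ 1 → ∀ S : Finset X,
    (∀ u ∈ S, dist p u ≤ r) → FarApart (ε * r) S → (S.card : ℝ) ≤ C * (1 / ε) ^ n

theorem exists_pack (n : ℕ) (η : ℕ → ℝ) (hη : Ladder n η) :
    ∃ C : ℝ, 1 ≤ C ∧ ∀ (X : Type) [MetricSpace X] (e R : ℝ), Model X n e R η →
      Packing X n C (R / 2 ^ (n + 1)) := by
  obtain ⟨C, hC1, hC⟩ := exists_pack_aux n η hη (n + 1) le_rfl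
  refine ⟨C, hC1, fun X _ e R hM p r hr hrR ε hε hε1 S hS hsep => ?_⟩
  have hR := hM.R0
  refine hC X e R hM 0 (by omega) p (R / 4) (fun i => i.elim0) (by positivity) (by linarith)
    ⟨fun i => i.elim0, fun i => i.elim0, fun i => i.elim0⟩ r hr ?_ ε hε hε1 S hS hsep
  rw [le_div_iff₀ (by positivity)] at hrR
  linarith

section Chain
variable {X : Type} [MetricSpace X]

/-- A large set contains a point which sees many points of the set at very different scales. -/
theorem exists_multiscale {ρ : ℝ} (hρ : 0 < ρ) (hρ1 : ρ ≤ 1) {A : ℕ} (hA : 2 ≤ A) (M : ℕ)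
    (S : Finset X) (hcov : ∀ N ⊆ S, ∀ d : ℝ, 0 < d → (∀ u ∈ N, ∀ v ∈ N, dist u v ≤ d) →
      FarApart (ρ * d / 8) N → N.card ≤ A) (hS : A ^ M ≤ S.card) :
    ∃ w ∈ S, ∃ T ⊆ S, T.card = M ∧ w ∉ T ∧
      ∀ t ∈ T, ∀ t' ∈ T, t ≠ t' → dist w t ≤ ρ * dist w t' ∨ dist w t' ≤ ρ * dist w t := by
  classical
  induction M generalizing S with
  | zero =>
    obtain ⟨w, hw⟩ := Finset.card_pos.1 (lt_of_lt_of_le (by simp) hS)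
    exact ⟨w, hw, ∅, by simp, rfl, by simp, by simp⟩
  | succ M ih =>
    have h1 : 1 < S.card := by
      have : 2 * 1 ≤ A * A ^ M := Nat.mul_le_mul hA (Nat.one_le_pow _ _ (by omega))
      rw [pow_succ'] at hS
      omega
    obtain ⟨a, ha, b, hb, hab⟩ := Finset.one_lt_card.1 h1
    obtain ⟨⟨u, v⟩, huv, hmax⟩ := (S ×ˢ S).exists_max_image (fun q => dist q.1 q.2)
      ⟨(a, b), Finset.mk_mem_product ha hb⟩
    rw [Finset.mem_product] at huv
    have hmax' : ∀ x ∈ S, ∀ y ∈ S, dist x y ≤ dist u v := fun x hx y hy =>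
      hmax (x, y) (Finset.mk_mem_product hx hy)
    have hd : 0 < dist u v := lt_of_lt_of_le (dist_pos.2 hab) (hmax' a ha b hb)
    set d := dist u v
    obtain ⟨N, hNS, hN1, φ, hφ⟩ := exists_sep_net_fiber S (r := ρ * d / 8) (by positivity)
    have hNc := hcov N hNS d hd (fun x hx y hy => hmax' x (hNS hx) y (hNS hy)) hN1
    obtain ⟨q, hq, hqc⟩ := Finset.exists_le_card_fiber_of_mul_le_card_of_maps_to (s := S) (t := N)
      (f := φ) (n := A ^ M) (fun x hx => (hφ x hx).1) ⟨φ a, (hφ a ha).1⟩ (by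
        rw [pow_succ'] at hS
        exact (Nat.mul_le_mul_right _ hNc).trans hS)
    set S' := S.filter fun x => φ x = q
    have hS'S : S' ⊆ S := Finset.filter_subset _ _
    obtain ⟨w, hw, T, hTS, hTc, hwT, hT⟩ := ih S'
      (fun N hN => hcov N (hN.trans hS'S)) hqc
    have hsmall : ∀ t ∈ T, dist w t ≤ ρ * d / 4 := fun t ht => by
      have h1 := Finset.mem_filter.1 hw
      have h2 := Finset.mem_filter.1 (hTS ht)
      have h3 := (hφ w h1.1).2
      have h4 := (hφ t h2.1).2
      rw [h1.2] at h3
      rw [h2.2] at h4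
      linarith [dist_triangle_right w t q]
    have hfar : ∃ t ∈ S, d / 2 ≤ dist w t := by
      by_contra! hcon
      have h1 := hcon u huv.1
      have h2 := hcon v huv.2
      have h3 : d ≤ dist w u + dist w v := dist_triangle_left u v w
      linarith
    obtain ⟨t, htS, ht⟩ := hfar
    have hρd : ρ * d ≤ d := by nlinarith
    have hfac : ρ * (d / 2) ≤ ρ * dist w t := by gcongr
    have hρd0 : 0 < ρ * d := by positivity
    refine ⟨w, hS'S hw, insert t T, Finset.insert_subset htS (hTS.trans hS'S), ?_, ?_, ?_⟩
    · rw [Finset.card_insert_of_notMem, hTc]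
      intro h
      linarith [hsmall t h]
    · rw [Finset.mem_insert, not_or]
      refine ⟨fun h => ?_, hwT⟩
      rw [← h, dist_self] at ht
      linarith
    · intro a ha b hb hab
      rcases Finset.mem_insert.1 ha with rfl | ha' <;> rcases Finset.mem_insert.1 hb with rfl | hb'
      · exact absurd rfl hab
      · right
        linarith [hsmall b hb']
      · left
        linarith [hsmall a ha']
      · exact hT a ha' b hb' hab

variable {e R : ℝ} {n : ℕ} {C r₀ : ℝ}

/-- Among many directions two are close to each other. -/
theorem exists_close_directions (H : LAlex X e R) (he : 0 ≤ e) {η : ℝ} (hη : 0 < η)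
    (hη1 : η ≤ 1) (heη : 16 * e ≤ η ^ 2)
    (hpack : Packing X n C r₀) {w : X} {T : Finset X} (hwT : w ∉ T)
    (hT : ∀ t ∈ T, dist w t ≤ r₀) (hr : 2 * r₀ ≤ R) (hcard : C * (2 / η) ^ n < T.card)
    (hne : T.Nonempty) :
    ∃ t ∈ T, ∃ t' ∈ T, t ≠ t' ∧ 1 - η ^ 2 / 2 ≤ cosC w t t' := by
  classical
  by_contra! hcon
  obtain ⟨t₀, ht₀, hmin⟩ := T.exists_min_image (fun t => dist w t) hne
  have hne' : ∀ t ∈ T, t ≠ w := fun t ht h => hwT (h ▸ ht)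
  obtain ⟨s, hs⟩ : ∃ s, s = dist w t₀ := ⟨_, rfl⟩
  have hs0 : 0 < s := hs ▸ dist_pos.2 (hne' t₀ ht₀).symm
  have hsmin : ∀ t ∈ T, s ≤ dist w t := fun t ht => hs ▸ hmin t ht
  have hsr : s ≤ r₀ := hs ▸ hT t₀ ht₀
  have hg : ∀ t, ∃ z, t ∈ T → dist w z = s ∧ dist z t = dist w t - s := fun t => by
    by_cases ht : t ∈ T
    · obtain ⟨z, hz⟩ := H.geo w t s hs0.le (hsmin t ht)
      exact ⟨z, fun _ => hz⟩
    · exact ⟨t, fun h => absurd h ht⟩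
  choose φ hφ using hg
  have key : ∀ t ∈ T, ∀ t' ∈ T, t ≠ t' → η / 2 * s < dist (φ t) (φ t') := by
    intro t ht t' ht' htt
    have c0 := hcon t ht t' ht' htt
    obtain ⟨a1, a2⟩ := hφ t ht
    obtain ⟨b1, b2⟩ := hφ t' ht'
    have n1 : φ t ≠ w := fun h => by rw [h, dist_self] at a1; linarith
    have n2 : φ t' ≠ w := fun h => by rw [h, dist_self] at b1; linarith
    have d1 : dist (φ t) t' ≤ 2 * dist w t' := by
      linarith [dist_triangle_left (φ t) t' w, hsmin t' ht']
    have d2 : dist (φ t') (φ t) ≤ 2 * s := by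
      linarith [dist_triangle_left (φ t') (φ t) w]
    have c1 := H.cosC_shorten (x := w) (a := t) (q := φ t) (w := t') n1 (hne' t' ht')
      (by rw [a1, a2]; ring) (by linarith [hT t ht]) (by linarith [hT t' ht']) he
    have c2 := H.cosC_shorten (x := w) (a := t') (q := φ t') (w := φ t) n2 n1
      (by rw [b1, b2]; ring) (by linarith [hT t' ht']) (by linarith) he
    have e1 : e * (dist (φ t) t' / dist w t') ≤ e * 2 := by
      have := dist_pos.2 (hne' t' ht').symm
      gcongr
      rwa [div_le_iff₀ this]
    have e2 : e * (dist (φ t') (φ t) / dist w (φ t)) ≤ e * 2 := by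
      rw [a1]
      gcongr
      rwa [div_le_iff₀ hs0]
    rw [cosC_comm w t' (φ t)] at c2
    have c3 : cosC w (φ t') (φ t) ≤ 1 - η ^ 2 / 4 := by linarith
    have hd := cosC_mul n2 n1
    rw [a1, b1] at hd
    have h5 : s * s * cosC w (φ t') (φ t) ≤ s * s * (1 - η ^ 2 / 4) := by gcongr
    rw [dist_comm]
    apply lt_of_pow_lt_pow_left₀ 2 dist_nonneg
    have : 0 < η ^ 2 * s ^ 2 := by positivity
    rw [hd]
    linarith
  have hinj : (T.image φ).card = T.card := Finset.card_image_of_injOn fun t ht t' ht' htt => by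
    by_contra hne
    have := key t ht t' ht' hne
    rw [htt, dist_self] at this
    have : 0 < η / 2 * s := by positivity
    linarith
  have := hpack w s hs0 hsr (η / 2) (by positivity) (by linarith) (T.image φ)
    (fun u hu => by
      obtain ⟨t, ht, rfl⟩ := Finset.mem_image.1 hu
      exact (hφ t ht).1.le)
    (fun u hu v hv huv => by
      obtain ⟨t, ht, rfl⟩ := Finset.mem_image.1 hu
      obtain ⟨t', ht', rfl⟩ := Finset.mem_image.1 hv
      exact key t ht t' ht' fun h => huv (by rw [h]))
  rw [hinj, one_div_div] at this
  linarith

theorem cosC_flip {w t t' : X} {η : ℝ} (hη1 : η ≤ 1 / 1000) (hη : 0 < η) (ht : t ≠ w)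
    (hρ : dist w t ≤ η ^ 2 / 4 * dist w t') (hcos : 1 - η ^ 2 / 2 ≤ cosC w t t') :
    cosC t w t' ≤ -1 + η ^ 2 ∧ dist t w ≤ dist t t' := by
  have hsq : η ^ 2 ≤ 1 / 1000000 := by nlinarith
  have hsq0 : 0 < η ^ 2 := by positivity
  obtain ⟨a, ha⟩ : ∃ a, a = dist w t := ⟨_, rfl⟩
  obtain ⟨b, hb⟩ : ∃ b, b = dist w t' := ⟨_, rfl⟩
  obtain ⟨d, hd⟩ : ∃ d, d = dist t t' := ⟨_, rfl⟩
  have ha0 : 0 < a := ha ▸ dist_pos.2 ht.symm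
  rw [← ha, ← hb] at hρ
  have hb0 : 0 < b := by
    by_contra! h
    nlinarith
  have ht' : t' ≠ w := fun h => by rw [h, dist_self] at hb; linarith
  have h1 := cosC_mul ht ht'
  have t1 : b ≤ a + d := by rw [ha, hb, hd]; exact dist_triangle _ _ _
  have t2 : d ≤ a + b := by rw [ha, hb, hd]; exact dist_triangle_left _ _ _
  have hab : a ≤ b / 1000000 := by nlinarith
  rw [← ha, ← hb, ← hd] at h1
  have h2 : a * b * (1 - η ^ 2 / 2) ≤ a * b * cosC w t t' := by gcongr
  refine ⟨?_, by rw [dist_comm t w, ← ha, ← hd]; linarith⟩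
  unfold cosC
  rw [dist_comm t w, ← ha, ← hb, ← hd, div_le_iff₀ (by nlinarith)]
  have h3 : d ^ 2 ≤ a ^ 2 + b ^ 2 - 2 * (a * b) * (1 - η ^ 2 / 2) := by linarith
  have h4 : a * d * (1 - η ^ 2) ≤ a * (a + b) * (1 - η ^ 2) := by
    have : 0 ≤ 1 - η ^ 2 := by linarith
    gcongr
  have h5 : a * a ≤ a * (η ^ 2 / 4 * b) := by gcongr
  have h6 : 0 ≤ a * a * η ^ 2 := by positivity
  linarith

end Chain

/-- Bound for the number of points on which the coordinates are almost constant, if no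
new strainer arises. -/
theorem exists_cell_bound (n : ℕ) (η : ℕ → ℝ) (C : ℝ) (k : ℕ) (hk : k ≤ n) :
    ∃ B : ℝ, 1 ≤ B ∧ ∀ (X : Type) [MetricSpace X] (e R r₀ : ℝ), Model X n e R η →
      Packing X n C r₀ → 4 * r₀ ≤ R → ∀ (p : X) (σ : ℝ) (c : Fin k → Bool → X), 0 < σ → σ ≤ r₀ →
      Strainer (η k) σ p c → ∀ S : Finset X, (∀ u ∈ S, dist p u ≤ η k ^ 2 * σ / 4) →
      (∀ u ∈ S, ∀ v ∈ S, ∀ i, |strCoord c u i - strCoord c v i| ≤ η k * dist u v) →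
      (∀ u ∈ S, ∀ v ∈ S, u ≠ v → ∀ c' : Fin (k + 1) → Bool → X,
        ¬ Strainer (η (k + 1)) (dist u v) u c') → (S.card : ℝ) ≤ B := by
  set ρ := η k ^ 2 / 4 with hρdef
  set A := max 2 ⌊C * (8 / ρ) ^ n⌋₊
  set M := ⌊C * (2 / η k) ^ n⌋₊ + 1
  have hA2 : 2 ≤ A := le_max_left _ _
  refine ⟨(A ^ M : ℕ), by exact_mod_cast Nat.one_le_pow _ _ (by omega), ?_⟩
  intro X _ e R r₀ hM hpack hrR p σ c hσ hσr hc S hS hf hno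
  have hP := hM.small (k := k) (by omega) hσ (by linarith)
  have hη := hP.η0
  have hη1 := hP.η1
  have hr' := hP.rad_le'
  have hsq := hP.sq_le
  have hρ : 0 < ρ := by positivity
  have hρ1 : ρ ≤ 1 := by rw [hρdef]; linarith
  have hdist : ∀ u ∈ S, ∀ v ∈ S, dist u v ≤ η k ^ 2 * σ / 2 := fun u hu v hv => by
    linarith [dist_triangle_left u v p, hS u hu, hS v hv]
  by_contra! hcard
  obtain ⟨w, hwS, T, hTS, hTc, hwT, hT⟩ := exists_multiscale hρ hρ1 hA2 M S
    (fun N hN d hd hNd hsep => by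
      rcases N.eq_empty_or_nonempty with rfl | ⟨q, hq⟩
      · simp
      refine le_trans ?_ (le_max_right _ _)
      apply Nat.le_floor
      have hnd : ∀ u ∈ N, dist q u ≤ min d r₀ := fun u hu => le_min (hNd q hq u hu) (by
        linarith [hdist q (hN hq) u (hN hu)])
      have := hpack q (min d r₀) (lt_min hd (by linarith)) (min_le_right _ _) (ρ / 8) (by positivity)
        (by linarith) N hnd (hsep.anti (by
          have : ρ * min d r₀ ≤ ρ * d := mul_le_mul_of_nonneg_left (min_le_left _ _) hρ.le
          linarith))
      rwa [one_div_div] at this)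
    (by exact_mod_cast hcard.le)
  have hne : T.Nonempty := by
    rw [← Finset.card_pos, hTc]
    omega
  obtain ⟨t, ht, t', ht', htt, hcos⟩ := exists_close_directions hM.lalex hM.e0 hη (by linarith)
    (hM.he k (by omega)) hpack hwT (fun t ht => by linarith [hdist w hwS t (hTS ht)])
    (by linarith) (by
      rw [hTc, Nat.cast_add_one]
      exact Nat.lt_floor_add_one (C * (2 / η k) ^ n)) hne
  wlog hle : dist w t ≤ ρ * dist w t' generalizing t t'
  · exact this t' ht' t ht htt.symm (by rwa [cosC_comm])
      ((hT t ht t' ht' htt).resolve_left hle)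
  have htw : t ≠ w := fun h => hwT (h ▸ ht)
  obtain ⟨f1, f2⟩ := cosC_flip hη1 hη htw hle hcos
  have d1 := hdist t (hTS ht) w hwS
  have d2 := hdist t (hTS ht) t' (hTS ht')
  have d3 := hS t (hTS ht)
  have hr0 : 0 < η k ^ 2 * σ := by positivity
  obtain ⟨c', hc'⟩ := hc.extend hM.lalex hP (hM.lad.step k hk) (x := t) (w := w) (z := t')
    (by linarith) htw (fun i => by
      rw [dist_comm t w]
      refine (hf w hwS t (hTS ht) i).trans ?_
      gcongr
      linarith) f2 f1
  exact hno t (hTS ht) w hwS htw c' hc'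

/-- Bound for the number of points without new strainers at the scales of separation. -/
theorem exists_unstrained_bound (n : ℕ) (η : ℕ → ℝ) (C : ℝ) (k : ℕ) (hk : k ≤ n) :
    ∃ B : ℝ, 1 ≤ B ∧ ∀ (X : Type) [MetricSpace X] (e R r₀ : ℝ), Model X n e R η →
      Packing X n C r₀ → 4 * r₀ ≤ R → ∀ (p : X) (σ : ℝ) (c : Fin k → Bool → X), 0 < σ → σ ≤ r₀ →
      Strainer (η k) σ p c → ∀ S : Finset X, (∀ u ∈ S, dist p u ≤ η k ^ 2 * σ / 4) →
      ∀ r : ℝ, 0 < r → FarApart (r * σ) S →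
      (∀ u ∈ S, ∀ s : ℝ, r * σ < s → s ≤ σ → ∀ c' : Fin (k + 1) → Bool → X,
        ¬ Strainer (η (k + 1)) s u c') → (S.card : ℝ) ≤ B * (1 / r + 1) ^ k := by
  obtain ⟨B, hB1, hB⟩ := exists_cell_bound n η C k hk
  refine ⟨B, hB1, fun X _ e R r₀ hM hpack hrR p σ c hσ hσr hc S hS r hr hsep hno => ?_⟩
  have hP := hM.small (k := k) (by omega) hσ (by linarith)
  have hη := hP.η0
  have hη1 := hP.η1
  have hr' := hP.rad_le'
  have := card_le_of_cells (strCoord c) S (strCoord c p) (b := B) (t := η k ^ 2 * σ / 4)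
    (h := η k * (r * σ)) (by linarith) (by positivity) (by positivity)
    (fun u hu i => by
      have := abs_strCoord_sub_le c u p i
      rw [dist_comm] at this
      exact this.trans (hS u hu))
    (fun N hN hNf => by
      by_cases h1 : N.card ≤ 1
      · have : (N.card : ℝ) ≤ 1 := by exact_mod_cast h1
        linarith
      refine hB X e R r₀ hM hpack hrR p σ c hσ hσr hc N (fun u hu => hS u (hN hu)) ?_ ?_
      · intro u hu v hv i
        by_cases huv : u = v
        · subst huv
          simp
        · have := hsep u (hN hu) v (hN hv) huv
          exact (hNf u hu v hv i).trans (by gcongr)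
      · intro u hu v hv huv
        refine hno u (hN hu) _ (hsep u (hN hu) v (hN hv) huv) ?_
        linarith [dist_triangle_left u v p, hS u (hN hu), hS v (hN hv)])
  refine this.trans ?_
  have h2 : 2 * (η k ^ 2 * σ / 4) / (η k * (r * σ)) ≤ 1 / r := by
    rw [show 2 * (η k ^ 2 * σ / 4) / (η k * (r * σ)) = (η k / 2) / r by field_simp; ring]
    gcongr
    linarith
  have h3 : 0 ≤ 2 * (η k ^ 2 * σ / 4) / (η k * (r * σ)) := by positivity
  gcongr

theorem card_le_layers {X : Type} (S : Finset X) (G : ℕ → X → Prop) (h0 : ∀ u ∈ S, G 0 u)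
    [∀ i, DecidablePred (G i)] (J : ℕ) :
    S.card ≤ (S.filter (G J)).card +
      ∑ i ∈ Finset.range J, (S.filter fun u => G i u ∧ ¬ G (i + 1) u).card := by
  classical
  induction J with
  | zero => simp [Finset.filter_true_of_mem h0]
  | succ J ih =>
    rw [Finset.sum_range_succ]
    have : (S.filter (G J)).card ≤ (S.filter (G (J + 1))).card +
        (S.filter fun u => G J u ∧ ¬ G (J + 1) u).card := by
      rw [← Finset.card_union_add_card_inter]
      refine le_trans (Finset.card_le_card ?_) (Nat.le_add_right _ _)
      intro u hu
      rw [Finset.mem_filter] at hu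
      rw [Finset.mem_union, Finset.mem_filter, Finset.mem_filter]
      tauto
    omega

theorem exists_count_aux (n : ℕ) (η : ℕ → ℝ) (hη : Ladder n η) (C : ℝ) (hC : 1 ≤ C) (d : ℕ)
    (hd : d ≤ n) (j : ℕ) (hj : j ≤ d) :
    ∃ C' : ℝ, 1 ≤ C' ∧ ∀ (X : Type) [MetricSpace X] (e R r₀ : ℝ), Model X n e R η →
      Packing X n C r₀ → 4 * r₀ ≤ R → ∀ T : Set X,
      (∀ p ∈ T, ∀ s : ℝ, 0 < s → s ≤ r₀ → ∀ c : Fin (d + 1) → Bool → X,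
        ¬ Strainer (η (d + 1)) s p c) →
      ∀ k : ℕ, k + j = d → ∀ (p : X) (σ : ℝ) (c : Fin k → Bool → X), 0 < σ → σ ≤ r₀ →
      Strainer (η k) σ p c → ∀ ε : ℝ, 0 < ε → ε ≤ 2 → ∀ S : Finset X, (∀ u ∈ S, u ∈ T) →
      (∀ u ∈ S, dist p u ≤ η k ^ 2 * σ / 4) → FarApart (ε * σ) S →
      (S.card : ℝ) ≤ C' * (1 / ε) ^ d := by
  classical
  have hpow : ∀ k ≤ d, ∀ ε : ℝ, 0 < ε → ε ≤ 2 → (1 / ε + 1) ^ k ≤ 3 ^ d * (1 / ε) ^ d := by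
    intro k hk ε hε hε2
    have h1 : 1 / 2 ≤ 1 / ε := one_div_le_one_div_of_le hε hε2
    calc (1 / ε + 1) ^ k ≤ (3 * (1 / ε)) ^ k := by gcongr; linarith
      _ ≤ (3 * (1 / ε)) ^ d := pow_le_pow_right₀ (by linarith) hk
      _ = _ := mul_pow _ _ _
  induction j with
  | zero =>
    obtain ⟨B, hB1, hB⟩ := exists_unstrained_bound n η C d hd
    refine ⟨B * 3 ^ d, ?_, ?_⟩
    · have : (1 : ℝ) ≤ 3 ^ d := one_le_pow₀ (by norm_num)
      nlinarith
    intro X _ e R r₀ hM hpack hrR T hT k hk p σ c hσ hσr hc ε hε hε2 S hST hS hsep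
    obtain rfl : k = d := by omega
    refine (hB X e R r₀ hM hpack hrR p σ c hσ hσr hc S hS ε hε hsep fun u hu s hs hsσ =>
      hT u (hST u hu) s ?_ (hsσ.trans hσr)).trans ?_
    · have : 0 < ε * σ := by positivity
      linarith
    · rw [mul_assoc]
      exact mul_le_mul_of_nonneg_left (hpow k le_rfl ε hε hε2) (by linarith)
  | succ j ih =>
    obtain ⟨C₁, hC₁, hcount⟩ := ih (by omega)
    obtain ⟨k, hkd⟩ : ∃ k, k + (j + 1) = d := ⟨d - (j + 1), by omega⟩
    obtain ⟨B, hB1, hB⟩ := exists_unstrained_bound n η C k (by omega)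
    have hη' := hη.pos (k + 1) (by omega)
    have hη1' := hη.le (k + 1) (by omega)
    obtain ⟨δ, hδ⟩ : ∃ δ, δ = η (k + 1) ^ 2 / 8 := ⟨_, rfl⟩
    have hδ0 : 0 < δ := by rw [hδ]; positivity
    have hδ1 : δ ≤ 1 := by
      rw [hδ]
      nlinarith
    obtain ⟨K, hK⟩ : ∃ K, K = B * 2 ^ k * (C * (1 / δ) ^ n * C₁) := ⟨_, rfl⟩
    have hK0 : 0 ≤ K := by
      rw [hK]
      have : 0 ≤ (1 / δ) ^ n := by positivity
      have : 0 ≤ B := by linarith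
      have : 0 ≤ C := by linarith
      have : 0 ≤ C₁ := by linarith
      positivity
    refine ⟨B * 3 ^ d + 2 * K, ?_, ?_⟩
    · have : (1 : ℝ) ≤ 3 ^ d := one_le_pow₀ (by norm_num)
      nlinarith
    intro X _ e R r₀ hM hpack hrR T hT k' hk' p σ c hσ hσr hc ε hε hε2 S hST hS hsep
    obtain rfl : k' = k := by omega
    let G : ℕ → X → Prop := fun i u => ∀ s : ℝ, (1 / 2) ^ i * σ < s → s ≤ σ →
      ∀ c' : Fin (k' + 1) → Bool → X, ¬ Strainer (η (k' + 1)) s u c'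
    have hJ : ∃ J : ℕ, (1 / 2 : ℝ) ^ J ≤ ε := by
      obtain ⟨J, hJ⟩ := exists_pow_lt_of_lt_one hε (by norm_num : (1 / 2 : ℝ) < 1)
      exact ⟨J, hJ.le⟩
    have hJ1 := Nat.find_spec hJ
    have hJ2 : ∀ i < Nat.find hJ, ε < (1 / 2 : ℝ) ^ i := fun i hi => not_le.1 (Nat.find_min hJ hi)
    set J := Nat.find hJ
    have hlay := card_le_layers S G (fun u _ s hs hsσ => by
      rw [pow_zero, one_mul] at hs
      linarith) J
    have hlast : ((S.filter (G J)).card : ℝ) ≤ B * 3 ^ d * (1 / ε) ^ d := by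
      refine (hB X e R r₀ hM hpack hrR p σ c hσ hσr hc (S.filter (G J))
        (fun u hu => hS u (Finset.filter_subset _ _ hu)) ε hε
        (hsep.subset (Finset.filter_subset _ _)) fun u hu s hs hsσ => ?_).trans ?_
      · have := (Finset.mem_filter.1 hu).2
        refine this s (lt_of_le_of_lt ?_ hs) hsσ
        gcongr
      · rw [mul_assoc]
        exact mul_le_mul_of_nonneg_left (hpow k' (by omega) ε hε hε2) (by linarith)
    have hlayer : ∀ i ∈ Finset.range J, ((S.filter fun u => G i u ∧ ¬ G (i + 1) u).card : ℝ) ≤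
        K * (1 / ε) ^ d * (1 / 2) ^ i := by
      intro i hi
      have hεh := hJ2 i (Finset.mem_range.1 hi)
      obtain ⟨h, hh⟩ : ∃ h : ℝ, h = (1 / 2) ^ i := ⟨_, rfl⟩
      have hh0 : 0 < h := by rw [hh]; positivity
      have hh1 : h ≤ 1 := by
        rw [hh]
        exact pow_le_one₀ (by norm_num) (by norm_num)
      rw [← hh] at hεh ⊢
      have hhσ : 0 < h * σ := by positivity
      have hhσr : h * σ ≤ r₀ := by nlinarith
      have hpn : 0 ≤ C * (1 / δ) ^ n := by
        have : 0 ≤ (1 / δ) ^ n := by positivity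
        nlinarith
      have hin : 0 ≤ C₁ * (h / ε) ^ d := by
        have : 0 ≤ (h / ε) ^ d := by positivity
        nlinarith
      set S₁ := S.filter fun u => G i u ∧ ¬ G (i + 1) u with hS₁
      have hmem : ∀ u ∈ S₁, u ∈ S ∧ G i u ∧ ¬ G (i + 1) u := fun u hu => Finset.mem_filter.1 hu
      have hcl : (S₁.card : ℝ) ≤ B * (1 / h + 1) ^ k' * (C * (1 / δ) ^ n * (C₁ * (h / ε) ^ d)) := by
        refine card_le_of_net S₁ (r := h * σ) hhσ.le (mul_nonneg hpn hin) ?_ ?_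
        · intro N hN hNsep
          refine hB X e R r₀ hM hpack hrR p σ c hσ hσr hc N
            (fun u hu => hS u (hmem u (hN hu)).1) h hh0 hNsep fun u hu s hs hsσ => ?_
          exact (hmem u (hN hu)).2.1 s (by rw [← hh]; exact hs) hsσ
        · intro q hq S' hS' hS'q
          refine card_le_of_net S' (r := δ * (h * σ)) (by positivity) hin ?_ ?_
          · intro N hN hNsep
            exact hpack q (h * σ) hhσ hhσr δ hδ0 hδ1 N (fun u hu => hS'q u (hN hu)) hNsep
          · intro q' hq' S'' hS'' hS''q
            obtain ⟨-, hG1, hG2⟩ := hmem q' (hS' hq')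
            simp only [G] at hG2
            push Not at hG2
            obtain ⟨s, hs1, hs2, c', hc'⟩ := hG2
            have hs3 : s ≤ h * σ := by
              by_contra! hcon
              exact hG1 s (by rw [← hh]; exact hcon) hs2 c' hc'
            rw [pow_succ, ← hh] at hs1
            have hs0 : 0 < s := by linarith
            have := hcount X e R r₀ hM hpack hrR T hT (k' + 1) (by omega) q' s c' hs0
              (hs3.trans hhσr) hc' (ε * σ / s) (by positivity) (by
                rw [div_le_iff₀ hs0]
                nlinarith) S'' (fun u hu => hST u (hmem u (hS' (hS'' hu))).1)
              (fun u hu => (hS''q u hu).trans (by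
                rw [hδ]
                have : η (k' + 1) ^ 2 * (h * σ / 2) ≤ η (k' + 1) ^ 2 * s := by
                  gcongr
                  linarith
                linarith)) (by
                rw [div_mul_cancel₀ _ hs0.ne']
                exact hsep.subset fun u hu => (hmem u (hS' (hS'' hu))).1)
            refine this.trans ?_
            have : 1 / (ε * σ / s) ≤ h / ε := by
              rw [one_div_div, div_le_div_iff₀ (by positivity) hε]
              nlinarith
            gcongr
      refine hcl.trans ?_
      have h4 : (1 / h + 1) ^ k' ≤ (2 / h) ^ k' := by
        have : 1 ≤ 1 / h := by rw [le_div_iff₀ hh0]; linarith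
        gcongr
        linarith [show 2 / h = 1 / h + 1 / h by ring]
      have h5 : h ^ d ≤ h ^ k' * h := by
        rw [← pow_succ]
        exact pow_le_pow_of_le_one hh0.le hh1 (by omega)
      calc B * (1 / h + 1) ^ k' * (C * (1 / δ) ^ n * (C₁ * (h / ε) ^ d))
          ≤ B * (2 / h) ^ k' * (C * (1 / δ) ^ n * (C₁ * (h / ε) ^ d)) := by
            have := mul_nonneg hpn hin
            gcongr
        _ = K * (1 / ε) ^ d * (h ^ d / h ^ k') := by
            rw [hK, div_pow 2 h, div_pow h ε, one_div_pow ε]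
            field_simp
        _ ≤ K * (1 / ε) ^ d * h := by
            have : h ^ d / h ^ k' ≤ h := by
              rw [div_le_iff₀ (by positivity)]
              linarith
            gcongr
    have hgeo : ∑ i ∈ Finset.range J, (1 / 2 : ℝ) ^ i ≤ 2 := by
      have := sum_geometric_two_le J
      simpa using this
    have hKε : 0 ≤ K * (1 / ε) ^ d := by positivity
    calc (S.card : ℝ) ≤ (S.filter (G J)).card +
          ∑ i ∈ Finset.range J, ((S.filter fun u => G i u ∧ ¬ G (i + 1) u).card : ℝ) := by
          exact_mod_cast hlay
      _ ≤ B * 3 ^ d * (1 / ε) ^ d + ∑ i ∈ Finset.range J, K * (1 / ε) ^ d * (1 / 2) ^ i :=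
          add_le_add hlast (Finset.sum_le_sum hlayer)
      _ = B * 3 ^ d * (1 / ε) ^ d + K * (1 / ε) ^ d * ∑ i ∈ Finset.range J, (1 / 2 : ℝ) ^ i := by
          rw [Finset.mul_sum]
      _ ≤ B * 3 ^ d * (1 / ε) ^ d + K * (1 / ε) ^ d * 2 := by gcongr
      _ = _ := by ring

/-- Counting theorem: sets without strained points of rank `d + 1` have at most
`d`-dimensional packings, uniformly. -/
theorem exists_count (n : ℕ) (η : ℕ → ℝ) (hη : Ladder n η) (C : ℝ) (hC : 1 ≤ C) (d : ℕ)
    (hd : d ≤ n) :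
    ∃ C' : ℝ, 1 ≤ C' ∧ ∀ (X : Type) [MetricSpace X] (e R r₀ : ℝ), Model X n e R η →
      Packing X n C r₀ → 4 * r₀ ≤ R → ∀ T : Set X,
      (∀ p ∈ T, ∀ s : ℝ, 0 < s → s ≤ r₀ → ∀ c : Fin (d + 1) → Bool → X,
        ¬ Strainer (η (d + 1)) s p c) →
      ∀ (p : X) (r : ℝ), 0 < r → r ≤ η 0 ^ 2 * r₀ / 4 → ∀ ε : ℝ, 0 < ε → ε ≤ 1 →
      ∀ S : Finset X, (∀ u ∈ S, u ∈ T) → (∀ u ∈ S, dist p u ≤ r) → FarApart (ε * r) S →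
      (S.card : ℝ) ≤ C' * (1 / ε) ^ d := by
  obtain ⟨C₁, hC₁, hcount⟩ := exists_count_aux n η hη C hC d hd d le_rfl
  have hη0 := hη.pos 0 (by omega)
  have hη1 := hη.le 0 (by omega)
  have hq : η 0 ^ 2 / 4 ≤ 1 := by nlinarith
  refine ⟨C₁ * (4 / η 0 ^ 2) ^ d, ?_, ?_⟩
  · have : 1 ≤ 4 / η 0 ^ 2 := by
      rw [le_div_iff₀ (by positivity)]
      linarith
    have := one_le_pow₀ this (n := d)
    nlinarith
  intro X _ e R r₀ hM hpack hrR T hT p r hr hrr ε hε hε1 S hST hS hsep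
  have h1 : r * 4 / η 0 ^ 2 ≤ r₀ := by
    rw [div_le_iff₀ (by positivity)]
    linarith
  have := hcount X e R r₀ hM hpack hrR T hT 0 (by omega) p (r * 4 / η 0 ^ 2) (fun i => i.elim0)
    (by positivity) h1 ⟨fun i => i.elim0, fun i => i.elim0, fun i => i.elim0⟩
    (ε * (η 0 ^ 2 / 4)) (by positivity) (by nlinarith) S hST
    (fun u hu => by
      rw [show η 0 ^ 2 * (r * 4 / η 0 ^ 2) / 4 = r by field_simp]
      exact hS u hu)
    (by
      rw [show ε * (η 0 ^ 2 / 4) * (r * 4 / η 0 ^ 2) = ε * r by field_simp]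
      exact hsep)
  refine this.trans (le_of_eq ?_)
  rw [show 1 / (ε * (η 0 ^ 2 / 4)) = (4 / η 0 ^ 2) * (1 / ε) by field_simp, mul_pow]
  ring

theorem orthogonal_aux {e η ε₀ h s A B Z A' B' : ℝ} (he : 0 ≤ e) (heη : e ≤ η)
    (hη : 100 * η ≤ ε₀) (hε : 0 < ε₀) (hh : 0 < h) (hs : 0 ≤ s) (hs1 : s ≤ 1)
    (hs2 : 4 * ε₀ ≤ s) (hB : 0 < B) (hB2 : B ≤ 2 * h) (hsB : (1 - s) * B ≤ 2 * h)
    (hZ0 : 0 ≤ Z) (hZ : Z ≤ 3 / 2 * h) (hA0 : 0 ≤ A') (hA : A' ≤ h) (hB0 : 0 ≤ B')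
    (hB' : B' ≤ 2 * h) (hZA : Z - A' ≤ ε₀ * h / 2) (hYB : B' - (1 - s) * B ≤ ε₀ * h / 2)
    (hQ : B ^ 2 - A ^ 2 - h ^ 2 ≤ 6 * η * h ^ 2) (hQ' : -(6 * η * h ^ 2) ≤ B' ^ 2 - A' ^ 2 - h ^ 2)
    (h2 : s * B * h ^ 2 + (1 - s) * B * A ^ 2 - (1 - s) * B * (s * B) * B -
      2 * e * Z * ((1 - s) * B * (s * B)) ≤ B * Z ^ 2) : False := by
  have hη0 : 0 ≤ η := he.trans heη
  have h1s : 0 ≤ 1 - s := by linarith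
  have h3 : s * h ^ 2 + (1 - s) * A ^ 2 - s * (1 - s) * B ^ 2 -
      2 * e * Z * (s * (1 - s) * B) ≤ Z ^ 2 := by
    refine le_of_mul_le_mul_left ?_ hB
    linarith
  have h4 : 2 * e * Z * (s * (1 - s) * B) ≤ 2 * η * h ^ 2 := by
    have h5 : s * (1 - s) ≤ 1 / 4 := by nlinarith [sq_nonneg (s - 1 / 2)]
    calc 2 * e * Z * (s * (1 - s) * B) ≤ 2 * η * (3 / 2 * h) * (1 / 4 * (2 * h)) := by
          gcongr
      _ ≤ _ := by
          have : 0 ≤ η * h ^ 2 := by positivity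
          linarith
  have h5 : (1 - s) * (B ^ 2 - A ^ 2 - h ^ 2) ≤ 6 * η * h ^ 2 := by
    have h6 : 0 ≤ 6 * η * h ^ 2 := by positivity
    exact (mul_le_mul_of_nonneg_left hQ h1s).trans (mul_le_of_le_one_left h6 (by linarith))
  have h6 : 2 * s * h ^ 2 - 8 * η * h ^ 2 ≤ h ^ 2 + Z ^ 2 - ((1 - s) * B) ^ 2 := by
    linarith [show s * h ^ 2 + (1 - s) * A ^ 2 - s * (1 - s) * B ^ 2 =
      (2 * s - 1) * h ^ 2 - (1 - s) * (B ^ 2 - A ^ 2 - h ^ 2) + ((1 - s) * B) ^ 2 by ring]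
  have h0 : 0 ≤ ε₀ * h / 2 := by positivity
  have h7 : Z ^ 2 - A' ^ 2 ≤ ε₀ * h / 2 * (5 / 2 * h) := by
    rw [sq_sub_sq, mul_comm]
    exact (mul_le_mul_of_nonneg_right hZA (by positivity)).trans
      (mul_le_mul_of_nonneg_left (by linarith) h0)
  have h8 : B' ^ 2 - ((1 - s) * B) ^ 2 ≤ ε₀ * h / 2 * (4 * h) := by
    rw [sq_sub_sq, mul_comm]
    exact (mul_le_mul_of_nonneg_right hYB (by positivity)).trans
      (mul_le_mul_of_nonneg_left (by linarith) h0)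
  have h9 : 4 * ε₀ * h ^ 2 ≤ s * h ^ 2 := by gcongr
  have h10 : 100 * η * h ^ 2 ≤ ε₀ * h ^ 2 := by gcongr
  have h11 : 0 < ε₀ * h ^ 2 := by positivity
  have h12 : 0 ≤ η * h ^ 2 := by positivity
  linarith

/-- If every point of a rich finite set `S` around `x` lies in a direction almost orthogonal to
`q`, then joining (contracted copies of) the points of `S` to `q` produces too many separated
points. -/
theorem LAlex.false_of_orthogonal {X : Type} [MetricSpace X] {e R : ℝ} (H : LAlex X e R)
    {η ε₀ C r₀ L : ℝ} {n : ℕ} (he : 0 ≤ e) (heη : e ≤ η) (hη : 100 * η ≤ ε₀) (hε : 0 < ε₀)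
    (hε1 : ε₀ ≤ 1) (hpack : Packing X n C r₀) {x q : X} (hxq : x ≠ q) (hr : 2 * dist x q ≤ r₀)
    (hR : 3 * dist x q ≤ R) (hL : dist x q ≤ L) (hLR : L ≤ R) {S : Finset X}
    (hS : ∀ w ∈ S, dist x w ≤ L) (hsep : FarApart (ε₀ * L) S)
    (hcard : C * (16 / ε₀) ^ n < (S.card - 1) / (8 * ε₀))
    (hlow : ∀ w, ε₀ * dist x q / 2 ≤ dist x w → dist x w ≤ dist x q → -η ≤ cosC x q w)
    (hup : ∀ w ∈ S, ε₀ * L / 2 ≤ dist x w → cosC x q w ≤ η) : False := by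
  classical
  obtain ⟨h, hh⟩ : ∃ h, h = dist x q := ⟨_, rfl⟩
  have hh0 : 0 < h := hh ▸ dist_pos.2 hxq
  rw [← hh] at hr hR hL hlow
  have hL0 : 0 < L := by linarith
  have hη0 : 0 ≤ η := he.trans heη
  set S₁ := S.filter fun w => ε₀ * L / 2 ≤ dist x w with hS₁
  have hc1 : (S.card : ℝ) - 1 ≤ S₁.card := by
    have h1 : (S.filter fun w => ¬ ε₀ * L / 2 ≤ dist x w).card ≤ 1 := by
      rw [Finset.card_le_one]
      intro u hu v hv
      rw [Finset.mem_filter, not_le] at hu hv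
      by_contra huv
      linarith [hsep u hu.1 v hv.1 huv, dist_triangle_left u v x]
    have h2 := Finset.card_filter_add_card_filter_not (s := S) (fun w => ε₀ * L / 2 ≤ dist x w)
    rw [← h2]
    push_cast
    have : ((S.filter fun w => ¬ ε₀ * L / 2 ≤ dist x w).card : ℝ) ≤ 1 := by exact_mod_cast h1
    linarith
  have hl0 : 0 < h / L := div_pos hh0 hL0
  have hl1 : h / L ≤ 1 := by rw [div_le_one hL0]; exact hL
  have hex : ∀ w, ∃ z, dist x z = h / L * dist x w ∧ dist z w = (1 - h / L) * dist x w := by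
    intro w
    obtain ⟨z, hz, hz'⟩ := H.geo x w (h / L * dist x w) (by positivity)
      (mul_le_of_le_one_left dist_nonneg hl1)
    exact ⟨z, hz, by rw [hz']; ring⟩
  choose b hb hb' using hex
  have hA : ∀ w ∈ S₁, ε₀ * h / 2 ≤ dist x (b w) ∧ dist x (b w) ≤ h := by
    intro w hw
    rw [hS₁, Finset.mem_filter] at hw
    rw [hb]
    constructor
    · calc ε₀ * h / 2 = h / L * (ε₀ * L / 2) := by field_simp
        _ ≤ _ := by gcongr; exact hw.2
    · calc h / L * dist x w ≤ h / L * L := by gcongr; exact hS w hw.1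
        _ = h := by field_simp
  have hQ : ∀ w ∈ S₁, |dist q (b w) ^ 2 - dist x (b w) ^ 2 - h ^ 2| ≤ 6 * η * h ^ 2 := by
    intro w hw
    have hA' := hA w hw
    have hbx : b w ≠ x := by
      rw [← dist_pos, dist_comm]
      have : 0 < ε₀ * h / 2 := by positivity
      linarith
    have hw' := hw
    rw [hS₁, Finset.mem_filter] at hw'
    have hwx : w ≠ x := by
      rw [← dist_pos, dist_comm]
      have : 0 < ε₀ * L / 2 := by positivity
      linarith
    have h1 := hlow (b w) hA'.1 hA'.2
    have hbq : dist (b w) q ≤ 2 * h := by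
      linarith [dist_triangle_left (b w) q x]
    have h2 := H.cosC_shorten hbx hxq.symm (by rw [hb, hb']; ring) ((hS w hw'.1).trans hLR)
      (hbq.trans (by linarith)) he
    have h3 : dist (b w) q / dist x q ≤ 2 := by
      rw [← hh, div_le_iff₀ hh0]
      exact hbq
    have h4 := hup w hw'.1 hw'.2
    rw [cosC_comm, cosC_comm x w q] at h2
    have h5 : cosC x q (b w) ≤ 3 * η := by
      have := mul_le_mul_of_nonneg_left h3 he
      linarith
    have h6 := cosC_mul hxq.symm hbx
    rw [← hh] at h6
    rw [h6, show h ^ 2 + dist x (b w) ^ 2 - 2 * h * dist x (b w) * cosC x q (b w) -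
      dist x (b w) ^ 2 - h ^ 2 = -(2 * h * dist x (b w)) * cosC x q (b w) by ring, abs_mul]
    have h7 : |cosC x q (b w)| ≤ 3 * η := abs_le.2 ⟨by linarith, h5⟩
    rw [abs_neg, abs_of_nonneg (by positivity)]
    calc 2 * h * dist x (b w) * |cosC x q (b w)| ≤ 2 * h * h * (3 * η) := by
          gcongr
          exact hA'.2
      _ = _ := by ring
  have hbq : ∀ w ∈ S₁, dist q (b w) ≤ 2 * h := fun w hw => by
    linarith [dist_triangle_left q (b w) x, hA w hw]
  have hex : ∀ (w : X) (s : ℝ), ∃ z, 0 ≤ s → s ≤ 1 → dist q z = (1 - s) * dist q (b w) ∧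
      dist z (b w) = s * dist q (b w) := by
    intro w s
    by_cases hs : 0 ≤ s ∧ s ≤ 1
    · obtain ⟨z, hz, hz'⟩ := H.geo q (b w) ((1 - s) * dist q (b w))
        (mul_nonneg (by linarith) dist_nonneg) (mul_le_of_le_one_left dist_nonneg (by linarith))
      exact ⟨z, fun _ _ => ⟨hz, by rw [hz']; ring⟩⟩
    · exact ⟨x, fun h1 h2 => absurd ⟨h1, h2⟩ hs⟩
  choose z hz using hex
  have key : ∀ w ∈ S₁, ∀ v ∈ S₁, ∀ s s', 0 ≤ s → s ≤ s' → s' ≤ 1 / 2 →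
      (s' = s ∧ v ≠ w ∨ s + 4 * ε₀ ≤ s') → ε₀ * h / 8 < dist (z w s) (z v s') := by
    intro w hw v hv s s' hs hss hs' hcase
    by_contra! hcon
    obtain ⟨hzw, hzw'⟩ := hz w s hs (by linarith)
    obtain ⟨hzv, hzv'⟩ := hz v s' (by linarith) (by linarith)
    have h1s : 0 < 1 - s := by linarith
    obtain ⟨y, hy, hy'⟩ := H.geo (z v s') (b v) ((s / (1 - s)) * dist q (z v s')) (by positivity) (by
      rw [hzv, hzv', ← mul_assoc, div_mul_eq_mul_div]
      refine mul_le_mul_of_nonneg_right ?_ dist_nonneg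
      rw [div_le_iff₀ h1s]
      nlinarith)
    obtain ⟨s₂, hs₂⟩ : ∃ s₂, s₂ = (s' - s) / (1 - s) := ⟨_, rfl⟩
    have hs₂0 : 0 ≤ s₂ := hs₂ ▸ div_nonneg (by linarith) h1s.le
    have hs₂1 : s₂ ≤ 1 := by rw [hs₂, div_le_one h1s]; linarith
    have hs₂s : s' - s ≤ s₂ := by
      rw [hs₂, le_div_iff₀ h1s]
      nlinarith
    have hyv : dist y (b v) = s₂ * dist q (b v) := by
      rw [hy', hzv, hzv', hs₂]
      field_simp
      ring
    have hqy : dist q y = (1 - s₂) * dist q (b v) := by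
      refine le_antisymm ((dist_triangle q (z v s') y).trans (le_of_eq ?_)) ?_
      · rw [hy, hzv, hs₂]
        field_simp
        ring
      · linarith [dist_triangle q y (b v)]
    have hqy' : dist q (z v s') = (1 - s) * dist q y := by
      rw [hqy, hzv, hs₂]
      field_simp
      ring
    have hBv := hbq v hv
    have hBw := hbq w hw
    have hqy2 : dist q y ≤ 2 * h := by
      rw [hqy]
      exact (mul_le_of_le_one_left dist_nonneg (by linarith)).trans hBv
    have h1 := H.hom q (b w) y (z w s) (z v s') (1 - s) (by linarith) (by linarith) h1s.le
      (by linarith) hzw (by rw [hzw']; ring) hqy' (by rw [hy, hqy']; field_simp; ring)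
    have hd : dist (b w) y ≤ ε₀ * h / 2 := by
      have : 1 / 4 * dist (b w) y ≤ (1 - s) / 2 * dist (b w) y :=
        mul_le_mul_of_nonneg_right (by linarith) dist_nonneg
      linarith
    rcases hcase with ⟨hs_eq, hne⟩ | hlt
    · have hs2 : s₂ = 0 := by rw [hs₂, hs_eq]; simp
      rw [hs2, zero_mul, dist_eq_zero] at hyv
      rw [hyv] at hd
      have hw' := (Finset.mem_filter.1 hw).1
      have hv' := (Finset.mem_filter.1 hv).1
      have h2 := H.hom x w v (b w) (b v) (h / L) ((hS w hw').trans hLR) ((hS v hv').trans hLR)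
        hl0.le hl1 (hb w) (hb' w) (hb v) (hb' v)
      have h3 : h / L / 2 * (ε₀ * L) < h / L / 2 * dist w v :=
        mul_lt_mul_of_pos_left (hsep w hw' v hv' hne.symm) (by positivity)
      rw [show h / L / 2 * (ε₀ * L) = ε₀ * h / 2 by field_simp] at h3
      linarith
    · have hAw := hA w hw
      have hAv := hA v hv
      have hxy : dist x y ≤ 3 / 2 * h := by
        have : ε₀ * h ≤ 1 * h := by gcongr
        linarith [dist_triangle x (b w) y]
      have hyx : dist y x ≤ 3 / 2 * h := by rw [dist_comm]; exact hxy
      have h2 := H.sq_dist_between (x := q) (z := y) (y := b v) x (by rw [hqy, hyv]; ring)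
        (by linarith) (by linarith)
      have hQv := abs_le.1 (hQ v hv)
      have hQw := abs_le.1 (hQ w hw)
      rw [dist_comm q x, ← hh, dist_comm (b v) x, dist_comm y x] at h2
      have hBpos : 0 < dist q (b v) := by
        rw [dist_pos]
        intro hqb
        have h6 : dist x (b v) ^ 2 = h ^ 2 := by rw [← hqb, ← hh]
        rw [h6, ← hqb, dist_self] at hQv
        have h7 : η * h ^ 2 ≤ 1 / 100 * h ^ 2 := by
          gcongr
          linarith
        have : 0 < h ^ 2 := by positivity
        linarith [hQv.1]
      have hYB := dist_triangle_right q (b w) y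
      rw [hqy] at hYB hqy2
      rw [hqy, hyv] at h2
      exact orthogonal_aux he heη hη hε hh0 hs₂0 hs₂1 (by linarith) hBpos hBv hqy2 dist_nonneg hxy
        dist_nonneg hAw.2 dist_nonneg hBw (by linarith [dist_triangle x (b w) y]) (by linarith)
        hQv.2 hQw.1 h2
  set J := ⌊1 / (8 * ε₀)⌋₊ with hJ
  have hJ1 : 1 / (8 * ε₀) ≤ (J + 1 : ℕ) := by
    push_cast
    exact (Nat.lt_floor_add_one _).le
  have hJ2 : ∀ j ∈ Finset.range (J + 1), 4 * ε₀ * (j : ℝ) ≤ 1 / 2 := by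
    intro j hj
    have h1 : (j : ℝ) ≤ J := by
      exact_mod_cast Nat.lt_succ_iff.1 (Finset.mem_range.1 hj)
    have h2 : (J : ℝ) ≤ 1 / (8 * ε₀) := Nat.floor_le (by positivity)
    calc 4 * ε₀ * (j : ℝ) ≤ 4 * ε₀ * (1 / (8 * ε₀)) := by
          gcongr
          linarith
      _ = 1 / 2 := by
          field_simp
          norm_num
  have key' : ∀ a ∈ S₁ ×ˢ Finset.range (J + 1), ∀ a' ∈ S₁ ×ˢ Finset.range (J + 1), a ≠ a' →
      ε₀ * h / 8 < dist (z a.1 (4 * ε₀ * a.2)) (z a'.1 (4 * ε₀ * a'.2)) := by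
    rintro ⟨w, j⟩ ha ⟨v, j'⟩ ha' hne
    rw [Finset.mem_product] at ha ha'
    have aux : ∀ i i' : ℕ, i < i' → 4 * ε₀ * (i : ℝ) + 4 * ε₀ ≤ 4 * ε₀ * (i' : ℝ) := by
      intro i i' hi
      have : (i : ℝ) + 1 ≤ i' := by exact_mod_cast hi
      calc 4 * ε₀ * (i : ℝ) + 4 * ε₀ = 4 * ε₀ * ((i : ℝ) + 1) := by ring
        _ ≤ _ := by gcongr
    rcases lt_trichotomy j j' with hlt | heq | hlt
    · exact key w ha.1 v ha'.1 _ _ (by positivity) (by linarith [aux j j' hlt]) (hJ2 _ ha'.2)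
        (Or.inr (aux j j' hlt))
    · subst heq
      refine key w ha.1 v ha'.1 _ _ (by positivity) le_rfl (hJ2 _ ha'.2) (Or.inl ⟨rfl, ?_⟩)
      rintro rfl
      exact hne rfl
    · rw [dist_comm]
      exact key v ha'.1 w ha.1 _ _ (by positivity) (by linarith [aux j' j hlt]) (hJ2 _ ha.2)
        (Or.inr (aux j' j hlt))
  have hinj : Set.InjOn (fun a : X × ℕ => z a.1 (4 * ε₀ * a.2))
      (S₁ ×ˢ Finset.range (J + 1) : Finset (X × ℕ)) := by
    intro a ha a' ha' hEq
    by_contra hne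
    have := key' a ha a' ha' hne
    simp only at hEq
    rw [hEq, dist_self] at this
    have : 0 < ε₀ * h / 8 := by positivity
    linarith
  have := hpack q (2 * h) (by linarith) hr (ε₀ / 16) (by positivity) (by linarith)
    ((S₁ ×ˢ Finset.range (J + 1)).image fun a => z a.1 (4 * ε₀ * a.2)) (by
      intro u hu
      obtain ⟨a, ha, rfl⟩ := Finset.mem_image.1 hu
      rw [Finset.mem_product] at ha
      have h1 := hJ2 _ ha.2
      have h0 : 0 ≤ 4 * ε₀ * (a.2 : ℝ) := by positivity
      rw [(hz a.1 _ h0 (by linarith)).1]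
      exact (mul_le_of_le_one_left dist_nonneg (by linarith)).trans (hbq _ ha.1)) (by
      intro u hu v hv huv
      obtain ⟨a, ha, rfl⟩ := Finset.mem_image.1 hu
      obtain ⟨a', ha', rfl⟩ := Finset.mem_image.1 hv
      have := key' a ha a' ha' (by rintro rfl; exact huv rfl)
      rw [show ε₀ / 16 * (2 * h) = ε₀ * h / 8 by ring]
      exact this)
  rw [Finset.card_image_of_injOn hinj, Finset.card_product, Finset.card_range, one_div_div] at this
  rw [Nat.cast_mul] at this
  have h1 : (S₁.card : ℝ) * (1 / (8 * ε₀)) ≤ S₁.card * (J + 1 : ℕ) := by gcongr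
  have h2 : ((S.card : ℝ) - 1) * (1 / (8 * ε₀)) ≤ S₁.card * (1 / (8 * ε₀)) := by gcongr
  rw [mul_one_div] at h2
  linarith

section NearCritical

variable {X : Type} [MetricSpace X] {e R η σ : ℝ} {k : ℕ} {p : X} {c : Fin k → Bool → X}

/-- If `q` differs from `x ∈ E` essentially in directions orthogonal to the strainer and `x` is
isolated in its fiber, then `x` is almost critical for the distance from `q`. -/
theorem Strainer.near_critical [CompactSpace X] (H : LAlex X e R) (hP : SmallParam e R η σ)
    (hc : Strainer η σ p c) {E : Set X} (hE : AlmostExt e R E) (hk : 100 * η * k ≤ 1) {x q : X}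
    (hxE : x ∈ E) (hxq : x ≠ q) {δ θ : ℝ} (hδ0 : 0 ≤ δ)
    (hδ : ∀ i, |strCoord c q i - strCoord c x i| ≤ δ * dist x q)
    (hθ : 4 * k * (δ + 12 * η) ≤ θ) (hθ1 : θ ≤ 1 / 2)
    (hx : dist p x + 4 * dist x q ≤ η ^ 2 * σ)
    (hiso : ∀ x' ∈ E, dist x x' ≤ 3 * dist x q → strCoord c x' = strCoord c x → x' = x) {w : X}
    (hw : w ≠ x) (hwθ : θ * dist x q ≤ dist x w) (hwR : dist x w + dist x q ≤ R) :
    -(2 * (θ + e)) ≤ cosC x q w := by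
  obtain ⟨h, hh⟩ : ∃ h, h = dist x q := ⟨_, rfl⟩
  have hh0 : 0 < h := hh ▸ dist_pos.2 hxq
  rw [← hh] at hδ hx hiso hwθ hwR
  have hη := hP.η0
  have he := hP.e0
  have hθ0 : 0 ≤ θ := le_trans (by positivity) hθ
  obtain ⟨p', hp'E, hmin⟩ := hE.1.isCompact.exists_isMinOn ⟨x, hxE⟩
    (continuous_const.dist continuous_id : Continuous fun y => dist q y).continuousOn
  rw [isMinOn_iff] at hmin
  have hqp : dist q p' ≤ h := by
    rw [hh, dist_comm x q]
    exact hmin x hxE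
  have hpq : dist p q ≤ η ^ 2 * σ := by linarith [dist_triangle p x q]
  have hpp' : dist p p' ≤ dist p x + 2 * h := by
    linarith [dist_triangle p x q, dist_triangle p q p']
  have hcoord : ∀ i, |strCoord c q i - strCoord c p' i| ≤ 12 * η * h := by
    intro i
    by_cases hqE : q ∈ E
    · have h1 := hmin q hqE
      rw [dist_self] at h1
      rw [dist_le_zero.1 h1, sub_self, abs_zero]
      positivity
    · exact (hc.coord_nearest H hP hE (by linarith) hpq hp'E hqE hmin i).trans (by gcongr)
  have hv : ∀ i, |strCoord c x i - strCoord c p' i| ≤ (δ + 12 * η) * h := by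
    intro i
    have h1 := abs_sub_le (strCoord c x i) (strCoord c q i) (strCoord c p' i)
    rw [abs_sub_comm (strCoord c x i) (strCoord c q i)] at h1
    linarith [hδ i, hcoord i]
  have hT : 4 * ∑ i, |strCoord c x i - strCoord c p' i| ≤ θ * h := by
    calc 4 * ∑ i, |strCoord c x i - strCoord c p' i| ≤ 4 * ∑ _i : Fin k, (δ + 12 * η) * h := by
          gcongr
          exact hv _
      _ = 4 * k * (δ + 12 * η) * h := by
          simp
          ring
      _ ≤ _ := by gcongr
  have hθh : θ * h ≤ 1 / 2 * h := by gcongr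
  obtain ⟨y, hyE, hy, hyd⟩ := hc.exists_coord_eq H hP hE hk hp'E
    (v := fun i => strCoord c x i - strCoord c p' i) (by linarith)
  have hyx : y = x := by
    refine hiso y hyE ?_ (funext fun i => by rw [hy]; ring)
    linarith [dist_triangle x q y, dist_triangle q p' y]
  rw [hyx] at hyd
  have hp'x : dist p' x ≤ θ * h := hyd.trans hT
  have hqE : q ∉ E := by
    intro hqE
    have h1 := hmin q hqE
    rw [dist_self] at h1
    rw [← dist_le_zero.1 h1, dist_comm, ← hh] at hp'x
    linarith
  have hxw : 0 < dist x w := dist_pos.2 hw.symm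
  have hp'w : dist p' w ≤ dist x w + θ * h := by linarith [dist_triangle p' x w]
  have key : dist q w ^ 2 ≤ h ^ 2 + (dist x w + θ * h) ^ 2 + 2 * e * h * (dist x w + θ * h) := by
    by_cases hwp : w = p'
    · rw [hwp]
      have h1 : dist q p' ^ 2 ≤ h ^ 2 := by gcongr
      have : 0 ≤ (dist x p' + θ * h) ^ 2 + 2 * e * h * (dist x p' + θ * h) := by positivity
      linarith
    · have hqp' : q ≠ p' := fun h' => hqE (h' ▸ hp'E)
      have h1 := hE.2 q hqE p' hp'E hmin w hwp (by rw [dist_comm]; linarith) (by linarith)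
      rw [cosC_mul hqp' hwp, dist_comm p' q]
      have h2 : -(dist q p' * dist p' w * cosC p' q w) ≤ h * (dist x w + θ * h) * e := by
        calc -(dist q p' * dist p' w * cosC p' q w) = dist q p' * dist p' w * -cosC p' q w := by ring
          _ ≤ dist q p' * dist p' w * e := by gcongr; linarith
          _ ≤ _ := by gcongr
      have h3 : dist q p' ^ 2 ≤ h ^ 2 := by gcongr
      have h4 : dist p' w ^ 2 ≤ (dist x w + θ * h) ^ 2 := by gcongr
      linarith
  rw [cosC_mul hxq.symm hw, ← hh] at key
  have h1 : θ * h * (θ * h) ≤ θ * h * dist x w := by gcongr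
  have h2 : e * h * (θ * h) ≤ e * h * dist x w := by gcongr
  have h3 : 0 ≤ θ * h * dist x w := by positivity
  have hpos : 0 < 2 * h * dist x w := by positivity
  refine le_of_mul_le_mul_left ?_ hpos
  linarith

/-- Almost criticality at both ends of a segment makes directions to far points orthogonal. -/
theorem LAlex.cosC_le_of_segment (H : LAlex X e R) (he : 0 ≤ e) {x q q' y w : X} {h θ : ℝ}
    (hh : 0 < h) (hθ : 0 ≤ θ) (hxq : dist x q = h) (hqy : dist q y = 7 * h) (hxq' : dist x q' = 7 * h)
    (hq'y : dist q' y = h) (hxy : dist x y = 8 * h) (hw : 16 * h ≤ dist x w)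
    (hwR : 2 * dist x w ≤ R) (hcr : -θ ≤ cosC y q' w) :
    cosC x q w ≤ 8 * h / dist x w + 2 * θ + 4 * e := by
  have hxw : 0 < dist x w := by linarith
  have hwx : w ≠ x := (dist_pos.1 hxw).symm
  have hqx : q ≠ x := (dist_pos.1 (by rw [hxq]; exact hh)).symm
  have hyq : q' ≠ y := dist_pos.1 (by rw [hq'y]; exact hh)
  have b1 : dist y w ≤ 3 / 2 * dist x w := by linarith [dist_triangle_left y w x]
  have b0 : 0 < dist y w := by linarith [dist_triangle x y w]
  have b2 : dist q w ≤ 3 / 2 * dist x w := by linarith [dist_triangle_left q w x]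
  have b3 : dist q' w ≤ 3 / 2 * dist x w := by linarith [dist_triangle_left q' w x]
  have h1 := H.sq_dist_between (x := x) (z := q) (y := y) w (by linarith) (by linarith) (by linarith)
  have h2 := H.sq_dist_between (x := x) (z := q') (y := y) w (by linarith) (by linarith) (by linarith)
  have h3 := cosC_mul hyq (dist_pos.1 b0).symm
  have h4 := cosC_mul hqx hwx
  rw [dist_comm y q', hq'y] at h3
  rw [hxq, hqy, hxy] at h1
  rw [hxq', hq'y, hxy] at h2
  rw [hxq] at h4
  have h5 : 7 * dist x w ^ 2 + dist y w ^ 2 - 56 * h ^ 2 - 14 * e * dist q w * h ≤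
      8 * dist q w ^ 2 := by
    refine le_of_mul_le_mul_left ?_ hh
    linarith
  have h6 : dist x w ^ 2 + 7 * dist y w ^ 2 - 56 * h ^ 2 - 14 * e * dist q' w * h ≤
      8 * dist q' w ^ 2 := by
    refine le_of_mul_le_mul_left ?_ hh
    linarith
  have h7 : -(2 * h * dist y w * cosC y q' w) ≤ 3 * h * dist x w * θ := by
    calc -(2 * h * dist y w * cosC y q' w) = 2 * h * dist y w * -cosC y q' w := by ring
      _ ≤ 2 * h * dist y w * θ := by gcongr; linarith
      _ ≤ 2 * h * (3 / 2 * dist x w) * θ := by gcongr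
      _ = _ := by ring
  have h8 : e * dist q w * h ≤ e * (3 / 2 * dist x w) * h := by gcongr
  have h9 : e * dist q' w * h ≤ e * (3 / 2 * dist x w) * h := by gcongr
  have hpos : 0 < 2 * h * dist x w := by positivity
  have h10 : 2 * h * dist x w * (8 * h / dist x w + 2 * θ + 4 * e) =
      16 * h ^ 2 + 4 * (h * dist x w * θ) + 8 * (e * dist x w * h) := by
    field_simp
    ring
  have h11 : 0 ≤ h * dist x w * θ := by positivity
  have h12 : 0 ≤ e * dist x w * h := by positivity
  refine le_of_mul_le_mul_left ?_ hpos
  rw [h10]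
  linarith

/-- Along a segment with equal end coordinates, the coordinates are almost constant. -/
theorem Strainer.coord_of_segment (H : LAlex X e R) (hP : SmallParam e R η σ)
    (hc : Strainer η σ p c) {x q y : X} {h : ℝ} (hh : 0 < h) (hxq : dist x q = h)
    (hqy : dist q y = 7 * h) (hxy : dist x y = 8 * h) (hf : strCoord c x = strCoord c y)
    (hx : dist p x + 8 * h ≤ η ^ 2 * σ) (i : Fin k) :
    |strCoord c q i - strCoord c x i| ≤ 50 * η * h := by
  have hη := hP.η0
  have hσ := hP.σ0
  have he := hP.e0
  have hpx : dist p x ≤ η ^ 2 * σ := by linarith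
  have hpy : dist p y ≤ η ^ 2 * σ := by linarith [dist_triangle p x y]
  have hpq : dist p q ≤ η ^ 2 * σ := by linarith [dist_triangle p x q]
  have hrad := hP.rad_le
  have hrad' := hP.rad_le'
  have hσR := hP.σR
  have key : ∀ b, dist x (c i b) - dist q (c i b) ≤ 30 * η * h := by
    intro b
    have h0 : |dist x (c i b) - dist y (c i b)| ≤ 88 * η * h := by
      cases b
      · have h1 := hc.sum_le' H hP hpy hpx i
        rw [hf, sub_self, add_zero, dist_comm y x, hxy] at h1
        linarith
      · have h1 := congrFun hf i
        simp only [strCoord] at h1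
        rw [h1, sub_self, abs_zero]
        positivity
    have h1 := H.sq_dist_between (x := x) (z := q) (y := y) (c i b) (by linarith)
      (by linarith [dist_nonneg (x := p) (y := x)])
      (by linarith [(hc.dist_near' hP hpq i b).2])
    rw [hxq, hqy, hxy] at h1
    have n1 := hc.dist_near' hP hpx i b
    have n2 := hc.dist_near' hP hpy i b
    have n3 := hc.dist_near' hP hpq i b
    generalize dist x (c i b) = A at *
    generalize dist y (c i b) = B at *
    generalize dist q (c i b) = Q at *
    have h2 : 7 * A ^ 2 + B ^ 2 - 56 * h ^ 2 - 14 * e * Q * h ≤ 8 * Q ^ 2 := by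
      refine le_of_mul_le_mul_left ?_ hh
      linarith
    have h3 : A ^ 2 - B ^ 2 ≤ 88 * η * h * (202 / 100 * σ) := by
      rw [sq_sub_sq, mul_comm]
      have := (abs_le.1 h0).2
      exact (mul_le_mul_of_nonneg_right this (by linarith)).trans
        (mul_le_mul_of_nonneg_left (by linarith) (by positivity))
    by_contra! hcon
    have h4 : 30 * η * h * (198 / 100 * σ) ≤ (A - Q) * (A + Q) := by
      apply mul_le_mul hcon.le (by linarith) (by positivity)
      have : 0 ≤ 30 * η * h := by positivity
      linarith
    have h5 : h * h ≤ η * σ / 8000 * h := by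
      gcongr
      linarith [dist_nonneg (x := p) (y := x)]
    have h6 : e * Q * h ≤ η / 1000 * (101 / 100 * σ) * h := by
      have := hP.e1
      have := hP.sq_le
      gcongr
      · linarith
      · linarith
      · exact n3.2
    have h7 : 0 < η * σ * h := by positivity
    linarith
  have h1 := abs_le.1 (hc.sum_le' H hP hpx hpq i)
  rw [hxq] at h1
  have h2 := key true
  have h3 := key false
  simp only [strCoord] at h1 ⊢
  have : 0 < η * h := by positivity
  rw [abs_le]
  constructor <;> linarith

end NearCritical

/-- The ball of radius `L` around `p` contains many separated points, compared with the packing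
constant `C`. -/
def Rich (X : Type) [MetricSpace X] (n : ℕ) (C ε₀ L : ℝ) (p : X) : Prop :=
  ∃ S : Finset X, (∀ w ∈ S, dist p w ≤ L / 2) ∧ FarApart (ε₀ * L) S ∧
    C * (16 / ε₀) ^ n < (S.card - 1) / (8 * ε₀)

/-- The data near a strained point `p` of `E` from which bi-Lipschitz coordinates on `E` are
obtained. -/
structure Chart {X : Type} [MetricSpace X] {k : ℕ} (n : ℕ) (e R η σ C r₀ ε₀ L lam : ℝ) (p : X)
    (c : Fin k → Bool → X) (E : Set X) : Prop where
  alex : LAlex X e R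
  small : SmallParam e R η σ
  str : Strainer η σ p c
  ext : AlmostExt e R E
  pack : Packing X n C r₀
  rich : Rich X n C ε₀ L p
  ε₀_pos : 0 < ε₀
  ε₀_le : ε₀ ≤ 1
  lam_pos : 0 < lam
  lam_le : lam ≤ 1
  η_le : 1000000 * (k + 1) ^ 2 * η ≤ lam ^ 2 * ε₀
  L_pos : 0 < L
  L_le : 4 * L ≤ η ^ 2 * σ
  L_r₀ : L ≤ r₀

section Chart

variable {X : Type} [MetricSpace X] {k n : ℕ} {e R η σ C r₀ ε₀ L lam : ℝ} {p : X}
  {c : Fin k → Bool → X} {E : Set X}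

theorem Chart.η_ε₀ (h : Chart n e R η σ C r₀ ε₀ L lam p c E) :
    1000000 * (k + 1) ^ 2 * η ≤ ε₀ :=
  h.η_le.trans (mul_le_of_le_one_left h.ε₀_pos.le (pow_le_one₀ h.lam_pos.le h.lam_le))

theorem Chart.k_le (h : Chart n e R η σ C r₀ ε₀ L lam p c E) : 100 * η * k ≤ 1 := by
  have h1 := h.η_ε₀
  have h2 := h.ε₀_le
  have h3 := h.small.η0
  have : 0 ≤ η * (k : ℝ) ^ 2 := by positivity
  have : 0 ≤ η * (k : ℝ) := by positivity
  linarith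

theorem Chart.e_le (h : Chart n e R η σ C r₀ ε₀ L lam p c E) : e ≤ ε₀ / 1000000000 := by
  have h1 := h.η_ε₀
  have h3 := h.small.η0
  have h4 := h.small.e1
  have h5 := h.small.sq_le
  have : 0 ≤ η * (k : ℝ) ^ 2 := by positivity
  have : 0 ≤ η * (k : ℝ) := by positivity
  linarith

theorem Chart.L_le_R (h : Chart n e R η σ C r₀ ε₀ L lam p c E) : 100 * L ≤ R := by
  linarith [h.L_le, h.small.rad_le', h.small.σR, h.small.σ0]

theorem Chart.false_of_orthogonal (h : Chart n e R η σ C r₀ ε₀ L lam p c E) {x q : X}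
    (hxq : x ≠ q) (hpx : dist p x ≤ L / 2) (hxq' : 4 * dist x q ≤ L)
    (hlow : ∀ w, w ≠ x → ε₀ * dist x q / 2 ≤ dist x w → dist x w ≤ dist x q →
      -(ε₀ / 100) ≤ cosC x q w)
    (hup : ∀ w, dist x w ≤ L → ε₀ * L / 2 ≤ dist x w → cosC x q w ≤ ε₀ / 100) : False := by
  obtain ⟨S, hS, hsep, hcard⟩ := h.rich
  have hS' : ∀ w ∈ S, dist x w ≤ L := fun w hw => by
    linarith [dist_triangle_left x w p, hS w hw]
  refine h.alex.false_of_orthogonal (η := ε₀ / 100) h.small.e0 (by linarith [h.e_le, h.ε₀_pos])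
    (by linarith) h.ε₀_pos h.ε₀_le h.pack hxq ?_ ?_ ?_ ?_ hS' hsep hcard ?_ ?_
  · linarith [h.L_r₀, dist_nonneg (x := x) (y := q)]
  · linarith [h.L_le_R, h.L_pos]
  · linarith [dist_nonneg (x := x) (y := q)]
  · linarith [h.L_le_R, h.L_pos]
  · intro w hw hw'
    refine hlow w ?_ hw hw'
    rw [← dist_pos, dist_comm]
    have := dist_pos.2 hxq
    have := h.ε₀_pos
    have : 0 < ε₀ * dist x q / 2 := by positivity
    linarith
  · exact fun w hw hw' => hup w (hS' w hw) hw'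

theorem Chart.injOn [CompactSpace X] (h : Chart n e R η σ C r₀ ε₀ L lam p c E) {r : ℝ}
    (hr : 100000 * r ≤ ε₀ ^ 2 * L)
    (hfin : ∀ y, {z | z ∈ E ∧ dist p z ≤ 20 * r ∧ strCoord c z = y}.Finite) :
    InjOn (strCoord c) (E ∩ closedBall p r) := by
  classical
  rintro x₀ ⟨hx₀E, hx₀⟩ y₀ ⟨hy₀E, hy₀⟩ hf
  by_contra hne
  rw [mem_closedBall, dist_comm] at hx₀ hy₀
  have hr0 : 0 ≤ r := dist_nonneg.trans hx₀
  set Φ := (hfin (strCoord c x₀)).toFinset with hΦ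
  have hmem : ∀ z, z ∈ Φ ↔ z ∈ E ∧ dist p z ≤ 20 * r ∧ strCoord c z = strCoord c x₀ := by
    intro z
    rw [hΦ, Set.Finite.mem_toFinset, mem_ofPred_eq]
  have hx₀Φ : x₀ ∈ Φ := (hmem x₀).2 ⟨hx₀E, by linarith, rfl⟩
  have hy₀Φ : y₀ ∈ Φ := (hmem y₀).2 ⟨hy₀E, by linarith, hf.symm⟩
  obtain ⟨⟨x, y⟩, hxy, hmin⟩ := Finset.exists_min_image ((Φ ×ˢ Φ).filter fun a => a.1 ≠ a.2)
    (fun a => dist a.1 a.2 + dist x₀ a.1 / 4)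
    ⟨(x₀, y₀), Finset.mem_filter.2 ⟨Finset.mem_product.2 ⟨hx₀Φ, hy₀Φ⟩, hne⟩⟩
  rw [Finset.mem_filter, Finset.mem_product] at hxy
  obtain ⟨⟨hx, hy⟩, hxyne⟩ := hxy
  simp only at hx hy hxyne
  have hmin' : ∀ a ∈ Φ, ∀ b ∈ Φ, a ≠ b →
      dist x y + dist x₀ x / 4 ≤ dist a b + dist x₀ a / 4 := fun a ha b hb hab =>
    hmin (a, b) (Finset.mem_filter.2 ⟨Finset.mem_product.2 ⟨ha, hb⟩, hab⟩)
  have h0 := hmin' x₀ hx₀Φ y₀ hy₀Φ hne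
  rw [dist_self, zero_div, add_zero] at h0
  have h00 : dist x₀ y₀ ≤ 2 * r := by linarith [dist_triangle_left x₀ y₀ p]
  obtain ⟨s, hs⟩ : ∃ s, s = dist x y / 8 := ⟨_, rfl⟩
  have hs0 : 0 < s := by
    have := dist_pos.2 hxyne
    linarith
  have hxy8 : dist x y = 8 * s := by linarith
  have hd0 := dist_nonneg (x := x₀) (y := x)
  have hsr : 4 * s ≤ r := by linarith
  have hpx : dist p x ≤ 9 * r := by linarith [dist_triangle p x₀ x]
  have hpy : dist p y ≤ 11 * r := by linarith [dist_triangle p x y]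
  obtain ⟨hxE, -, hfx⟩ := (hmem x).1 hx
  obtain ⟨hyE, -, hfy⟩ := (hmem y).1 hy
  have hisox : ∀ z ∈ E, dist x z ≤ 3 * s → strCoord c z = strCoord c x → z = x := by
    intro z hzE hz hzf
    by_contra hzx
    have := hmin' x hx z ((hmem z).2 ⟨hzE, by linarith [dist_triangle p x z], hzf.trans hfx⟩)
      (Ne.symm hzx)
    linarith
  have hisoy : ∀ z ∈ E, dist y z ≤ 3 * s → strCoord c z = strCoord c y → z = y := by
    intro z hzE hz hzf
    by_contra hzy
    have := hmin' y hy z ((hmem z).2 ⟨hzE, by linarith [dist_triangle p y z], hzf.trans hfy⟩)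
      (Ne.symm hzy)
    linarith [dist_triangle x₀ x y]
  obtain ⟨q, hxq, hqy⟩ := h.alex.geo x y s hs0.le (by linarith)
  rw [hxy8, show 8 * s - s = 7 * s by ring] at hqy
  obtain ⟨q', hxq', hq'y⟩ := h.alex.geo x y (7 * s) (by linarith) (by linarith)
  rw [hxy8, show 8 * s - 7 * s = s by ring] at hq'y
  have hε := h.ε₀_pos
  have hL := h.L_pos
  have hrL : 100000 * r ≤ ε₀ * L := by
    refine hr.trans (mul_le_mul_of_nonneg_right ?_ hL.le)
    rw [pow_two]
    exact mul_le_of_le_one_left hε.le h.ε₀_le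
  have hrL' : 100000 * r ≤ L := hrL.trans (mul_le_of_le_one_left hL.le h.ε₀_le)
  have hLσ := h.L_le
  have hLR := h.L_le_R
  have hη := h.small.η0
  have he := h.small.e0
  have hfxy : strCoord c x = strCoord c y := hfx.trans hfy.symm
  obtain ⟨θ, hθ⟩ : ∃ θ, θ = 4 * k * (50 * η + 12 * η) := ⟨_, rfl⟩
  have hθ0 : 0 ≤ θ := by rw [hθ]; positivity
  have hθε : θ ≤ ε₀ / 1000 := by
    have h1 := h.η_ε₀
    have : 0 ≤ η * (k : ℝ) ^ 2 := by positivity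
    have : 0 ≤ η * (k : ℝ) := by positivity
    rw [hθ]
    linarith
  have hε1 := h.ε₀_le
  have he' := h.e_le
  have hxqne : x ≠ q := dist_pos.1 (by rw [hxq]; exact hs0)
  have hyqne : y ≠ q' := dist_pos.1 (by rw [dist_comm, hq'y]; exact hs0)
  have hncx : ∀ w, w ≠ x → θ * s ≤ dist x w → dist x w + s ≤ R → -(2 * (θ + e)) ≤ cosC x q w := by
    intro w hw hw1 hw2
    rw [← hxq] at hw1 hw2
    refine h.str.near_critical h.alex h.small h.ext h.k_le hxE hxqne (δ := 50 * η) (by positivity)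
      (fun i => ?_) hθ.ge (by linarith) (by rw [hxq]; linarith) (by rw [hxq]; exact hisox) hw hw1 hw2
    rw [hxq]
    exact h.str.coord_of_segment h.alex h.small hs0 hxq hqy hxy8 hfxy (by linarith) i
  have hncy : ∀ w, w ≠ y → θ * s ≤ dist y w → dist y w + s ≤ R → -(2 * (θ + e)) ≤ cosC y q' w := by
    intro w hw hw1 hw2
    rw [dist_comm] at hq'y
    rw [← hq'y] at hw1 hw2
    refine h.str.near_critical h.alex h.small h.ext h.k_le hyE hyqne (δ := 50 * η) (by positivity)
      (fun i => ?_) hθ.ge (by linarith) (by rw [hq'y]; linarith) (by rw [hq'y]; exact hisoy) hw hw1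
      hw2
    rw [hq'y]
    exact h.str.coord_of_segment h.alex h.small hs0 hq'y (by rw [dist_comm]; exact hxq')
      (by rw [dist_comm]; exact hxy8) hfxy.symm (by linarith) i
  refine h.false_of_orthogonal hxqne (by linarith) (by rw [hxq]; linarith) ?_ ?_
  · intro w hw hw1 hw2
    rw [hxq] at hw1 hw2
    have h1 : θ * s ≤ ε₀ * s / 2 := by
      rw [mul_div_right_comm]
      exact mul_le_mul_of_nonneg_right (by linarith) hs0.le
    linarith [hncx w hw (h1.trans hw1) (by linarith)]
  · intro w hw1 hw2
    have hyw : 8 * s ≤ dist y w := by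
      linarith [dist_triangle x y w]
    have hyw' : dist y w ≤ dist x w + 8 * s := by
      linarith [dist_triangle_left y w x]
    have hθs : θ * s ≤ 1 * s := mul_le_mul_of_nonneg_right (by linarith) hs0.le
    have hwy : w ≠ y := by
      rw [← dist_pos, dist_comm]
      linarith
    have h1 := h.alex.cosC_le_of_segment he hs0 (by linarith) hxq hqy hxq' hq'y hxy8
      (by linarith) (by linarith) (hncy w hwy (by linarith) (by linarith))
    have h2 : 8 * s / dist x w ≤ ε₀ / 1000 := by
      rw [div_le_iff₀ (by linarith)]
      have h3 : ε₀ * (ε₀ * L / 2) ≤ ε₀ * dist x w := by gcongr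
      linarith
    linarith

end Chart

section Chart

variable {X : Type} [MetricSpace X] {k n : ℕ} {e R η σ C r₀ ε₀ L lam : ℝ} {p : X}
  {c : Fin k → Bool → X} {E : Set X}

theorem Chart.η_k (h : Chart n e R η σ C r₀ ε₀ L lam p c E) :
    1000000 * (η * (k * (k + lam))) ≤ lam ^ 2 * ε₀ ∧
      1000000 * (η * (k * (k + 1))) ≤ lam ^ 2 * ε₀ ∧
      1000000 * (η * k) ≤ lam ^ 2 * ε₀ ∧ 1000000 * η ≤ lam ^ 2 * ε₀ := by
  have h1 := h.η_le
  have h2 := h.small.η0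
  have h3 := h.lam_le
  have h4 := h.lam_pos
  have hk : (0 : ℝ) ≤ k := k.cast_nonneg
  have a1 : η * (k * lam) ≤ η * (k * 1) := by gcongr
  have a2 : 0 ≤ η * (k : ℝ) := by positivity
  have a3 : 0 ≤ η * (k : ℝ) ^ 2 := by positivity
  refine ⟨?_, ?_, ?_, ?_⟩ <;> linarith

theorem Chart.sum_sq_lower [CompactSpace X] (h : Chart n e R η σ C r₀ ε₀ L lam p c E) {ρ r : ℝ}
    (hinj : InjOn (strCoord c) (E ∩ closedBall p r)) (hr : 20 * ρ ≤ r)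
    (hρ : 100000 * ((k + 1) * ρ) ≤ lam * ε₀ ^ 2 * L) {x y : X} (hxE : x ∈ E) (hyE : y ∈ E)
    (hx : dist p x ≤ ρ) (hy : dist p y ≤ ρ) :
    (1 - 2 * lam ^ 2) * dist x y ^ 2 ≤ ∑ i, (strCoord c y i - strCoord c x i) ^ 2 := by
  by_contra! hcon
  obtain ⟨s, hs⟩ : ∃ s, s = dist x y := ⟨_, rfl⟩
  have hxyne : x ≠ y := by
    rintro rfl
    simp at hcon
  have hs0 : 0 < s := hs ▸ dist_pos.2 hxyne
  have hsρ : s ≤ 2 * ρ := by linarith [dist_triangle_left x y p]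
  have hρ0 : 0 < ρ := by linarith
  have hε := h.ε₀_pos
  have hL := h.L_pos
  have hlam := h.lam_pos
  have hlam1 := h.lam_le
  have hε1 := h.ε₀_le
  have hη := h.small.η0
  have he := h.small.e0
  have hLσ := h.L_le
  have hLR := h.L_le_R
  obtain ⟨hk1, hk2, hk3, hk4⟩ := h.η_k
  have hk : (0 : ℝ) ≤ k := k.cast_nonneg
  have hkρ : 0 ≤ k * ρ := by positivity
  have hlε : lam ^ 2 * ε₀ ≤ lam * ε₀ := by
    rw [pow_two, mul_assoc]
    exact mul_le_of_le_one_left (by positivity) hlam1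
  have hlε1 : lam * ε₀ ≤ 1 := mul_le_one₀ hlam1 hε.le hε1
  have hlε2 : lam * ε₀ ≤ ε₀ := mul_le_of_le_one_left hε.le hlam1
  have hl2 : lam ^ 2 * ε₀ ≤ lam ^ 2 := mul_le_of_le_one_right (by positivity) hε1
  have hL1 : lam * ε₀ ^ 2 * L ≤ L := by
    refine mul_le_of_le_one_left hL.le ?_
    rw [pow_two, ← mul_assoc]
    exact mul_le_one₀ hlε1 hε.le hε1
  obtain ⟨v, hv⟩ : ∃ v : Fin k → ℝ, v = fun i => strCoord c y i - strCoord c x i := ⟨_, rfl⟩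
  obtain ⟨V, hV⟩ : ∃ V, V = ∑ i, v i ^ 2 := ⟨_, rfl⟩
  obtain ⟨T, hT⟩ : ∃ T, T = ∑ i, |v i| := ⟨_, rfl⟩
  have hT0 : 0 ≤ T := hT ▸ Finset.sum_nonneg fun i _ => abs_nonneg _
  have hTs : T ≤ k * s := by
    rw [hT, hs, hv, dist_comm]
    exact sum_abs_sub_le_mul c y x
  have hVs : V < (1 - 2 * lam ^ 2) * s ^ 2 := by
    rw [hV, hs, hv]
    exact hcon
  have hV0 : 0 ≤ V := hV ▸ Finset.sum_nonneg fun i _ => sq_nonneg _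
  have hks : k * s ≤ 2 * (k * ρ) := by
    calc k * s ≤ k * (2 * ρ) := by gcongr
      _ = _ := by ring
  have hneg : ∑ i, |(-v) i| = T := by simp [hT]
  obtain ⟨q, hxq, hfq, hq⟩ := h.str.exists_multi_move h.alex h.small (x := x) (v := v) (by
    rw [← hT]; linarith)
  obtain ⟨q₂, hyq₂, hfq₂, hq₂⟩ := h.str.exists_multi_move h.alex h.small (x := y) (v := -v) (by
    rw [hneg]; linarith)
  rw [hneg] at hyq₂ hfq₂ hq₂
  rw [← hT] at hxq hfq hq
  obtain ⟨l, hl⟩ : ∃ l, l = dist y q := ⟨_, rfl⟩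
  obtain ⟨l₂, hl₂⟩ : ∃ l₂, l₂ = dist x q₂ := ⟨_, rfl⟩
  have hpy : dist p y ≤ η ^ 2 * σ := by linarith
  have hpx : dist p x ≤ η ^ 2 * σ := by linarith
  have hl0 : 0 ≤ l := hl ▸ dist_nonneg
  have hl₂0 : 0 ≤ l₂ := hl₂ ▸ dist_nonneg
  have herr : 175 * η * T * (s + T) ≤ lam ^ 2 * s ^ 2 := by
    calc 175 * η * T * (s + T) ≤ 175 * η * (k * s) * (s + k * s) := by gcongr
      _ = 175 * (η * (k * (k + 1))) * s ^ 2 := by ring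
      _ ≤ _ := by
        gcongr
        linarith
  have hlq : |l ^ 2 - (s ^ 2 - V)| ≤ lam ^ 2 * s ^ 2 := by
    have h1 := hq y hpy
    rw [← hs, dist_comm q y, ← hl] at h1
    have h2 : ∑ i, (v i ^ 2 + 2 * v i * (strCoord c x i - strCoord c y i)) = -V := by
      rw [hV, ← Finset.sum_neg_distrib]
      refine Finset.sum_congr rfl fun i _ => ?_
      rw [hv]
      ring
    rw [h2] at h1
    exact h1.trans herr
  have hlq₂ : |l₂ ^ 2 - (s ^ 2 - V)| ≤ lam ^ 2 * s ^ 2 := by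
    have h1 := hq₂ x hpx
    rw [dist_comm y x, ← hs, dist_comm q₂ x, ← hl₂] at h1
    have h2 : ∑ i, ((-v) i ^ 2 + 2 * (-v) i * (strCoord c y i - strCoord c x i)) = -V := by
      rw [hV, ← Finset.sum_neg_distrib]
      refine Finset.sum_congr rfl fun i _ => ?_
      rw [hv]
      simp only [Pi.neg_apply]
      ring
    rw [h2] at h1
    exact h1.trans herr
  have hlam2 : lam ^ 2 * s ^ 2 ≤ 1 * s ^ 2 := by
    gcongr
    exact pow_le_one₀ hlam.le hlam1
  have low : ∀ a, 0 ≤ a → |a ^ 2 - (s ^ 2 - V)| ≤ lam ^ 2 * s ^ 2 → lam * s ≤ a ∧ a ≤ 2 * s := by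
    intro a ha h1
    rw [abs_le] at h1
    constructor
    · refine le_of_sq_le_sq ?_ ha
      linarith
    · refine le_of_sq_le_sq ?_ (by linarith)
      have : 0 < s ^ 2 := by positivity
      linarith
  obtain ⟨hls, hls'⟩ := low l hl0 hlq
  obtain ⟨hls₂, hls₂'⟩ := low l₂ hl₂0 hlq₂
  have hlams : 0 < lam * s := by positivity
  have hyqne : y ≠ q := dist_pos.1 (by linarith)
  have hxqne : x ≠ q₂ := dist_pos.1 (by linarith)
  have hiso : ∀ a ∈ E, dist p a ≤ ρ → ∀ t, t ≤ 2 * s → ∀ z ∈ E, dist a z ≤ 3 * t →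
      strCoord c z = strCoord c a → z = a := by
    intro a haE ha t ht z hzE hz hzf
    refine hinj ⟨hzE, ?_⟩ ⟨haE, ?_⟩ hzf
    · rw [mem_closedBall, dist_comm]
      linarith [dist_triangle p a z]
    · rw [mem_closedBall, dist_comm]
      linarith
  obtain ⟨θ, hθ⟩ : ∃ θ, θ = 4 * k * (12 * η * k / lam + 12 * η) := ⟨_, rfl⟩
  have hθ0 : 0 ≤ θ := by rw [hθ]; positivity
  have hθε : θ ≤ lam * ε₀ / 10000 := by
    rw [hθ, show 4 * k * (12 * η * k / lam + 12 * η) = 48 * (η * (k * (k + lam))) / lam by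
      field_simp
      ring, div_le_iff₀ hlam]
    have : 0 ≤ η * (k * (k + lam)) := by positivity
    linarith
  have heε : e ≤ lam * ε₀ / 10000 := by
    have := h.small.e1
    have := h.small.sq_le
    linarith
  have hδ : ∀ (a : Fin k → ℝ) (b : ℝ) (i : Fin k), 0 ≤ b → lam * s ≤ b → |a i| ≤ 12 * η * T → |a i| ≤ 12 * η * k / lam * b := by
    intro a b i hb hb' ha
    refine ha.trans ?_
    calc 12 * η * T ≤ 12 * η * (k * s) := by gcongr
      _ = 12 * η * k / lam * (lam * s) := by field_simp
      _ ≤ _ := by gcongr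
  have hncy : ∀ w, w ≠ y → θ * l ≤ dist y w → dist y w + l ≤ R → -(2 * (θ + e)) ≤ cosC y q w := by
    intro w hw hw1 hw2
    rw [hl] at hw1 hw2
    refine h.str.near_critical h.alex h.small h.ext h.k_le hyE hyqne (δ := 12 * η * k / lam)
      (by positivity) (fun i => ?_) hθ.ge (by linarith) (by rw [← hl]; linarith)
      (by rw [← hl]; exact hiso y hyE hy l hls') hw hw1 hw2
    rw [← hl]
    refine hδ (fun i => strCoord c q i - strCoord c y i) l i hl0 hls ?_
    have h1 := hfq i
    rw [hv] at h1
    rwa [sub_sub, add_sub_cancel] at h1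
  have hncx : ∀ w, w ≠ x → θ * l₂ ≤ dist x w → dist x w + l₂ ≤ R →
      -(2 * (θ + e)) ≤ cosC x q₂ w := by
    intro w hw hw1 hw2
    rw [hl₂] at hw1 hw2
    refine h.str.near_critical h.alex h.small h.ext h.k_le hxE hxqne (δ := 12 * η * k / lam)
      (by positivity) (fun i => ?_) hθ.ge (by linarith) (by rw [← hl₂]; linarith)
      (by rw [← hl₂]; exact hiso x hxE hx l₂ hls₂') hw hw1 hw2
    rw [← hl₂]
    refine hδ (fun i => strCoord c q₂ i - strCoord c x i) l₂ i hl₂0 hls₂ ?_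
    have h1 := hfq₂ i
    rw [hv] at h1
    simp only [Pi.neg_apply] at h1
    rwa [show strCoord c q₂ i - strCoord c y i - -(strCoord c y i - strCoord c x i) =
      strCoord c q₂ i - strCoord c x i by ring] at h1
  have hθl : ∀ t, 0 ≤ t → θ * t ≤ ε₀ * t / 2 := by
    intro t ht
    rw [mul_div_right_comm]
    exact mul_le_mul_of_nonneg_right (by linarith) ht
  refine h.false_of_orthogonal hyqne (by linarith) (by rw [← hl]; linarith) ?_ ?_
  · intro w hw hw1 hw2
    rw [← hl] at hw1 hw2
    linarith [hncy w hw ((hθl l hl0).trans hw1) (by linarith)]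
  · intro w hw1 hw2
    have hρL : 100000 * ρ ≤ lam * ε₀ * (ε₀ * L) := by linarith
    have hεL : lam * ε₀ * (ε₀ * L) ≤ lam * ε₀ * (2 * dist y w) :=
      mul_le_mul_of_nonneg_left (by linarith) (by positivity)
    have hρw : 50000 * ρ ≤ lam * ε₀ * dist y w := by linarith
    have hkw : 50000 * (k * ρ) ≤ dist y w := by
      have : lam * ε₀ * (ε₀ * L) ≤ ε₀ * L := mul_le_of_le_one_left (by positivity) hlε1
      linarith
    have hρw' : 50000 * ρ ≤ dist y w :=
      hρw.trans (mul_le_of_le_one_left dist_nonneg hlε1)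
    have hpw : dist p w ≤ η ^ 2 * σ := by linarith [dist_triangle p y w]
    have hxw : dist x w ≤ 2 * dist y w := by linarith [dist_triangle x y w]
    have hxw' : dist y w ≤ 2 * dist x w := by linarith [dist_triangle_left y w x]
    have hwx : w ≠ x := by
      rw [← dist_pos, dist_comm]
      linarith
    have hwy : w ≠ y := by
      rw [← dist_pos, dist_comm]
      linarith
    have hθl₂ : θ * l₂ ≤ 1 * l₂ := by
      gcongr
      linarith
    have h1 := hncx w hwx (by linarith) (by linarith)
    have h2 := (abs_le.1 (hq w hpw)).1
    have h3 := (abs_le.1 (hq₂ w hpw)).1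
    have h4 : ∑ i, (v i ^ 2 + 2 * v i * (strCoord c x i - strCoord c w i)) +
        ∑ i, ((-v) i ^ 2 + 2 * (-v) i * (strCoord c y i - strCoord c w i)) = 0 := by
      rw [← Finset.sum_add_distrib]
      refine Finset.sum_eq_zero fun i _ => ?_
      rw [hv]
      simp only [Pi.neg_apply]
      ring
    have h5 := cosC_mul hxqne.symm hwx
    have h6 := cosC_mul hyqne.symm hwy
    rw [← hl₂] at h5
    rw [← hl] at h6
    have h7 : 2 * l₂ * dist x w * -cosC x q₂ w ≤ 2 * (2 * s) * (2 * dist y w) * (2 * (θ + e)) := by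
      calc 2 * l₂ * dist x w * -cosC x q₂ w ≤ 2 * l₂ * dist x w * (2 * (θ + e)) := by
            gcongr
            linarith
        _ ≤ _ := by gcongr
    have h8 : 175 * η * T * (dist x w + T) ≤ 175 * η * (k * s) * (3 * dist y w) := by
      gcongr
      linarith
    have h9 : 175 * η * T * (dist y w + T) ≤ 175 * η * (k * s) * (3 * dist y w) := by
      gcongr
      linarith
    have h10 : l * l ≤ 2 * s * (2 * (2 * ρ)) := by
      gcongr
      linarith
    have h11 : l₂ * l₂ ≤ 2 * s * (2 * (2 * ρ)) := by
      gcongr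
      linarith
    have h12 : s * (50000 * ρ) ≤ s * (lam * ε₀ * dist y w) := by gcongr
    have h13 : s * dist y w * (θ + e) ≤ s * dist y w * (lam * ε₀ / 5000) := by
      gcongr
      linarith
    have h14 : s * dist y w * (1000000 * (η * k)) ≤ s * dist y w * (lam * ε₀) :=
      mul_le_mul_of_nonneg_left (by linarith) (by positivity)
    have h15 : dist y w * ε₀ * (lam * s) ≤ dist y w * ε₀ * l := by gcongr
    have hpos : 0 < 2 * l * dist y w := by
      have : 0 < l := by linarith
      have : 0 < dist y w := by linarith
      positivity
    refine le_of_mul_le_mul_left ?_ hpos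
    have h16 : 0 ≤ s * dist y w * (lam * ε₀) := by positivity
    linarith

end Chart

section FiniteMeasure

variable {X : Type} [MetricSpace X]

/-- A bounded family of separated sets contains a maximal one, which is a net. -/
theorem exists_maximal_farApart {T : Set X} {r : ℝ} (hr : 0 ≤ r) {N : ℕ}
    (hN : ∀ S : Finset X, (∀ u ∈ S, u ∈ T) → FarApart r S → S.card ≤ N) :
    ∃ S : Finset X, (∀ u ∈ S, u ∈ T) ∧ FarApart r S ∧ ∀ u ∈ T, ∃ q ∈ S, dist u q ≤ r := by
  classical
  let P : ℕ → Prop := fun k => ∃ S : Finset X, (∀ u ∈ S, u ∈ T) ∧ FarApart r S ∧ S.card = k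
  have h0 : P 0 := ⟨∅, by simp, by simp [FarApart], rfl⟩
  obtain ⟨S, hST, hS, hcard⟩ : P (Nat.findGreatest P N) := Nat.findGreatest_spec (Nat.zero_le N) h0
  refine ⟨S, hST, hS, fun u hu => ?_⟩
  by_contra! hcon
  have huS : u ∉ S := fun h => by
    have := hcon u h
    rw [dist_self] at this
    exact absurd hr this.not_ge
  have hP : P (S.card + 1) := by
    refine ⟨insert u S, ?_, ?_, Finset.card_insert_of_notMem huS⟩
    · simpa using ⟨hu, hST⟩
    · intro a ha b hb hab
      rw [Finset.mem_insert] at ha hb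
      rcases ha with rfl | ha <;> rcases hb with rfl | hb
      · exact absurd rfl hab
      · exact hcon b hb
      · rw [dist_comm]
        exact hcon a ha
      · exact hS a ha b hb hab
  obtain ⟨S', h1, h2, h3⟩ := id hP
  have := Nat.le_findGreatest (h3 ▸ hN S' h1 h2) hP
  omega

open MeasureTheory Filter in
/-- A set whose separated subsets have polynomially bounded cardinality has bounded Hausdorff
measure. -/
theorem hausdorffMeasure_le_of_card_le [MeasurableSpace X] [BorelSpace X] {T : Set X} {r A : ℝ}
    {d : ℕ} (hr : 0 < r)
    (hT : ∀ ε, 0 < ε → ε ≤ 1 → ∀ S : Finset X, (∀ u ∈ S, u ∈ T) → FarApart (ε * r) S →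
      (S.card : ℝ) ≤ A * (1 / ε) ^ d) :
    Measure.hausdorffMeasure (d : ℝ) T ≤ ENNReal.ofReal (A * (2 * r) ^ d) := by
  let ε : ℕ → ℝ := fun j => 1 / (j + 1)
  have hε : ∀ j, 0 < ε j := fun j => Nat.one_div_pos_of_nat
  have hε1 : ∀ j, ε j ≤ 1 := fun j => by
    have := Nat.one_div_le_one_div (α := ℝ) (Nat.zero_le j)
    simpa [ε] using this
  have hex : ∀ j, ∃ S : Finset X, (∀ u ∈ S, u ∈ T) ∧ FarApart (ε j * r) S ∧
      ∀ u ∈ T, ∃ q ∈ S, dist u q ≤ ε j * r := fun j =>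
    exists_maximal_farApart (by have := hε j; positivity) (N := ⌊A * (1 / ε j) ^ d⌋₊)
      fun S h1 h2 => Nat.le_floor (hT _ (hε j) (hε1 j) S h1 h2)
  choose S hS1 hS2 hS3 using hex
  have hdiam : ∀ j (q : X), ediam (closedBall q (ε j * r)) ≤ ENNReal.ofReal (ε j * (2 * r)) := by
    intro j q
    refine ediam_le_of_forall_dist_le fun x hx y hy => ?_
    rw [mem_closedBall] at hx hy
    linarith [dist_triangle_right x y q]
  have hlim : Tendsto (fun j => ENNReal.ofReal (ε j * (2 * r))) atTop (nhds 0) := by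
    rw [← ENNReal.ofReal_zero]
    refine ENNReal.tendsto_ofReal ?_
    have := (tendsto_one_div_add_atTop_nhds_zero_nat (𝕜 := ℝ)).mul_const (2 * r)
    rwa [zero_mul] at this
  refine (Measure.hausdorffMeasure_le_liminf_sum (d : ℝ) T _ hlim
    (fun j (q : S j) => closedBall (q : X) (ε j * r))
    (Eventually.of_forall fun j q => hdiam j q) (Eventually.of_forall fun j u hu => ?_)).trans ?_
  · obtain ⟨q, hq, huq⟩ := hS3 j u hu
    exact mem_iUnion.2 ⟨⟨q, hq⟩, huq⟩
  · refine liminf_le_of_frequently_le' (Eventually.of_forall fun j => ?_).frequently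
    have hp : 0 < ε j * (2 * r) := by have := hε j; positivity
    calc ∑ q : S j, ediam (closedBall (q : X) (ε j * r)) ^ (d : ℝ)
        ≤ ∑ _q : S j, ENNReal.ofReal ((ε j * (2 * r)) ^ d) := by
          refine Finset.sum_le_sum fun q _ => ?_
          rw [ENNReal.rpow_natCast, ENNReal.ofReal_pow hp.le]
          gcongr
          exact hdiam j q
      _ = ENNReal.ofReal ((S j).card * (ε j * (2 * r)) ^ d) := by
          rw [Finset.sum_const, Finset.card_univ, Fintype.card_coe, nsmul_eq_mul,
            ENNReal.ofReal_mul (Nat.cast_nonneg _), ENNReal.ofReal_natCast]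
      _ ≤ _ := by
          refine ENNReal.ofReal_le_ofReal ?_
          calc (S j).card * (ε j * (2 * r)) ^ d
              ≤ A * (1 / ε j) ^ d * (ε j * (2 * r)) ^ d := by
                gcongr
                exact hT _ (hε j) (hε1 j) _ (hS1 j) (hS2 j)
            _ = _ := by
                rw [mul_assoc, ← mul_pow, ← mul_assoc, one_div, inv_mul_cancel₀ (hε j).ne', one_mul]

end FiniteMeasure

section Rich

variable {X : Type} [MetricSpace X]

/-- The ball of radius `r` around `p` contains more separated points than a set of dimension `d`
could. -/
def LocalRich (X : Type) [MetricSpace X] (d : ℕ) (r : ℝ) (p : X) : Prop :=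
  ∀ K : ℝ, ∃ ε, 0 < ε ∧ ε ≤ 1 ∧ ∃ S : Finset X, (∀ u ∈ S, dist p u ≤ r) ∧ FarApart (ε * r) S ∧
    K * (1 / ε) ^ d < S.card

theorem exists_localRich [CompactSpace X] {d : ℕ} (hX : dimH (univ : Set X) = (d + 1 : ℕ)) {r : ℝ}
    (hr : 0 < r) : ∃ p : X, LocalRich X d r p := by
  by_contra! hcon
  borelize X
  have hle : ∀ p : X, dimH (ball p r) ≤ (d : ℝ≥0∞) := by
    intro p
    have := hcon p
    rw [LocalRich] at this
    push Not at this
    obtain ⟨K, hK⟩ := this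
    refine dimH_le_of_hausdorffMeasure_ne_top (d := (d : ℝ≥0)) (ne_top_of_le_ne_top
      (ENNReal.ofReal_ne_top (r := K * (2 * r) ^ d)) ?_)
    rw [NNReal.coe_natCast]
    refine hausdorffMeasure_le_of_card_le hr fun ε h0 h1 S hS hsep => hK ε h0 h1 S (fun u hu => ?_) hsep
    rw [dist_comm]
    exact (mem_ball.1 (hS u hu)).le
  obtain ⟨t, -, htfin, ht⟩ := finite_cover_balls_of_compact (isCompact_univ (X := X)) hr
  have : dimH (univ : Set X) ≤ d := by
    refine (dimH_mono ht).trans ?_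
    rw [dimH_bUnion htfin.countable]
    exact iSup₂_le fun p _ => hle p
  rw [hX] at this
  exact absurd (Nat.cast_le.1 this) (by omega)

theorem LocalRich.of_near {d : ℕ} {e R r : ℝ} (H : LAlex X e R) {p q : X} (hr : 0 < r)
    (hp : LocalRich X d r p) (hpq : dist p q + r ≤ R) : LocalRich X d r q := by
  intro K
  have hD : 0 < dist p q + r := by positivity
  have hl : 0 < r / (dist p q + r) := by positivity
  obtain ⟨ε, h0, h1, S, hS, hsep, hcard⟩ := hp (K * (2 / (r / (dist p q + r))) ^ d)
  have hl1 : r / (dist p q + r) ≤ 1 := by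
    rw [div_le_one hD]
    linarith [dist_nonneg (x := p) (y := q)]
  obtain ⟨S', hc, hS', hsep'⟩ := H.exists_contract q S (fun u hu => by
    linarith [dist_triangle_left q u p, hS u hu] : ∀ u ∈ S, dist q u ≤ dist p q + r) hpq hl hl1
    (by positivity) hsep
  refine ⟨r / (dist p q + r) / 2 * ε, by positivity, ?_, S', ?_, ?_, ?_⟩
  · exact mul_le_one₀ (by linarith) h0.le h1
  · rwa [div_mul_cancel₀ _ hD.ne'] at hS'
  · rwa [mul_assoc]
  · rw [hc]
    convert hcard using 1
    rw [mul_assoc, ← mul_pow]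
    congr 2
    field_simp

theorem LocalRich.forall {d : ℕ} {e R r : ℝ} (H : LAlex X e R) (hR : 0 < R) {p : X} (hr : 0 < r)
    (hrR : 2 * r ≤ R) (hp : LocalRich X d r p) (q : X) : LocalRich X d r q := by
  have key : ∀ N : ℕ, ∀ q, dist p q ≤ N * (R / 2) → LocalRich X d r q := by
    intro N
    induction N with
    | zero =>
      intro q hq
      rw [Nat.cast_zero, zero_mul] at hq
      rwa [← dist_le_zero.1 hq]
    | succ N ih =>
      intro q hq
      push_cast at hq
      rcases le_total (dist p q) (R / 2) with h | h
      · exact hp.of_near H hr (by linarith)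
      · obtain ⟨z, hz1, hz2⟩ := H.geo p q (dist p q - R / 2) (by linarith) (by linarith)
        exact (ih z (by linarith)).of_near H hr (by linarith)
  obtain ⟨N, hN⟩ := exists_nat_ge (dist p q / (R / 2))
  exact key N q ((div_le_iff₀ (by positivity)).1 hN)

/-- A compact space of dimension `n` contains many separated points at all points and all small
scales. -/
theorem exists_uniform_rich [CompactSpace X] {n : ℕ} {e R C : ℝ} (H : LAlex X e R) (hR : 0 < R)
    (hn : 1 ≤ n) (hX : dimH (univ : Set X) = n) :
    ∃ ε₁ > 0, ∀ (q : X) (L : ℝ), 0 < L → L ≤ 4 * R → ∃ ε₀, ε₁ ≤ ε₀ ∧ ε₀ ≤ 1 ∧ ∃ S : Finset X,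
      (∀ w ∈ S, dist q w ≤ L / 4) ∧ FarApart (2 * ε₀ * L) S ∧
      C * (16 / ε₀) ^ n < (S.card - 1) / (8 * ε₀) := by
  obtain ⟨d, rfl⟩ : ∃ d, n = d + 1 := ⟨n - 1, by omega⟩
  have hr : 0 < R / 2 := by positivity
  obtain ⟨p, hp⟩ := exists_localRich hX hr
  have hall : ∀ q : X, ∃ ε, 0 < ε ∧ ε ≤ 1 ∧ ∃ S : Finset X, (∀ u ∈ S, dist q u ≤ R / 2) ∧
      FarApart (ε * (R / 2)) S ∧ (8 * C * 16 ^ (d + 1) * 32 ^ d + 1) * (1 / ε) ^ d < S.card :=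
    fun q => hp.forall H hR hr (by linarith) q _
  choose ε hε0 hε1 S hS hsep hcard using hall
  obtain ⟨t, -, htfin, ht⟩ := finite_cover_balls_of_compact (isCompact_univ (X := X)) hr
  obtain ⟨q₀, hq₀⟩ : ∃ q₀, ∀ q ∈ t, ε q₀ ≤ ε q := by
    have hne : htfin.toFinset.Nonempty := by
      obtain ⟨x, hx, -⟩ := mem_iUnion₂.1 (ht (mem_univ p))
      exact ⟨x, htfin.mem_toFinset.2 hx⟩
    obtain ⟨q₀, -, h⟩ := htfin.toFinset.exists_min_image ε hne
    exact ⟨q₀, fun q hq => h q (htfin.mem_toFinset.2 hq)⟩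
  refine ⟨ε q₀ / 32, by have := hε0 q₀; positivity, fun q L hL hLR => ?_⟩
  obtain ⟨x, hx, hqx⟩ := mem_iUnion₂.1 (ht (mem_univ q))
  rw [mem_ball] at hqx
  have hεx := hε0 x
  obtain ⟨S', hc, hS', hsep'⟩ := H.exists_contract q (S x) (r := R) (l := L / (4 * R)) (fun u hu => by
    linarith [dist_triangle q x u, hS x u hu]) le_rfl (by positivity)
    ((div_le_one (by positivity)).2 hLR) (by positivity) (hsep x)
  refine ⟨ε x / 32, by linarith [hq₀ x hx], by linarith [hε1 x], S', ?_, ?_, ?_⟩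
  · intro w hw
    have := hS' w hw
    rwa [show L / (4 * R) * R = L / 4 by field_simp] at this
  · rwa [show L / (4 * R) / 2 * (ε x * (R / 2)) = 2 * (ε x / 32) * L by field_simp; ring] at hsep'
  · rw [hc, lt_div_iff₀ (by positivity)]
    have h1 := hcard x
    have h2 : 1 ≤ (1 / ε x) ^ d := one_le_pow₀ (one_le_one_div hεx (hε1 x))
    have h3 : C * (16 / (ε x / 32)) ^ (d + 1) * (8 * (ε x / 32)) =
        8 * C * 16 ^ (d + 1) * 32 ^ d * (1 / ε x) ^ d := by
      rw [show 16 / (ε x / 32) = 16 * 32 * (1 / ε x) by field_simp, mul_pow, mul_pow, pow_succ 32,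
        pow_succ (1 / ε x)]
      field_simp
    rw [h3]
    linarith

end Rich

theorem exists_ladder (n : ℕ) {b : ℝ} (hb : 0 < b) :
    ∃ η : ℕ → ℝ, Ladder n η ∧ ∀ k ≤ n + 1, η k ≤ b := by
  obtain ⟨a, ha⟩ : ∃ a, a = min b (1 / 1000) / 300 := ⟨_, rfl⟩
  have ha0 : 0 < a := by
    rw [ha]
    have : 0 < min b (1 / 1000) := lt_min hb (by norm_num)
    positivity
  have hab : 300 * a = min b (1 / 1000) := by rw [ha]; ring
  have ha1 : a ≤ 1 := by linarith [min_le_right b (1 / 1000)]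
  have hle : ∀ k ≤ n + 1, 300 * a ^ 2 ^ (n + 1 - k) ≤ min b (1 / 1000) := fun k _ => by
    rw [← hab]
    exact mul_le_mul_of_nonneg_left (pow_le_of_le_one ha0.le ha1 (pow_ne_zero _ two_ne_zero))
      (by norm_num)
  refine ⟨fun k => 300 * a ^ 2 ^ (n + 1 - k), ⟨fun k _ => by positivity,
    fun k hk => (hle k hk).trans (min_le_right _ _), fun k hk => le_of_eq ?_⟩,
    fun k hk => (hle k hk).trans (min_le_left _ _)⟩
  rw [show n + 1 - k = (n + 1 - (k + 1)) + 1 by omega, pow_succ 2, pow_mul]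
  ring

/-- The scale at which spaces of curvature bounded below satisfy the local axioms. -/
theorem exists_model (n : ℕ) (κ : ℝ) {η : ℕ → ℝ} (hη : Ladder n η)
    (hη1 : ∀ k ≤ n + 1, η k ≤ 1 / (100 * (n + 1))) :
    ∃ e R : ℝ, 0 < R ∧ ∀ (X : Type) [MetricSpace X] [CompactSpace X], IsAlexandrov X κ →
      dimH (univ : Set X) = n →
      Model X n e R η ∧ ∀ E : Set X, IsExtremal κ E → AlmostExt e R E := by
  obtain ⟨k₀, hk₀, hmin⟩ := (Finset.range (n + 2)).exists_min_image η ⟨0, by simp⟩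
  rw [Finset.mem_range] at hk₀
  have h0 : 0 < η k₀ := hη.pos k₀ (by omega)
  have hmin' : ∀ k ≤ n + 1, η k₀ ≤ η k := fun k hk => hmin k (by rw [Finset.mem_range]; omega)
  have he : 0 < η k₀ ^ 2 / 16 := by positivity
  obtain ⟨R, hR, h⟩ := exists_scale κ he
  refine ⟨η k₀ ^ 2 / 16, R, hR, fun X _ _ hX hdim => ?_⟩
  obtain ⟨hL, hE⟩ := h X hX
  refine ⟨⟨hη, he.le, fun k hk => ?_, hR, hL, fun p s c hs hsR hc => ?_⟩, hE⟩
  · rw [mul_div_cancel₀ _ (by norm_num)]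
    exact pow_le_pow_left₀ h0.le (hmin' k hk) 2
  · have hsm : SmallParam (η k₀ ^ 2 / 16) R (η (n + 1)) s :=
      { e0 := he.le
        e1 := by
          have := pow_le_pow_left₀ h0.le (hmin' (n + 1) le_rfl) 2
          have := pow_pos h0 2
          linarith
        η0 := hη.pos _ le_rfl
        η1 := hη.le _ le_rfl
        σ0 := hs
        σR := hsR }
    have hle := hc.le_dimH hL hsm (E := univ) ⟨isClosed_univ, fun q hq => absurd (mem_univ q) hq⟩
      (by
        have := hη1 (n + 1) le_rfl
        rw [le_div_iff₀ (by positivity)] at this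
        push_cast
        linarith) (mem_univ p)
    rw [hdim] at hle
    exact absurd (Nat.cast_le.1 hle) (by omega)

/-- Extremal sets of dimension `m` have no strained points of higher rank. -/
theorem Model.not_strainer_of_dimH {X : Type} [MetricSpace X] [CompactSpace X] {n m : ℕ} {e R : ℝ}
    {η : ℕ → ℝ} (hM : Model X n e R η) (hη1 : ∀ k ≤ n + 1, η k ≤ 1 / (100 * (n + 1))) (hm : m ≤ n)
    {E : Set X} (hE : AlmostExt e R E) (hdim : dimH E = m) {p : X} (hp : p ∈ E) {s : ℝ} (hs : 0 < s)
    (hsR : 4 * s ≤ R) (c : Fin (m + 1) → Bool → X) : ¬ Strainer (η (m + 1)) s p c := by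
  intro hc
  have hle := hc.le_dimH hM.lalex (hM.small (by omega) hs hsR) hE
    (by
      have h1 := hη1 (m + 1) (by omega)
      rw [le_div_iff₀ (by positivity)] at h1
      have h2 := hM.lad.pos (m + 1) (by omega)
      have h3 : (m : ℝ) ≤ n := Nat.cast_le.2 hm
      have h4 : η (m + 1) * m ≤ η (m + 1) * n := mul_le_mul_of_nonneg_left h3 h2.le
      push_cast
      linarith) hp
  rw [hdim] at hle
  exact absurd (Nat.cast_le.1 hle) (by omega)

section Transfer

/-- Strainers persist under small perturbations of all distances. -/
theorem Strainer.perturb {X Y : Type} [MetricSpace X] [MetricSpace Y] {k : ℕ} {η η' σ t : ℝ} {p : X}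
    {c : Fin k → Bool → X} (hc : Strainer η σ p c) {p' : Y} {c' : Fin k → Bool → Y} (hσ : 0 < σ)
    (hη1 : η ≤ 1) (hη0 : 0 ≤ η)
    (ht : 8 * t ≤ (η' ^ 2 - η ^ 2) * σ) (h1 : ∀ i b, |dist p' (c' i b) - dist p (c i b)| ≤ t)
    (h2 : ∀ i b j b', |dist (c' i b) (c' j b') - dist (c i b) (c j b')| ≤ t) :
    Strainer η' σ p' c' := by
  have hsq : η ^ 2 ≤ 1 := pow_le_one₀ hη0 hη1
  have hrad : ∀ i b, dist p (c i b) ≤ 2 * σ := fun i b => by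
    have := (abs_le.1 (hc.rad i b)).2
    have : η ^ 2 * σ ≤ 1 * σ := by gcongr
    linarith
  have hlow : ∀ i b j b', dist (c i b) (c j b') ^ 2 - (η' ^ 2 - η ^ 2) * σ ^ 2 ≤
      dist (c' i b) (c' j b') ^ 2 := by
    intro i b j b'
    have ht0 : 0 ≤ t := (abs_nonneg _).trans (h1 i b)
    have hd : dist (c i b) (c j b') ≤ 4 * σ := by
      linarith [dist_triangle_left (c i b) (c j b') p, hrad i b, hrad j b']
    have h3 := (abs_le.1 (h2 i b j b')).1
    have h4 : 2 * t * dist (c i b) (c j b') ≤ 2 * t * (4 * σ) := by gcongr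
    have h5 : 8 * t * σ ≤ (η' ^ 2 - η ^ 2) * σ * σ := by gcongr
    rcases le_total (dist (c i b) (c j b')) t with h | h
    · have : dist (c i b) (c j b') * dist (c i b) (c j b') ≤ t * dist (c i b) (c j b') := by gcongr
      have : 0 ≤ t * dist (c i b) (c j b') := by positivity
      linarith [sq_nonneg (dist (c' i b) (c' j b'))]
    · have := pow_le_pow_left₀ (sub_nonneg.2 h) (by linarith : dist (c i b) (c j b') - t ≤
        dist (c' i b) (c' j b')) 2
      linarith [sq_nonneg t]
  refine ⟨fun i b => ?_, fun i b => ?_, fun i j hij b b' => ?_⟩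
  · have h3 := hc.rad i b
    have h4 := h1 i b
    have ht0 : 0 ≤ t := (abs_nonneg _).trans h4
    rw [abs_le] at *
    constructor <;> linarith
  · linarith [hlow i b i (!b), hc.opp i b]
  · linarith [hlow i b j b', hc.cross i j hij b b']

end Transfer

/-- Coordinates given by a strainer of maximal rank almost expand distances on `E`. -/
theorem Chart.sum_sq_lower_of_dimH {X : Type} [MetricSpace X] [CompactSpace X] {k n : ℕ}
    {e R σ C r₀ ε₀ L lam : ℝ} {η : ℕ → ℝ} {p : X} {c : Fin k → Bool → X} {E : Set X}
    (h : Chart n e R (η k) σ C r₀ ε₀ L lam p c E) (hM : Model X n e R η)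
    (hη1 : ∀ j ≤ n + 1, η j ≤ 1 / (100 * (n + 1))) (hk : k ≤ n) (hr₀ : 4 * r₀ ≤ R) (hσ : σ ≤ r₀)
    (hdim : dimH E = k) {ρ : ℝ} (hρ0 : 0 ≤ ρ) (hρ : 2000000 * ((k + 1) * ρ) ≤ lam * ε₀ ^ 2 * L)
    {x y : X} (hxE : x ∈ E) (hyE : y ∈ E) (hx : dist p x ≤ ρ) (hy : dist p y ≤ ρ) :
    (1 - 2 * lam ^ 2) * dist x y ^ 2 ≤ ∑ i, (strCoord c y i - strCoord c x i) ^ 2 := by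
  have hL := h.L_pos
  have hε := h.ε₀_pos
  have hkρ : 0 ≤ k * ρ := by positivity
  have hsq : ε₀ ^ 2 * L ≤ 1 * L := by
    gcongr
    exact pow_le_one₀ hε.le h.ε₀_le
  have hlam : lam * (ε₀ ^ 2 * L) ≤ ε₀ ^ 2 * L := mul_le_of_le_one_left (by positivity) h.lam_le
  refine h.sum_sq_lower (ρ := ρ) (r := 20 * ρ) (h.injOn (by linarith) fun y => ?_) le_rfl
    (by linarith) hxE hyE hx hy
  by_contra hinf
  obtain ⟨B, -, hB⟩ := exists_cell_bound n η C k hk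
  obtain ⟨S, hS, hcard⟩ := Set.Infinite.exists_subset_card_eq hinf (⌊B⌋₊ + 1)
  have hS' : ∀ u ∈ S, u ∈ E ∧ dist p u ≤ 20 * (20 * ρ) ∧ strCoord c u = y := fun u hu => hS hu
  have := hB X e R r₀ hM h.pack hr₀ p σ c h.small.σ0 hσ h.str S
    (fun u hu => by linarith [(hS' u hu).2.1, h.L_le])
    (fun u hu v hv i => by
      rw [(hS' u hu).2.2, (hS' v hv).2.2, sub_self, abs_zero]
      exact mul_nonneg h.small.η0.le dist_nonneg)
    (fun u hu v hv huv c' => hM.not_strainer_of_dimH hη1 hk h.ext hdim (hS' u hu).1 (dist_pos.2 huv)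
      (by linarith [dist_triangle_left u v p, (hS' u hu).2.1, (hS' v hv).2.1, h.L_le_R]) c')
  rw [hcard] at this
  push_cast at this
  linarith [Nat.lt_floor_add_one B]

/-- Points of one extremal set are carried to points with equal coordinates of another one. -/
theorem Strainer.exists_transfer {X Y : Type} [MetricSpace X] [MetricSpace Y] [CompactSpace Y] {k : ℕ}
    {e R η σ lam ρ δ : ℝ} {p : X} {c : Fin k → Bool → X} {E : Set X} {p' : Y} {c' : Fin k → Bool → Y}
    {F : Set Y} (hlow : ∀ x ∈ E, ∀ y ∈ E, dist p x ≤ ρ → dist p y ≤ ρ →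
      (1 - 2 * lam ^ 2) * dist x y ^ 2 ≤ ∑ i, (strCoord c y i - strCoord c x i) ^ 2)
    (H : LAlex Y e R) (hP : SmallParam e R η σ) (hc : Strainer η σ p' c') (hF : AlmostExt e R F)
    (hk : 100 * η * k ≤ 1) (hδ : 0 ≤ δ) (hρ : (1 + 2 * k) * (2 * ρ + 8 * (k * δ)) ≤ η ^ 2 * σ)
    (hρ0 : 0 ≤ ρ) (φ : X → Y)
    (hφ : ∀ z ∈ E, dist p z ≤ ρ → φ z ∈ F ∧ dist p' (φ z) ≤ 2 * ρ ∧
      ∀ j, |strCoord c' (φ z) j - strCoord c z j| ≤ δ) :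
    ∃ h : X → Y, ∀ z ∈ E, dist p z ≤ ρ → h z ∈ F ∧ dist (φ z) (h z) ≤ 4 * (k * δ) ∧
      ∀ z' ∈ E, dist p z' ≤ ρ →
        (1 - 2 * lam ^ 2) * dist z z' ^ 2 ≤ (1 + 175 * η * k * (k + 1)) * dist (h z) (h z') ^ 2 := by
  have hkδ : 0 ≤ k * δ := by positivity
  have hkk : 0 ≤ (2 * k : ℝ) * (2 * ρ + 8 * (k * δ)) := by positivity
  have hex : ∀ z, ∃ w, z ∈ E → dist p z ≤ ρ → w ∈ F ∧ dist (φ z) w ≤ 4 * (k * δ) ∧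
      dist p' w ≤ 2 * ρ + 4 * (k * δ) ∧ strCoord c' w = strCoord c z := by
    intro z
    by_cases hz : z ∈ E ∧ dist p z ≤ ρ
    · obtain ⟨h1, h2, h3⟩ := hφ z hz.1 hz.2
      have hsum : ∑ i, |strCoord c z i - strCoord c' (φ z) i| ≤ k * δ := by
        refine (Finset.sum_le_card_nsmul _ _ δ fun i _ => ?_).trans (by simp)
        rw [abs_sub_comm]
        exact h3 i
      obtain ⟨w, hwF, hw, hwd⟩ := hc.exists_coord_eq H hP hF hk h1
        (v := fun i => strCoord c z i - strCoord c' (φ z) i) (by linarith)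
      refine ⟨w, fun _ _ => ⟨hwF, by linarith, by linarith [dist_triangle p' (φ z) w], ?_⟩⟩
      funext j
      rw [hw]
      ring
    · exact ⟨p', fun h1 h2 => absurd ⟨h1, h2⟩ hz⟩
  choose h hh using hex
  refine ⟨h, fun z hz hpz => ⟨(hh z hz hpz).1, (hh z hz hpz).2.1, fun z' hz' hpz' => ?_⟩⟩
  obtain ⟨-, -, h3, h4⟩ := hh z hz hpz
  obtain ⟨-, -, h3', h4'⟩ := hh z' hz' hpz'
  have h5 := hlow z' hz' z hz hpz' hpz
  rw [dist_comm, ← h4, ← h4'] at h5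
  refine h5.trans (hc.sum_sq_le H hP (by linarith) ?_)
  have h6 : k * dist (h z) (h z') ≤ k * (2 * (2 * ρ + 4 * (k * δ))) := by
    gcongr
    linarith [dist_triangle_left (h z) (h z') p']
  have h7 : (k : ℝ) * (2 * (2 * ρ + 4 * (k * δ))) ≤ k * (2 * (2 * ρ + 8 * (k * δ))) := by
    gcongr
    norm_num
  linarith

/-- An `ε`-approximation carrying `E` close to `F`. -/
structure Approx {X Y : Type} [MetricSpace X] [MetricSpace Y] (ε : ℝ) (g : X → Y) (E : Set X)
    (F : Set Y) : Prop where
  isom : ∀ a b, |dist (g a) (g b) - dist a b| ≤ ε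
  surj : ∀ y, ∃ a, dist (g a) y ≤ ε
  fwd : ∀ z ∈ E, ∃ y ∈ F, dist (g z) y ≤ ε
  bwd : ∀ y ∈ F, ∃ z ∈ E, dist (g z) y ≤ ε

/-- Strained and rich points persist in approximating spaces. -/
theorem Approx.exists_strainer_rich {X Y : Type} [MetricSpace X] [MetricSpace Y] {n k : ℕ}
    {ε η η' σ C ε₀ L : ℝ} {g : X → Y} {E : Set X} {F : Set Y} (hg : Approx ε g E F) {p : Y}
    {c : Fin k → Bool → Y} (hc : Strainer η' σ p c) (hσ : 0 < σ) (hη0 : 0 ≤ η') (hη1 : η' ≤ 1)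
    {S : Finset Y} (hS : ∀ w ∈ S, dist p w ≤ L / 4) (hsep : FarApart (2 * ε₀ * L) S)
    (hcard : C * (16 / ε₀) ^ n < (S.card - 1) / (8 * ε₀)) (hε₀ : 0 < ε₀) (hε₀1 : ε₀ ≤ 1) (hL : 0 < L)
    (h1 : 24 * ε ≤ (η ^ 2 - η' ^ 2) * σ) (h2 : 12 * ε ≤ ε₀ * L) :
    ∃ (p' : X) (c' : Fin k → Bool → X), dist (g p') p ≤ ε ∧ (∀ i b, dist (g (c' i b)) (c i b) ≤ ε) ∧
      Strainer η σ p' c' ∧ Rich X n C ε₀ L p' := by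
  classical
  choose ψ hψ using hg.surj
  have hε : 0 ≤ ε := dist_nonneg.trans (hψ p)
  have hdist : ∀ a b, |dist (ψ a) (ψ b) - dist a b| ≤ 3 * ε := by
    intro a b
    have h3 := abs_le.1 (hg.isom (ψ a) (ψ b))
    have h4 := hψ a
    have h5 := hψ b
    have h6 := dist_triangle4 a (g (ψ a)) (g (ψ b)) b
    have h7 := dist_triangle4 (g (ψ a)) a b (g (ψ b))
    rw [dist_comm a (g (ψ a))] at h6
    rw [dist_comm b (g (ψ b))] at h7
    rw [abs_le]
    constructor <;> linarith
  have hεL : ε₀ * L ≤ 1 * L := by gcongr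
  have hε₀L : 0 < ε₀ * L := by positivity
  have hinj : InjOn ψ S := by
    intro a ha b hb hab
    by_contra hne
    have h3 := hsep a ha b hb hne
    have h4 := (abs_le.1 (hdist a b)).1
    rw [hab, dist_self] at h4
    linarith
  refine ⟨ψ p, fun i b => ψ (c i b), hψ p, fun i b => hψ _, ?_, S.image ψ, ?_, ?_, ?_⟩
  · exact hc.perturb hσ hη1 hη0 (t := 3 * ε) (by linarith) (fun i b => hdist _ _)
      fun i b j b' => hdist _ _
  · intro w hw
    obtain ⟨a, ha, rfl⟩ := Finset.mem_image.1 hw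
    linarith [(abs_le.1 (hdist p a)).2, hS a ha]
  · intro u hu v hv huv
    obtain ⟨a, ha, rfl⟩ := Finset.mem_image.1 hu
    obtain ⟨b, hb, rfl⟩ := Finset.mem_image.1 hv
    linarith [(abs_le.1 (hdist a b)).1, hsep a ha b hb (fun h => huv (by rw [h]))]
  · rwa [Finset.card_image_of_injOn hinj]

/-- Near a strained point of the limit set, approximating extremal sets admit almost expanding maps
to the limit set, and conversely. -/
theorem exists_local_transfer {Y : Type} [MetricSpace Y] [CompactSpace Y] {n k : ℕ}
    {e R C r₀ lam ε₁ L₁ η' σ : ℝ} {η : ℕ → ℝ} {F : Set Y} {p : Y} {c : Fin k → Bool → Y}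
    (hY : Model Y n e R η) (hη1 : ∀ j ≤ n + 1, η j ≤ 1 / (100 * (n + 1))) (hk : k ≤ n)
    (hr₀ : 4 * r₀ ≤ R) (hpack : Packing Y n C r₀) (hF : AlmostExt e R F) (hFdim : dimH F = k)
    (hlam : 0 < lam) (hlam1 : lam ≤ 1) (hε₁ : 0 < ε₁)
    (hηε : 1000000 * (k + 1) ^ 2 * η k ≤ lam ^ 2 * ε₁) (hL₁ : 0 < L₁)
    (hrich : ∀ L, 0 < L → L ≤ L₁ → ∃ ε₀, ε₁ ≤ ε₀ ∧ ε₀ ≤ 1 ∧ ∃ S : Finset Y,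
      (∀ w ∈ S, dist p w ≤ L / 4) ∧ FarApart (2 * ε₀ * L) S ∧
      C * (16 / ε₀) ^ n < (S.card - 1) / (8 * ε₀))
    (hc : Strainer η' σ p c) (hη' : 0 < η') (hη'1 : η' < η k) (hσ : 0 < σ) (hσr : σ ≤ r₀) :
    ∃ ρ > 0, ∀ δ > 0, ∃ ε₂ > 0, ∀ (X : Type) [MetricSpace X] [CompactSpace X] (E : Set X) (g : X → Y),
      Model X n e R η → Packing X n C r₀ → AlmostExt e R E → dimH E = k → Approx ε₂ g E F →
      (∃ h : X → Y, ∀ z ∈ E, dist p (g z) ≤ ρ → h z ∈ F ∧ dist (g z) (h z) ≤ δ ∧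
        ∀ z' ∈ E, dist p (g z') ≤ ρ →
          (1 - 2 * lam ^ 2) * dist z z' ^ 2 ≤
            (1 + 175 * η k * k * (k + 1)) * dist (h z) (h z') ^ 2) ∧
      (∃ h : Y → X, ∀ y ∈ F, dist p y ≤ ρ → h y ∈ E ∧ dist (g (h y)) y ≤ δ ∧
        ∀ y' ∈ F, dist p y' ≤ ρ →
          (1 - 2 * lam ^ 2) * dist y y' ^ 2 ≤
            (1 + 175 * η k * k * (k + 1)) * dist (h y) (h y') ^ 2) := by
  have hηk := hY.lad.pos k (by omega)
  have hηk1 := hY.lad.le k (by omega)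
  have hr₀0 : 0 < r₀ := hσ.trans_le hσr
  have hσR : 4 * σ ≤ R := by linarith
  have hησ : 0 < η k ^ 2 * σ / 4 := by positivity
  obtain ⟨L, hL⟩ : ∃ L, L = min L₁ (min r₀ (η k ^ 2 * σ / 4)) := ⟨_, rfl⟩
  have hL0 : 0 < L := hL ▸ lt_min hL₁ (lt_min hr₀0 hησ)
  have hLr : L ≤ r₀ := by rw [hL]; exact (min_le_right _ _).trans (min_le_left _ _)
  have hLη : L ≤ η k ^ 2 * σ / 4 := by rw [hL]; exact (min_le_right _ _).trans (min_le_right _ _)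
  obtain ⟨ε₀, hε₀, hε₀1, S, hS, hsep, hcard⟩ := hrich L hL0 (by rw [hL]; exact min_le_left _ _)
  have hε₀0 : 0 < ε₀ := hε₁.trans_le hε₀
  have hηε' : 1000000 * (k + 1) ^ 2 * η k ≤ lam ^ 2 * ε₀ := hηε.trans (by gcongr)
  obtain ⟨ρ, hρ⟩ : ∃ ρ, ρ = lam * ε₀ ^ 2 * L / (2000000 * (k + 1)) := ⟨_, rfl⟩
  have hρ0 : 0 < ρ := by rw [hρ]; positivity
  have hρ' : 2000000 * ((k + 1) * ρ) = lam * ε₀ ^ 2 * L := by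
    rw [hρ]
    field_simp
  have hρL : 2000000 * ((k + 1) * ρ) ≤ L := by
    rw [hρ']
    exact mul_le_of_le_one_left hL0.le (mul_le_one₀ hlam1 (by positivity)
      (pow_le_one₀ hε₀0.le hε₀1))
  have hkρ : 0 ≤ k * ρ := by positivity
  have hsq : 0 < η k ^ 2 - η' ^ 2 := sub_pos.2 (pow_lt_pow_left₀ hη'1 hη'.le two_ne_zero)
  have hcY : Strainer (η k) σ p c := hc.perturb hσ (by linarith) hη'.le (t := 0)
    (by rw [mul_zero]; positivity) (by simp) (by simp)
  have hchY : Chart n e R (η k) σ C r₀ ε₀ L lam p c F :=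
    { alex := hY.lalex
      small := hY.small (by omega) hσ hσR
      str := hcY
      ext := hF
      pack := hpack
      rich := ⟨S, fun w hw => by linarith [hS w hw], hsep.anti (by
        have : 0 < ε₀ * L := by positivity
        linarith), hcard⟩
      ε₀_pos := hε₀0
      ε₀_le := hε₀1
      lam_pos := hlam
      lam_le := hlam1
      η_le := hηε'
      L_pos := hL0
      L_le := by linarith
      L_r₀ := hLr }
  refine ⟨ρ / 2, by positivity, fun δ hδ => ?_⟩
  obtain ⟨ε, hεd⟩ : ∃ ε, ε = min (min ((η k ^ 2 - η' ^ 2) * σ / 24) (ε₀ * L / 12))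
    (min (ρ / (12 * k + 4)) (δ / (12 * k + 2))) := ⟨_, rfl⟩
  have hε0 : 0 < ε := by
    rw [hεd]
    refine lt_min (lt_min ?_ ?_) (lt_min ?_ ?_) <;> positivity
  have hε1 : 24 * ε ≤ (η k ^ 2 - η' ^ 2) * σ := by
    have : ε ≤ (η k ^ 2 - η' ^ 2) * σ / 24 := by
      rw [hεd]; exact (min_le_left _ _).trans (min_le_left _ _)
    linarith
  have hε2 : 12 * ε ≤ ε₀ * L := by
    have : ε ≤ ε₀ * L / 12 := by
      rw [hεd]; exact (min_le_left _ _).trans (min_le_right _ _)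
    linarith
  have hε3 : ε * (12 * k + 4) ≤ ρ := by
    rw [← le_div_iff₀ (by positivity), hεd]
    exact (min_le_right _ _).trans (min_le_left _ _)
  have hε4 : ε * (12 * k + 2) ≤ δ := by
    rw [← le_div_iff₀ (by positivity), hεd]
    exact (min_le_right _ _).trans (min_le_right _ _)
  have hkε : 0 ≤ ε * k := by positivity
  refine ⟨ε, hε0, fun X _ _ E g hX hpX hE hEdim hg => ?_⟩
  obtain ⟨p', c', hp', hc', hcX, hrichX⟩ := hg.exists_strainer_rich hc hσ hη'.le (by linarith) hS hsep
    hcard hε₀0 hε₀1 hL0 hε1 hε2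
  have hchX : Chart n e R (η k) σ C r₀ ε₀ L lam p' c' E :=
    { alex := hX.lalex
      small := hX.small (by omega) hσ hσR
      str := hcX
      ext := hE
      pack := hpX
      rich := hrichX
      ε₀_pos := hε₀0
      ε₀_le := hε₀1
      lam_pos := hlam
      lam_le := hlam1
      η_le := hηε'
      L_pos := hL0
      L_le := by linarith
      L_r₀ := hLr }
  have hlarge : (1 + 2 * k) * (2 * ρ + 8 * (k * (3 * ε))) ≤ η k ^ 2 * σ := by
    calc (1 + 2 * k) * (2 * ρ + 8 * (k * (3 * ε))) ≤ (1 + 2 * k) * (4 * ρ) := by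
          gcongr
          linarith
      _ ≤ _ := by linarith
  have hgc : ∀ (z : X) (y : Y), dist (g z) y ≤ ε → ∀ j,
      |strCoord c y j - strCoord c' z j| ≤ 3 * ε := by
    intro z y hzy j
    have h1 := abs_le.1 (hg.isom z (c' j true))
    have h2 := hc' j true
    have h3 := dist_triangle4 y (g z) (g (c' j true)) (c j true)
    have h4 := dist_triangle4 (g z) y (c j true) (g (c' j true))
    rw [dist_comm y (g z)] at h3
    rw [dist_comm (c j true) (g (c' j true))] at h4
    simp only [strCoord]
    rw [abs_le]
    constructor <;> linarith
  have hgp : ∀ z, |dist p' z - dist p (g z)| ≤ 2 * ε := by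
    intro z
    have h1 := abs_le.1 (hg.isom p' z)
    have h2 := dist_triangle_left p (g z) (g p')
    have h3 := dist_triangle (g p') p (g z)
    rw [abs_le]
    constructor <;> linarith
  constructor
  · have : Nonempty Y := ⟨p⟩
    choose! φ hφF hφ using hg.fwd
    obtain ⟨h, hh⟩ := Strainer.exists_transfer (ρ := ρ) (δ := 3 * ε) (p := p') (c := c')
      (fun x hx y hy hpx hpy => hchX.sum_sq_lower_of_dimH hX hη1 hk hr₀ hσr hEdim hρ0.le hρ'.le hx hy
        hpx hpy) hY.lalex hchY.small hcY hF hchY.k_le (by positivity) hlarge hρ0.le φ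
      (fun z hz hpz => ⟨hφF z hz, by
        linarith [dist_triangle p (g z) (φ z), hφ z hz, (abs_le.1 (hgp z)).1],
        hgc z (φ z) (hφ z hz)⟩)
    have hin : ∀ z, dist p (g z) ≤ ρ / 2 → dist p' z ≤ ρ := fun z hz => by
      linarith [(abs_le.1 (hgp z)).2]
    refine ⟨h, fun z hz hpz => ?_⟩
    obtain ⟨h1, h2, h3⟩ := hh z hz (hin z hpz)
    exact ⟨h1, by linarith [dist_triangle (g z) (φ z) (h z), hφ z hz], fun z' hz' hpz' =>
      h3 z' hz' (hin z' hpz')⟩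
  · have : Nonempty X := ⟨p'⟩
    choose! φ hφF hφ using hg.bwd
    obtain ⟨h, hh⟩ := Strainer.exists_transfer (ρ := ρ) (δ := 3 * ε) (p := p) (c := c)
      (fun x hx y hy hpx hpy => hchY.sum_sq_lower_of_dimH hY hη1 hk hr₀ hσr hFdim hρ0.le hρ'.le hx hy
        hpx hpy) hX.lalex hchX.small hcX hE hchX.k_le (by positivity) hlarge hρ0.le φ
      (fun y hy hpy => ⟨hφF y hy, by
        linarith [dist_triangle_right p (g (φ y)) y, hφ y hy, (abs_le.1 (hgp (φ y))).2], fun j => by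
        rw [abs_sub_comm]
        exact hgc (φ y) y (hφ y hy) j⟩)
    refine ⟨h, fun y hy hpy => ?_⟩
    obtain ⟨h1, h2, h3⟩ := hh y hy (by linarith)
    refine ⟨h1, ?_, fun y' hy' hpy' => h3 y' hy' (by linarith)⟩
    have h4 := (abs_le.1 (hg.isom (h y) (φ y))).2
    rw [dist_comm (h y)] at h4
    linarith [dist_triangle (g (h y)) (g (φ y)) y, hφ y hy]

section BallCovers

open MeasureTheory Measure Filter

section HMeas

variable {X : Type} [MetricSpace X]

theorem hMeas_zero (S : Set X) : hMeas (fun a b : X => edist a b) ((0 : ℕ) : ℝ) S = ⊤ := by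
  rw [eq_top_iff]
  unfold hMeas
  refine le_iSup₂_of_le 1 one_pos ?_
  refine le_iInf fun t => le_iInf fun _ => le_iInf fun _ => ?_
  simp

theorem hMeas_eq_hausdorffMeasure [MeasurableSpace X] [BorelSpace X] {m : ℕ} (hm : 1 ≤ m)
    (S : Set X) : hMeas (fun a b : X => edist a b) (m : ℝ) S = μH[(m : ℝ)] S := by
  rw [hausdorffMeasure_apply]
  unfold hMeas
  have h1 : ∀ s : Set X, ediamOn (fun a b : X => edist a b) s = ediam s := fun s => rfl
  have h2 : ∀ s : Set X, (⨆ _ : s.Nonempty, ediam s ^ (m : ℝ)) = ediam s ^ (m : ℝ) := by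
    intro s
    rcases s.eq_empty_or_nonempty with rfl | hs
    · simp [show m ≠ 0 by omega]
    · simp [hs]
  simp only [h1, h2]

end HMeas

/-- A map that is almost expanding on a set does not decrease Hausdorff measure much. -/
theorem hausdorffMeasure_le_of_expanding {X Y : Type} [MetricSpace X] [MetricSpace Y]
    [MeasurableSpace X] [BorelSpace X] [MeasurableSpace Y] [BorelSpace Y] {K : ℝ≥0} {h : X → Y}
    {A : Set X} (hA : ∀ a ∈ A, ∀ b ∈ A, dist a b ≤ K * dist (h a) (h b)) (m : ℕ) :
    μH[(m : ℝ)] A ≤ (K : ℝ≥0∞) ^ m * μH[(m : ℝ)] (h '' A) := by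
  have hf : AntilipschitzWith K (fun a : A => h a) :=
    AntilipschitzWith.of_le_mul_dist fun a b => hA a a.2 b b.2
  have h1 := hf.le_hausdorffMeasure_image (d := m) (Nat.cast_nonneg m) univ
  have h2 := (isometry_subtype_coe (s := A)).hausdorffMeasure_image (d := m)
    (Or.inl (Nat.cast_nonneg m)) univ
  rw [image_univ, Subtype.range_coe] at h2
  have h3 : (fun a : A => h a) '' univ = h '' A := by ext; simp
  rw [h2, ← ENNReal.rpow_natCast, ← h3]
  exact h1

/-- A set of small Hausdorff measure has an economical cover by small balls. -/
theorem exists_ball_cover {Y : Type} [MetricSpace Y] [Nonempty Y] [MeasurableSpace Y]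
    [BorelSpace Y] {F : Set Y} (hF : IsCompact F) {m : ℕ} (hm : 1 ≤ m) {a : ℝ≥0∞} (ha : μH[(m : ℝ)] F < a)
    {r₁ : ℝ} (hr₁ : 0 < r₁) :
    ∃ (T : Finset ℕ) (y : ℕ → Y) (r : ℕ → ℝ), (∀ j, 0 < r j ∧ r j ≤ r₁) ∧
      F ⊆ ⋃ j ∈ T, ball (y j) (r j) ∧
      ∑ j ∈ T, ENNReal.ofReal (r j) ^ m ≤ 2 ^ m * (2 * a) := by
  obtain ⟨y₀⟩ := ‹Nonempty Y›
  obtain ⟨b, hb⟩ : ∃ b, b = min (r₁ / 2) 1 := ⟨_, rfl⟩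
  have hb0 : 0 < b := hb ▸ lt_min (by positivity) one_pos
  have hbr : b ≤ r₁ / 2 := hb ▸ min_le_left _ _
  have hb1 : b ≤ 1 := hb ▸ min_le_right _ _
  rw [hausdorffMeasure_apply] at ha
  have h1 := (le_iSup₂ (f := fun (r : ℝ≥0∞) (_ : 0 < r) => ⨅ t : ℕ → Set Y, ⨅ (_ : F ⊆ ⋃ n, t n),
    ⨅ (_ : ∀ n, ediam (t n) ≤ r), ∑' n, ⨆ (_ : (t n).Nonempty), ediam (t n) ^ (m : ℝ))
      (ENNReal.ofReal b) (ENNReal.ofReal_pos.2 hb0)).trans_lt ha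
  simp only [iInf_lt_iff] at h1
  obtain ⟨t, ht, htd, hsum⟩ := h1
  have hsum' : ∑' n, ediam (t n) ^ m ≤ a := by
    refine le_trans (ENNReal.tsum_le_tsum fun n => ?_) hsum.le
    rcases (t n).eq_empty_or_nonempty with h | h
    · simp [h, show m ≠ 0 by omega]
    · simp [h]
  have ha0 : a ≠ 0 := (bot_le.trans_lt ha).ne'
  obtain ⟨s, hs0, hs⟩ := ENNReal.exists_pos_sum_of_countable ha0 ℕ
  let q : ℕ → ℝ := fun j => min (s j) b
  have hq0 : ∀ j, 0 < q j := fun j => lt_min (by exact_mod_cast hs0 j) hb0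
  have hfin : ∀ j, ediam (t j) ≠ ⊤ := fun j => ((htd j).trans_lt ENNReal.ofReal_lt_top).ne
  have hdb : ∀ j, diam (t j) ≤ b := fun j => ENNReal.toReal_le_of_le_ofReal hb0.le (htd j)
  have hy : ∀ j, ∃ y, (t j).Nonempty → y ∈ t j := fun j => by
    rcases (t j).eq_empty_or_nonempty with h | ⟨y, hy⟩
    · exact ⟨y₀, fun h' => absurd h h'.ne_empty⟩
    · exact ⟨y, fun _ => hy⟩
  choose y hy using hy
  let r : ℕ → ℝ := fun j => 2 * max (diam (t j)) (q j)
  have hr0 : ∀ j, 0 < r j := fun j => by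
    have := (hq0 j).trans_le (le_max_right (diam (t j)) (q j))
    simp only [r]
    linarith
  have hcover : F ⊆ ⋃ j, ball (y j) (r j) := by
    intro x hx
    obtain ⟨j, hj⟩ := mem_iUnion.1 (ht hx)
    refine mem_iUnion.2 ⟨j, mem_ball.2 ?_⟩
    have h2 := dist_le_diam_of_mem' (hfin j) hj (hy j ⟨x, hj⟩)
    have h3 := le_max_left (diam (t j)) (q j)
    have h4 := hr0 j
    simp only [r] at h4 ⊢
    linarith
  obtain ⟨T, hT⟩ := hF.elim_finite_subcover _ (fun j => isOpen_ball) hcover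
  refine ⟨T, y, r, fun j => ⟨hr0 j, ?_⟩, hT, ?_⟩
  · have := max_le (hdb j) (min_le_right (s j : ℝ) b)
    simp only [r, q]
    linarith
  have hterm : ∀ j, ENNReal.ofReal (r j) ^ m ≤ 2 ^ m * (ediam (t j) ^ m + s j) := by
    intro j
    have h3 : ENNReal.ofReal (r j) = 2 * max (ediam (t j)) (ENNReal.ofReal (q j)) := by
      simp only [r]
      rw [ENNReal.ofReal_mul zero_le_two, ENNReal.ofReal_max, diam, ENNReal.ofReal_toReal (hfin j)]
      simp
    rw [h3, mul_pow]
    gcongr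
    have h4 : ENNReal.ofReal (q j) ^ m ≤ s j := by
      have h5 : ENNReal.ofReal (q j) ≤ 1 := ENNReal.ofReal_le_one.2 ((min_le_right _ _).trans hb1)
      calc ENNReal.ofReal (q j) ^ m ≤ ENNReal.ofReal (q j) ^ 1 := pow_le_pow_right_of_le_one' h5 hm
        _ ≤ s j := by
          rw [pow_one]
          refine ENNReal.ofReal_le_of_le_toReal ?_
          exact min_le_left _ _
    rcases le_total (ediam (t j)) (ENNReal.ofReal (q j)) with h | h
    · rw [max_eq_right h]
      exact h4.trans le_add_self
    · rw [max_eq_left h]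
      exact le_self_add
  calc ∑ j ∈ T, ENNReal.ofReal (r j) ^ m ≤ ∑ j ∈ T, 2 ^ m * (ediam (t j) ^ m + s j) :=
        Finset.sum_le_sum fun j _ => hterm j
    _ ≤ ∑' j, 2 ^ m * (ediam (t j) ^ m + (s j : ℝ≥0∞)) := ENNReal.sum_le_tsum _
    _ = 2 ^ m * (∑' j, ediam (t j) ^ m + ∑' j, (s j : ℝ≥0∞)) := by
        rw [ENNReal.tsum_mul_left, ENNReal.tsum_add]
    _ ≤ 2 ^ m * (2 * a) := by
        rw [two_mul]
        gcongr

open TopologicalSpace in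
/-- A finite measure on a covered set is almost carried by finitely many disjoint compact sets
subordinate to the cover. -/
theorem exists_disjoint_compacts {Y : Type} [MetricSpace Y] [CompactSpace Y] [MeasurableSpace Y]
    [BorelSpace Y] (μ : Measure Y) {F : Set Y} (hF : IsClosed F) (hμ : μ F ≠ ⊤) {U : ℕ → Set Y}
    (hU : ∀ j, IsOpen (U j)) (hFU : μ (F \ ⋃ j, U j) = 0) {a : ℝ≥0∞} (ha : a ≠ 0) :
    ∃ (N : ℕ) (K : ℕ → Set Y), (∀ j, IsCompact (K j) ∧ K j ⊆ F ∧ K j ⊆ U j) ∧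
      Pairwise (fun i j => Disjoint (K i) (K j)) ∧ μ (F \ ⋃ j ∈ Finset.range N, K j) < a := by
  have : IsFiniteMeasure (μ.restrict F) := ⟨by simpa using hμ.lt_top⟩
  obtain ⟨b, hb0, hb⟩ := ENNReal.exists_pos_sum_of_countable' ha ℕ
  have hD : ∀ j, MeasurableSet (F ∩ disjointed U j) := fun j =>
    hF.measurableSet.inter (MeasurableSet.disjointed (fun i => (hU i).measurableSet) j)
  have hex : ∀ j, ∃ K ⊆ F ∩ disjointed U j, IsCompact K ∧
      μ.restrict F ((F ∩ disjointed U j) \ K) < b j := fun j =>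
    (hD j).exists_isCompact_sdiff_lt (measure_ne_top _ _) (hb0 j).ne'
  choose K hK hKc hKμ using hex
  have hF' : ∀ s ⊆ F, MeasurableSet s → μ.restrict F s = μ s := fun s hs hsm => by
    rw [restrict_apply hsm, inter_eq_left.2 hs]
  have hres : μ (F \ ⋃ j, K j) < a := by
    calc μ (F \ ⋃ j, K j) ≤ μ ((F \ ⋃ j, U j) ∪ ⋃ j, ((F ∩ disjointed U j) \ K j)) := by
          refine measure_mono ?_
          intro x hx
          by_cases hxU : x ∈ ⋃ j, U j
          · rw [← iUnion_disjointed] at hxU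
            obtain ⟨j, hj⟩ := mem_iUnion.1 hxU
            exact Or.inr (mem_iUnion.2 ⟨j, ⟨hx.1, hj⟩, fun h => hx.2 (mem_iUnion.2 ⟨j, h⟩)⟩)
          · exact Or.inl ⟨hx.1, hxU⟩
      _ ≤ μ (F \ ⋃ j, U j) + ∑' j, μ ((F ∩ disjointed U j) \ K j) :=
          (measure_union_le _ _).trans (by gcongr; exact measure_iUnion_le _)
      _ ≤ ∑' j, b j := by
          rw [hFU, zero_add]
          refine ENNReal.tsum_le_tsum fun j => ?_
          rw [← hF' _ (sdiff_subset.trans inter_subset_left) ((hD j).diff (hKc j).measurableSet)]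
          exact (hKμ j).le
      _ < a := hb
  have hlim : Tendsto (fun N => μ (F \ ⋃ j ∈ Finset.range N, K j)) atTop
      (nhds (μ (⋂ N, F \ ⋃ j ∈ Finset.range N, K j))) := by
    refine tendsto_measure_iInter_atTop (fun N => ?_) ?_ ⟨0, by simpa using hμ⟩
    · exact (hF.measurableSet.diff (Finset.measurableSet_biUnion _
        fun j _ => (hKc j).measurableSet)).nullMeasurableSet
    · intro N M hNM
      refine sdiff_subset_sdiff_right (biUnion_subset_biUnion_left fun j hj => ?_)
      simp only [Finset.coe_range, mem_Iio] at hj ⊢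
      exact lt_of_lt_of_le hj hNM
  have heq : ⋂ N, F \ ⋃ j ∈ Finset.range N, K j = F \ ⋃ j, K j := by
    ext x
    simp only [mem_iInter, Set.mem_sdiff, mem_iUnion, Finset.mem_range, not_exists]
    constructor
    · exact fun h => ⟨(h 0).1, fun j hj => (h (j + 1)).2 j (by omega) hj⟩
    · exact fun h N => ⟨h.1, fun j _ hj => h.2 j hj⟩
  rw [heq] at hlim
  obtain ⟨N, hN⟩ := (hlim.eventually (gt_mem_nhds hres)).exists
  refine ⟨N, K, fun j => ⟨hKc j, fun x hx => (hK j hx).1,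
    fun x hx => disjointed_subset U j (hK j hx).2⟩, fun i j hij => ?_, hN⟩
  exact (disjoint_disjointed U hij).mono (fun x hx => (hK i hx).2) (fun x hx => (hK j hx).2)

end BallCovers

section PieceEstimates

open MeasureTheory Measure Filter

/-- Over `U` there are almost expanding maps, close to `g`, between `E` and `F` in both
directions. -/
structure Transfer {X Y : Type} [MetricSpace X] [MetricSpace Y] (K : ℝ≥0) (δ : ℝ) (g : X → Y)
    (E : Set X) (F U : Set Y) : Prop where
  fwd : ∃ h : X → Y, ∀ z ∈ E, g z ∈ U → h z ∈ F ∧ dist (g z) (h z) ≤ δ ∧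
    ∀ z' ∈ E, g z' ∈ U → dist z z' ≤ K * dist (h z) (h z')
  bwd : ∃ h : Y → X, ∀ y ∈ F, y ∈ U → h y ∈ E ∧ dist (g (h y)) y ≤ δ ∧
    ∀ y' ∈ F, y' ∈ U → dist y y' ≤ K * dist (h y) (h y')

section Estimates

variable {X Y : Type} [MetricSpace X] [MetricSpace Y] [MeasurableSpace X] [BorelSpace X]
  {K : ℝ≥0} {ε δ s : ℝ} {g : X → Y} {E : Set X} {F : Set Y} {T : Finset ℕ} {Q U : ℕ → Set Y}

/-- Points of the approximating set near a thin set have small measure. -/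
theorem measure_near_le {m : ℕ} {A r₁ : ℝ} (hA : 0 ≤ A) (hE : ∀ a : X, ∀ r, 0 < r → r ≤ r₁ →
      μH[(m : ℝ)] (E ∩ closedBall a r) ≤ ENNReal.ofReal (A * r ^ m)) (hg : Approx ε g E F)
    {y : ℕ → Y} {r : ℕ → ℝ} (hr : ∀ j ∈ T, 0 < r j ∧ 4 * r j ≤ r₁ ∧ ε ≤ r j) :
    μH[(m : ℝ)] {z ∈ E | ∃ w ∈ ⋃ j ∈ T, ball (y j) (r j), dist (g z) w ≤ ε} ≤
      ENNReal.ofReal A * 4 ^ m * ∑ j ∈ T, ENNReal.ofReal (r j) ^ m := by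
  choose a ha using hg.surj
  calc μH[(m : ℝ)] {z ∈ E | ∃ w ∈ ⋃ j ∈ T, ball (y j) (r j), dist (g z) w ≤ ε}
      ≤ μH[(m : ℝ)] (⋃ j ∈ T, E ∩ closedBall (a (y j)) (4 * r j)) := by
        refine measure_mono fun z hz => ?_
        obtain ⟨hz1, w, hw, hzw⟩ := hz
        obtain ⟨j, hj, hw⟩ := mem_iUnion₂.1 hw
        refine mem_iUnion₂.2 ⟨j, hj, hz1, mem_closedBall.2 ?_⟩
        have h1 := (abs_le.1 (hg.isom z (a (y j)))).1
        have h2 := dist_triangle4 (g z) w (y j) (g (a (y j)))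
        have h3 := ha (y j)
        rw [dist_comm (y j)] at h2
        rw [mem_ball] at hw
        linarith [(hr j hj).2.2]
    _ ≤ ∑ j ∈ T, μH[(m : ℝ)] (E ∩ closedBall (a (y j)) (4 * r j)) := measure_biUnion_finset_le _ _
    _ ≤ ∑ j ∈ T, ENNReal.ofReal A * 4 ^ m * ENNReal.ofReal (r j) ^ m := by
        refine Finset.sum_le_sum fun j hj => ?_
        obtain ⟨h1, h2, -⟩ := hr j hj
        refine (hE _ _ (by positivity) h2).trans (le_of_eq ?_)
        rw [ENNReal.ofReal_mul hA, mul_pow, ENNReal.ofReal_mul (by positivity),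
          ENNReal.ofReal_pow (by positivity), ENNReal.ofReal_pow h1.le, mul_assoc]
        simp
    _ = _ := by rw [Finset.mul_sum]

variable [MeasurableSpace Y] [BorelSpace Y]

/-- Disjoint pieces of the limit set are seen by the approximating set. -/
theorem Approx.sum_measure_le (hg : Approx ε g E F) (hE : IsClosed E) (m : ℕ)
    (hQF : ∀ j ∈ T, Q j ⊆ F) (hQU : ∀ j ∈ T, Q j ⊆ U j)
    (hsep : ∀ i ∈ T, ∀ j ∈ T, i ≠ j → ∀ x ∈ Q i, ∀ y ∈ Q j, s ≤ dist x y)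
    (hT : ∀ j ∈ T, Transfer K δ g E F (U j)) (hs : 2 * δ + ε < s) :
    ∑ j ∈ T, μH[(m : ℝ)] (Q j) ≤ (K : ℝ≥0∞) ^ m * μH[(m : ℝ)] E := by
  classical
  rcases T.eq_empty_or_nonempty with rfl | hTne
  · simp
  have hex : ∀ j, ∃ A : Set X, j ∈ T → A ⊆ E ∧ (∀ x ∈ A, ∃ y ∈ Q j, dist (g x) y ≤ δ) ∧
      μH[(m : ℝ)] (Q j) ≤ (K : ℝ≥0∞) ^ m * μH[(m : ℝ)] A := by
    intro j
    by_cases hj : j ∈ T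
    · obtain ⟨h, hh⟩ := (hT j hj).bwd
      refine ⟨h '' Q j, fun _ => ⟨?_, ?_, ?_⟩⟩
      · rintro _ ⟨y, hy, rfl⟩
        exact (hh y (hQF j hj hy) (hQU j hj hy)).1
      · rintro _ ⟨y, hy, rfl⟩
        exact ⟨y, hy, (hh y (hQF j hj hy) (hQU j hj hy)).2.1⟩
      · exact hausdorffMeasure_le_of_expanding (fun a ha b hb =>
          (hh a (hQF j hj ha) (hQU j hj ha)).2.2 b (hQF j hj hb) (hQU j hj hb)) m
    · exact ⟨∅, fun h => absurd h hj⟩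
  choose A hA using hex
  have hdist : ∀ i ∈ T, ∀ j ∈ T, i ≠ j → ∀ x ∈ A i, ∀ x' ∈ A j, s - 2 * δ - ε ≤ dist x x' := by
    intro i hi j hj hij x hx x' hx'
    obtain ⟨y, hy, hxy⟩ := (hA i hi).2.1 x hx
    obtain ⟨y', hy', hxy'⟩ := (hA j hj).2.1 x' hx'
    have h1 := hsep i hi j hj hij y hy y' hy'
    have h2 := (abs_le.1 (hg.isom x x')).2
    have h3 := dist_triangle4 y (g x) (g x') y'
    rw [dist_comm y (g x)] at h3
    linarith
  have hdisj : (T : Set ℕ).PairwiseDisjoint fun j => closure (A j) := by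
    intro i hi j hj hij
    refine Set.disjoint_left.2 fun x hxi hxj => ?_
    obtain ⟨a, ha, hxa⟩ := Metric.mem_closure_iff.1 hxi ((s - 2 * δ - ε) / 2) (by linarith)
    obtain ⟨b, hb, hxb⟩ := Metric.mem_closure_iff.1 hxj ((s - 2 * δ - ε) / 2) (by linarith)
    linarith [hdist i hi j hj hij a ha b hb, dist_triangle_left a b x]
  calc ∑ j ∈ T, μH[(m : ℝ)] (Q j) ≤ ∑ j ∈ T, (K : ℝ≥0∞) ^ m * μH[(m : ℝ)] (closure (A j)) :=
        Finset.sum_le_sum fun j hj => (hA j hj).2.2.trans (by gcongr; exact subset_closure)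
    _ = (K : ℝ≥0∞) ^ m * μH[(m : ℝ)] (⋃ j ∈ T, closure (A j)) := by
        rw [← Finset.mul_sum, measure_biUnion_finset hdisj fun j _ => isClosed_closure.measurableSet]
    _ ≤ _ := by
        gcongr
        exact iUnion₂_subset fun j hj => closure_minimal (hA j hj).1 hE

/-- The part of the approximating set over disjoint pieces is bounded by the limit set. -/
theorem measure_over_le (hF : IsClosed F) (m : ℕ) (hδs : δ ≤ s)
    (hsep : ∀ i ∈ T, ∀ j ∈ T, i ≠ j → Disjoint (cthickening (2 * s) (Q i)) (cthickening (2 * s) (Q j)))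
    (hQU : ∀ j ∈ T, cthickening s (Q j) ⊆ U j) (hs : 0 ≤ s)
    (hT : ∀ j ∈ T, Transfer K δ g E F (U j)) :
    μH[(m : ℝ)] {z ∈ E | ∃ j ∈ T, g z ∈ cthickening s (Q j)} ≤
      (K : ℝ≥0∞) ^ m * μH[(m : ℝ)] F := by
  have hpiece : ∀ j ∈ T, μH[(m : ℝ)] {z ∈ E | g z ∈ cthickening s (Q j)} ≤
      (K : ℝ≥0∞) ^ m * μH[(m : ℝ)] (F ∩ cthickening (2 * s) (Q j)) := by
    intro j hj
    obtain ⟨h, hh⟩ := (hT j hj).fwd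
    refine (hausdorffMeasure_le_of_expanding (h := h) (K := K) (fun a ha b hb =>
      (hh a ha.1 (hQU j hj ha.2)).2.2 b hb.1 (hQU j hj hb.2)) m).trans ?_
    gcongr
    rintro _ ⟨z, hz, rfl⟩
    obtain ⟨h1, h2, -⟩ := hh z hz.1 (hQU j hj hz.2)
    refine ⟨h1, ?_⟩
    have h3 : h z ∈ cthickening s (cthickening s (Q j)) :=
      mem_cthickening_of_dist_le _ _ _ _ hz.2 (by rw [dist_comm]; exact h2.trans hδs)
    rw [two_mul]
    exact cthickening_cthickening_subset hs hs _ h3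
  calc μH[(m : ℝ)] {z ∈ E | ∃ j ∈ T, g z ∈ cthickening s (Q j)}
      ≤ μH[(m : ℝ)] (⋃ j ∈ T, {z ∈ E | g z ∈ cthickening s (Q j)}) := by
        refine measure_mono fun z hz => ?_
        obtain ⟨hz1, j, hj, hz2⟩ := hz
        exact mem_iUnion₂.2 ⟨j, hj, hz1, hz2⟩
    _ ≤ ∑ j ∈ T, μH[(m : ℝ)] {z ∈ E | g z ∈ cthickening s (Q j)} := measure_biUnion_finset_le _ _
    _ ≤ ∑ j ∈ T, (K : ℝ≥0∞) ^ m * μH[(m : ℝ)] (F ∩ cthickening (2 * s) (Q j)) :=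
        Finset.sum_le_sum hpiece
    _ = (K : ℝ≥0∞) ^ m * μH[(m : ℝ)] (⋃ j ∈ T, F ∩ cthickening (2 * s) (Q j)) := by
        rw [← Finset.mul_sum, measure_biUnion_finset]
        · intro i hi j hj hij
          exact (hsep i hi j hj hij).mono inter_subset_right inter_subset_right
        · exact fun j _ => (hF.inter isClosed_cthickening).measurableSet
    _ ≤ _ := by
        gcongr
        exact iUnion₂_subset fun j _ => inter_subset_left

end Estimates

end PieceEstimates

section MeasureLimit

open MeasureTheory Measure Filter

theorem exists_dilation_lt {a b c : ℝ≥0∞} (hab : a < b) (hc : c ≠ ⊤) (m : ℕ) :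
    ∃ K : ℝ≥0, 1 < K ∧ ∃ t : ℝ≥0∞, t ≠ 0 ∧ (K : ℝ≥0∞) ^ m * a + c * t < b := by
  obtain ⟨b', hab', hb'⟩ := _root_.exists_between hab
  obtain ⟨d, had, hdb⟩ := _root_.exists_between hab'
  have ha : a ≠ ⊤ := (had.trans_le le_top).ne
  have h1 : ∀ᶠ K : ℝ≥0 in nhdsWithin 1 (Ioi 1), (K : ℝ≥0∞) ^ m * a < d := by
    have hcont : Continuous fun K : ℝ≥0 => (K : ℝ≥0∞) ^ m * a := by
      have : (fun K : ℝ≥0 => (K : ℝ≥0∞) ^ m * a) = fun K : ℝ≥0 => ((K ^ m * a.toNNReal : ℝ≥0) : ℝ≥0∞) := by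
        ext K
        push_cast
        rw [ENNReal.coe_toNNReal ha]
      rw [this]
      exact ENNReal.continuous_coe.comp (by fun_prop)
    have h2 := (hcont.tendsto 1).eventually_lt_const (u := d) (by simpa using had)
    exact h2.filter_mono nhdsWithin_le_nhds
  obtain ⟨K, hK, hK1⟩ := (h1.and self_mem_nhdsWithin).exists
  refine ⟨K, hK1, (b' - d) / (c + 1), ?_, lt_of_le_of_lt ?_ hb'⟩
  · exact (ENNReal.div_pos (tsub_pos_of_lt hdb).ne' (by simp [hc])).ne'
  · calc (K : ℝ≥0∞) ^ m * a + c * ((b' - d) / (c + 1)) ≤ d + (b' - d) := by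
          refine add_le_add hK.le ?_
          calc c * ((b' - d) / (c + 1)) ≤ (c + 1) * ((b' - d) / (c + 1)) := by
                gcongr
                exact le_self_add
            _ ≤ b' - d := ENNReal.mul_div_le
      _ = b' := add_tsub_cancel_of_le hdb.le

/-- Hausdorff measures converge if, away from a null set, almost expanding transfer maps exist. -/
theorem tendsto_hausdorffMeasure {X : ℕ → Type} [∀ i, MetricSpace (X i)]
    [∀ i, MeasurableSpace (X i)] [∀ i, BorelSpace (X i)] {Y : Type} [MetricSpace Y] [CompactSpace Y]
    [Nonempty Y] [MeasurableSpace Y] [BorelSpace Y] {m : ℕ} (hm : 1 ≤ m) {E : ∀ i, Set (X i)}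
    {F : Set Y} {g : ∀ i, X i → Y} {ε : ℕ → ℝ} (hε : Tendsto ε atTop (nhds 0))
    (hg : ∀ i, Approx (ε i) (g i) (E i) F) (hE : ∀ i, IsClosed (E i)) (hF : IsClosed F)
    (hFfin : μH[(m : ℝ)] F ≠ ⊤) {A r₁ : ℝ} (hA : 0 ≤ A) (hr₁ : 0 < r₁)
    (hEA : ∀ i, ∀ a : X i, ∀ r, 0 < r → r ≤ r₁ →
      μH[(m : ℝ)] (E i ∩ closedBall a r) ≤ ENNReal.ofReal (A * r ^ m))
    (hT : ∀ K : ℝ≥0, 1 < K → ∃ B : Set Y, μH[(m : ℝ)] B = 0 ∧ ∀ p ∈ F \ B, ∃ ρ > 0, ∀ δ > 0,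
      ∀ᶠ i in atTop, Transfer K δ (g i) (E i) F (ball p ρ)) :
    Tendsto (fun i => μH[(m : ℝ)] (E i)) atTop (nhds (μH[(m : ℝ)] F)) := by
  classical
  obtain ⟨c, hc⟩ : ∃ c, c = ENNReal.ofReal A * 4 ^ m * (2 ^ m * 2) := ⟨_, rfl⟩
  have hctop : c ≠ ⊤ := by
    rw [hc]
    finiteness
  have key : ∀ K : ℝ≥0, 1 < K → ∀ t : ℝ≥0∞, t ≠ 0 →
      (∀ᶠ i in atTop, μH[(m : ℝ)] F ≤ (K : ℝ≥0∞) ^ m * μH[(m : ℝ)] (E i) + 1 * t) ∧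
      (∀ᶠ i in atTop, μH[(m : ℝ)] (E i) ≤ (K : ℝ≥0∞) ^ m * μH[(m : ℝ)] F + c * t) := by
    intro K hK t ht
    obtain ⟨B, hB, hTB⟩ := hT K hK
    choose! ρ hρ hTρ using hTB
    obtain ⟨P, hPF, hPc, hPcov⟩ := TopologicalSpace.countable_cover_nhdsWithin
      (f := fun p => ball p (ρ p)) (s := F \ B)
      fun p hp => mem_nhdsWithin_of_mem_nhds (ball_mem_nhds p (hρ p hp))
    obtain ⟨U, hU⟩ := ((hPc.image fun p => ball p (ρ p)).insert ∅).exists_eq_range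
      (insert_nonempty _ _)
    have hUgood : ∀ j, IsOpen (U j) ∧ ∀ δ > 0, ∀ᶠ i in atTop, Transfer K δ (g i) (E i) F (U j) := by
      intro j
      have hj : U j ∈ insert ∅ ((fun p => ball p (ρ p)) '' P) := hU ▸ mem_range_self j
      rcases hj with hj | ⟨p, hp, hj⟩
      · rw [hj]
        refine ⟨isOpen_empty, fun δ _ => Eventually.of_forall fun i => ⟨⟨g i, ?_⟩, ?_⟩⟩
        · exact fun _ _ h => absurd h (notMem_empty _)
        · choose h _ using (hg i).surj
          exact ⟨h, fun _ _ h' => absurd h' (notMem_empty _)⟩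
      · rw [← hj]
        exact ⟨isOpen_ball, hTρ p (hPF hp)⟩
    have hnull : μH[(m : ℝ)] (F \ ⋃ j, U j) = 0 := by
      refine measure_mono_null (fun x hx => ?_) hB
      by_contra hxB
      obtain ⟨p, hp, hxp⟩ := mem_iUnion₂.1 (hPcov ⟨hx.1, hxB⟩)
      have h1 : ball p (ρ p) ∈ range U := hU ▸ Or.inr ⟨p, hp, rfl⟩
      obtain ⟨j, hj⟩ := h1
      exact hx.2 (mem_iUnion.2 ⟨j, hj ▸ hxp⟩)
    obtain ⟨N, Q, hQ, hQd, hQμ⟩ := exists_disjoint_compacts _ hF hFfin (fun j => (hUgood j).1) hnull ht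
    obtain ⟨T, hTN⟩ : ∃ T, T = Finset.range N := ⟨_, rfl⟩
    rw [← hTN] at hQμ
    have hs1 : ∀ᶠ s in nhdsWithin (0 : ℝ) (Ioi 0), ∀ j ∈ T, cthickening s (Q j) ⊆ U j := by
      rw [Filter.eventually_all_finset]
      intro j _
      obtain ⟨d, hd, hdU⟩ := (hQ j).1.exists_cthickening_subset_open (hUgood j).1 (hQ j).2.2
      filter_upwards [Ioo_mem_nhdsGT hd] with s hs
      exact (cthickening_mono hs.2.le _).trans hdU
    have hs2 : ∀ᶠ s in nhdsWithin (0 : ℝ) (Ioi 0), ∀ i ∈ T, ∀ j ∈ T, i ≠ j →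
        Disjoint (cthickening (2 * s) (Q i)) (cthickening (2 * s) (Q j)) := by
      rw [Filter.eventually_all_finset]
      intro i _
      rw [Filter.eventually_all_finset]
      intro j _
      by_cases hij : i = j
      · exact Eventually.of_forall fun s h => absurd hij h
      obtain ⟨d, hd, hdU⟩ := (hQd hij).exists_cthickenings (hQ i).1 (hQ j).1.isClosed
      filter_upwards [Ioo_mem_nhdsGT (half_pos hd)] with s hs _
      have h2 : 2 * s ≤ d := by linarith [hs.2]
      exact hdU.mono (cthickening_mono h2 _) (cthickening_mono h2 _)
    obtain ⟨s, ⟨hsU, hsd⟩, hs0⟩ := ((hs1.and hs2).and self_mem_nhdsWithin).exists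
    replace hs0 : 0 < s := hs0
    have hTr : ∀ᶠ i in atTop, ∀ j ∈ T, Transfer K (s / 4) (g i) (E i) F (U j) := by
      rw [Filter.eventually_all_finset]
      exact fun j _ => (hUgood j).2 _ (by positivity)
    have hεs : ∀ᶠ i in atTop, ε i < s / 4 := hε.eventually (gt_mem_nhds (by positivity))
    constructor
    · filter_upwards [hTr, hεs] with i hi hεi
      have h1 := (hg i).sum_measure_le (hE i) m (s := s) (fun j _ => (hQ j).2.1) (fun j _ => (hQ j).2.2)
        (fun i hi j hj hij x hx y hy => by
          by_contra! hlt
          exact Set.disjoint_left.1 (hsd i hi j hj hij)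
            (mem_cthickening_of_dist_le y x _ _ hx (by rw [dist_comm]; linarith))
            (self_subset_cthickening _ hy)) hi (by linarith)
      calc μH[(m : ℝ)] F ≤ μH[(m : ℝ)] ((⋃ j ∈ T, Q j) ∪ (F \ ⋃ j ∈ T, Q j)) := by
            refine measure_mono fun x hx => ?_
            by_cases h : x ∈ ⋃ j ∈ T, Q j
            · exact Or.inl h
            · exact Or.inr ⟨hx, h⟩
        _ ≤ ∑ j ∈ T, μH[(m : ℝ)] (Q j) + μH[(m : ℝ)] (F \ ⋃ j ∈ T, Q j) :=
            (measure_union_le _ _).trans (by gcongr; exact measure_biUnion_finset_le _ _)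
        _ ≤ _ := by
            rw [one_mul]
            gcongr
    · have hthin : μH[(m : ℝ)] (F \ ⋃ j ∈ T, thickening (s / 2) (Q j)) < t := by
        refine (measure_mono (sdiff_subset_sdiff_right ?_)).trans_lt hQμ
        exact iUnion₂_mono fun j _ => self_subset_thickening (by positivity) _
      have hthinc : IsCompact (F \ ⋃ j ∈ T, thickening (s / 2) (Q j)) :=
        hF.isCompact.diff (isOpen_biUnion fun j _ => isOpen_thickening)
      obtain ⟨T', y, r, hr, hcov, hsum⟩ := exists_ball_cover hthinc hm hthin
        (show 0 < r₁ / 4 by positivity)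
      have hεr : ∀ᶠ i in atTop, ∀ j ∈ T', ε i ≤ r j := by
        rw [Filter.eventually_all_finset]
        exact fun j _ => (hε.eventually (gt_mem_nhds (hr j).1)).mono fun i hi => le_of_lt hi
      filter_upwards [hTr, hεs, hεr] with i hi hεi hεri
      have h1 := measure_over_le (g := g i) (E := E i) hF m (by linarith) hsd hsU hs0.le hi
      have h2 := measure_near_le hA (hEA i) (hg i) (T := T') (y := y) (r := r)
        fun j hj => ⟨(hr j).1, by linarith [(hr j).2], hεri j hj⟩
      calc μH[(m : ℝ)] (E i) ≤ μH[(m : ℝ)] ({z ∈ E i | ∃ j ∈ T, g i z ∈ cthickening s (Q j)} ∪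
            {z ∈ E i | ∃ w ∈ ⋃ j ∈ T', ball (y j) (r j), dist (g i z) w ≤ ε i}) := by
            refine measure_mono fun z hz => ?_
            obtain ⟨w, hw, hzw⟩ := (hg i).fwd z hz
            by_cases hwQ : w ∈ ⋃ j ∈ T, thickening (s / 2) (Q j)
            · obtain ⟨j, hj, hwj⟩ := mem_iUnion₂.1 hwQ
              obtain ⟨q, hq, hwq⟩ := mem_thickening_iff.1 hwj
              exact Or.inl ⟨hz, j, hj, mem_cthickening_of_dist_le _ q _ _ hq
                (by linarith [dist_triangle (g i z) w q])⟩
            · exact Or.inr ⟨hz, w, hcov ⟨hw, hwQ⟩, hzw⟩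
        _ ≤ _ := measure_union_le _ _
        _ ≤ (K : ℝ≥0∞) ^ m * μH[(m : ℝ)] F + ENNReal.ofReal A * 4 ^ m * (2 ^ m * (2 * t)) := by
            gcongr
            exact h2.trans (by gcongr)
        _ = _ := by
            rw [hc]
            ring
  refine tendsto_order.2 ⟨fun a ha => ?_, fun b hb => ?_⟩
  · obtain ⟨K, hK, t, ht, hlt⟩ := exists_dilation_lt ha ENNReal.one_ne_top m
    filter_upwards [(key K hK t ht).1] with i hi
    by_contra! hle
    exact absurd (hi.trans (by gcongr)) hlt.not_ge
  · obtain ⟨K, hK, t, ht, hlt⟩ := exists_dilation_lt hb hctop m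
    filter_upwards [(key K hK t ht).2] with i hi
    exact hi.trans_lt hlt

end MeasureLimit

section LocalTransferMaps

open MeasureTheory Measure Filter

theorem Packing.mono {X : Type} [MetricSpace X] {n : ℕ} {C r r' : ℝ} (h : Packing X n C r)
    (hr : r' ≤ r) : Packing X n C r' :=
  fun p s hs hsr => h p s hs (hsr.trans hr)

theorem Approx.mono {X Y : Type} [MetricSpace X] [MetricSpace Y] {ε ε' : ℝ} {g : X → Y} {E : Set X}
    {F : Set Y} (h : Approx ε g E F) (hε : ε ≤ ε') : Approx ε' g E F where
  isom a b := (h.isom a b).trans hε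
  surj y := let ⟨a, ha⟩ := h.surj y; ⟨a, ha.trans hε⟩
  fwd z hz := let ⟨y, hy, hzy⟩ := h.fwd z hz; ⟨y, hy, hzy.trans hε⟩
  bwd y hy := let ⟨z, hz, hzy⟩ := h.bwd y hy; ⟨z, hz, hzy.trans hε⟩

/-- Sets without strained points of rank `d + 1` have uniformly bounded `d`-dimensional measure on
small balls. -/
theorem exists_measure_bound (n : ℕ) (η : ℕ → ℝ) (hη : Ladder n η) (C : ℝ) (hC : 1 ≤ C) (d : ℕ)
    (hd : d ≤ n) :
    ∃ A : ℝ, 0 ≤ A ∧ ∀ (X : Type) [MetricSpace X] [MeasurableSpace X] [BorelSpace X] (e R r₀ : ℝ),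
      Model X n e R η → Packing X n C r₀ → 4 * r₀ ≤ R → ∀ T : Set X,
      (∀ p ∈ T, ∀ s : ℝ, 0 < s → s ≤ r₀ → ∀ c : Fin (d + 1) → Bool → X,
        ¬ Strainer (η (d + 1)) s p c) →
      ∀ (p : X) (r : ℝ), 0 < r → r ≤ η 0 ^ 2 * r₀ / 4 →
      μH[(d : ℝ)] (T ∩ closedBall p r) ≤ ENNReal.ofReal (A * r ^ d) := by
  obtain ⟨C', hC', h⟩ := exists_count n η hη C hC d hd
  refine ⟨C' * 2 ^ d, by positivity, fun X _ _ _ e R r₀ hM hP hR T hT p r hr hr₀ => ?_⟩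
  have h1 := hausdorffMeasure_le_of_card_le (T := T ∩ closedBall p r) (A := C') (d := d) hr
    fun ε hε hε1 S hS hsep => h X e R r₀ hM hP hR T hT p r hr hr₀ ε hε hε1 S
      (fun u hu => (hS u hu).1) (fun u hu => by
        rw [dist_comm]
        exact mem_closedBall.1 (hS u hu).2) hsep
  refine h1.trans (le_of_eq ?_)
  congr 1
  ring

theorem measure_ne_top_of_ball {X : Type} [MetricSpace X] [CompactSpace X] [MeasurableSpace X]
    (μ : Measure X) {T : Set X} {r : ℝ} (hr : 0 < r) (h : ∀ p, μ (T ∩ closedBall p r) ≠ ⊤) :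
    μ T ≠ ⊤ := by
  obtain ⟨P, -, hP, hcov⟩ := finite_cover_balls_of_compact (isCompact_univ (X := X)) hr
  refine ne_top_of_le_ne_top (b := ∑ p ∈ hP.toFinset, μ (T ∩ closedBall p r)) ?_ ?_
  · exact ENNReal.sum_ne_top.2 fun p _ => h p
  · refine le_trans (measure_mono fun x hx => ?_) (measure_biUnion_finset_le _ _)
    obtain ⟨p, hp, hxp⟩ := mem_iUnion₂.1 (hcov (mem_univ x))
    exact mem_iUnion₂.2 ⟨p, hP.mem_toFinset.2 hp, hx, ball_subset_closedBall hxp⟩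

/-- Sets without strained points of rank `d` are null sets for the `d`-dimensional measure. -/
theorem Model.measure_eq_zero {X : Type} [MetricSpace X] [CompactSpace X] [MeasurableSpace X]
    [BorelSpace X] {n : ℕ} {e R r₀ C : ℝ} {η : ℕ → ℝ} (hM : Model X n e R η) (hC : 1 ≤ C)
    (hP : Packing X n C r₀) (hr₀ : 0 < r₀) (hR : 4 * r₀ ≤ R) {d : ℕ} (hd : 1 ≤ d) (hdn : d ≤ n)
    {T : Set X} (hT : ∀ p ∈ T, ∀ s : ℝ, 0 < s → s ≤ r₀ → ∀ c : Fin d → Bool → X,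
      ¬ Strainer (η d) s p c) : μH[(d : ℝ)] T = 0 := by
  obtain ⟨d, rfl⟩ : ∃ d', d = d' + 1 := ⟨d - 1, by omega⟩
  obtain ⟨A, -, hA⟩ := exists_measure_bound n η hM.lad C hC d (by omega)
  have hη := hM.lad.pos 0 (by omega)
  have htop : μH[(d : ℝ)] T ≠ ⊤ := measure_ne_top_of_ball _ (r := η 0 ^ 2 * r₀ / 4) (by positivity)
    fun p => ne_top_of_le_ne_top ENNReal.ofReal_ne_top
      (hA X e R r₀ hM hP hR T hT p _ (by positivity) le_rfl)
  have hlt : (d : ℝ) < ((d + 1 : ℕ) : ℝ) := by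
    push_cast
    linarith
  exact (hausdorffMeasure_zero_or_top hlt T).resolve_right htop

theorem exists_expansion_parameter {K : ℝ} (hK : 1 < K) :
    ∃ lam : ℝ, 0 < lam ∧ lam ≤ 1 ∧ ∀ a b : ℝ, 0 ≤ a → 0 ≤ b → ∀ t ≤ lam ^ 2,
      (1 - 2 * lam ^ 2) * a ^ 2 ≤ (1 + t) * b ^ 2 → a ≤ K * b := by
  have hK2 : 1 < K ^ 2 := by nlinarith
  obtain ⟨lam, hlam⟩ : ∃ lam, lam = min (1 / 2) ((K ^ 2 - 1) / (1 + 2 * K ^ 2)) := ⟨_, rfl⟩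
  have h0 : 0 < lam := by
    rw [hlam]
    refine lt_min (by norm_num) (div_pos (by linarith) (by positivity))
  have h1 : lam ≤ 1 / 2 := hlam ▸ min_le_left _ _
  have h2 : lam * (1 + 2 * K ^ 2) ≤ K ^ 2 - 1 := by
    rw [← le_div_iff₀ (by positivity), hlam]
    exact min_le_right _ _
  have h3 : lam ^ 2 ≤ lam / 2 := by nlinarith
  refine ⟨lam, h0, by linarith, fun a b ha hb t ht h => ?_⟩
  have h4 : 1 + lam ^ 2 ≤ K ^ 2 * (1 - 2 * lam ^ 2) := by
    have h5 : lam ^ 2 * (1 + 2 * K ^ 2) ≤ lam * (1 + 2 * K ^ 2) := by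
      gcongr
      linarith
    linarith
  have h6 : 0 < 1 - 2 * lam ^ 2 := by linarith
  refine abs_le_of_sq_le_sq' ?_ (by positivity) |>.2
  have h7 : (1 + t) * b ^ 2 ≤ K ^ 2 * (1 - 2 * lam ^ 2) * b ^ 2 := by
    gcongr
    linarith
  rw [mul_pow]
  refine le_of_mul_le_mul_left ?_ h6
  linarith

/-- Almost expanding transfer maps exist near almost every point of the limit set. -/
theorem exists_null_transfer {n m : ℕ} (hm : 1 ≤ m) (hmn : m ≤ n) {κ : ℝ} {X : ℕ → Type}
    [∀ i, MetricSpace (X i)] [∀ i, CompactSpace (X i)] {Y : Type} [MetricSpace Y] [CompactSpace Y]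
    [MeasurableSpace Y] [BorelSpace Y] (hXalex : ∀ i, IsAlexandrov (X i) κ)
    (hYalex : IsAlexandrov Y κ) (hXdim : ∀ i, dimH (univ : Set (X i)) = n)
    (hYdim : dimH (univ : Set Y) = n) {g : ∀ i, X i → Y} {ε : ℕ → ℝ}
    (hε : Tendsto ε atTop (nhds 0)) {E : ∀ i, Set (X i)} {F : Set Y}
    (hE : ∀ i, IsExtremal κ (E i)) (hF : IsExtremal κ F) (hEdim : ∀ i, dimH (E i) = m)
    (hFdim : dimH F = m) (hg : ∀ i, Approx (ε i) (g i) (E i) F) {e₁ R₁ C r₁ : ℝ}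
    (hY : LAlex Y e₁ R₁) (hR₁ : 0 < R₁) (hC : 1 ≤ C) (hr₁ : 0 < r₁)
    (hXpack : ∀ i, Packing (X i) n C r₁) (hYpack : Packing Y n C r₁) {K : ℝ≥0} (hK : 1 < K) :
    ∃ B : Set Y, μH[(m : ℝ)] B = 0 ∧ ∀ p ∈ F \ B, ∃ ρ > 0, ∀ δ > 0,
      ∀ᶠ i in atTop, Transfer K δ (g i) (E i) F (ball p ρ) := by
  obtain ⟨lam, hlam, hlam1, hexp⟩ := exists_expansion_parameter (K := K) (by exact_mod_cast hK)
  obtain ⟨ε₁, hε₁, hrich⟩ := exists_uniform_rich (C := C) hY hR₁ (hm.trans hmn) hYdim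
  obtain ⟨b, hb⟩ : ∃ b, b = min (1 / (100 * ((n : ℝ) + 1)))
    (lam ^ 2 * min ε₁ 1 / (1000000 * ((n : ℝ) + 1) ^ 2)) := ⟨_, rfl⟩
  have hε₁' : 0 < min ε₁ 1 := lt_min hε₁ one_pos
  have hb0 : 0 < b := by
    rw [hb]
    refine lt_min ?_ ?_ <;> positivity
  obtain ⟨η, hη, hηb⟩ := exists_ladder n hb0
  have hη1 : ∀ k ≤ n + 1, η k ≤ 1 / (100 * (n + 1)) := fun k hk =>
    (hηb k hk).trans (hb ▸ min_le_left _ _)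
  obtain ⟨e, R, hR, hmodel⟩ := exists_model n κ hη hη1
  have hηm := hη.pos m (by omega)
  obtain ⟨η', hη', hηb'⟩ := exists_ladder n (b := min (1 / (100 * ((n : ℝ) + 1))) (η m / 2))
    (lt_min (by positivity) (by positivity))
  have hη1' : ∀ k ≤ n + 1, η' k ≤ 1 / (100 * (n + 1)) := fun k hk =>
    (hηb' k hk).trans (min_le_left _ _)
  have hηlt : η' m < η m := by
    have := (hηb' m (by omega)).trans (min_le_right _ _)
    linarith
  obtain ⟨e', R', hR', hmodel'⟩ := exists_model n κ hη' hη1'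
  obtain ⟨r₀, hr₀⟩ : ∃ r₀, r₀ = min r₁ (min (R / 4) (R' / 4)) := ⟨_, rfl⟩
  have hr₀0 : 0 < r₀ := hr₀ ▸ lt_min hr₁ (lt_min (by positivity) (by positivity))
  have hr₀1 : r₀ ≤ r₁ := hr₀ ▸ min_le_left _ _
  have hr₀R : 4 * r₀ ≤ R := by
    have : r₀ ≤ R / 4 := hr₀ ▸ (min_le_right _ _).trans (min_le_left _ _)
    linarith
  have hr₀R' : 4 * r₀ ≤ R' := by
    have : r₀ ≤ R' / 4 := hr₀ ▸ (min_le_right _ _).trans (min_le_right _ _)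
    linarith
  have hηε : 1000000 * ((m : ℝ) + 1) ^ 2 * η m ≤ lam ^ 2 * min ε₁ 1 := by
    have h1 : η m ≤ lam ^ 2 * min ε₁ 1 / (1000000 * ((n : ℝ) + 1) ^ 2) :=
      (hηb m (by omega)).trans (hb ▸ min_le_right _ _)
    rw [le_div_iff₀ (by positivity)] at h1
    have h2 : 1000000 * ((m : ℝ) + 1) ^ 2 * η m ≤ 1000000 * ((n : ℝ) + 1) ^ 2 * η m := by gcongr
    linarith
  have hηε1 : 175 * η m * m * (m + 1) ≤ lam ^ 2 := by
    have h1 : η m * (m * (m + 1)) ≤ η m * ((m : ℝ) + 1) ^ 2 := by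
      refine mul_le_mul_of_nonneg_left ?_ hηm.le
      have : (0 : ℝ) ≤ m := Nat.cast_nonneg m
      nlinarith
    have h2 : lam ^ 2 * min ε₁ 1 ≤ lam ^ 2 := mul_le_of_le_one_right (by positivity) (min_le_right _ _)
    have h3 : 0 ≤ η m * ((m : ℝ) + 1) ^ 2 := by positivity
    linarith
  refine ⟨{p ∈ F | ∀ s : ℝ, 0 < s → s ≤ r₀ → ∀ c : Fin m → Bool → Y, ¬ Strainer (η' m) s p c},
    (hmodel' Y hYalex hYdim).1.measure_eq_zero hC (hYpack.mono hr₀1) hr₀0 hr₀R' hm hmn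
      fun p hp => hp.2, fun p hp => ?_⟩
  have hpF := hp.1
  obtain ⟨σ, hσ, hσr, c, hc⟩ : ∃ s : ℝ, 0 < s ∧ s ≤ r₀ ∧ ∃ c : Fin m → Bool → Y,
      Strainer (η' m) s p c := by
    by_contra! hcon
    exact hp.2 ⟨hpF, hcon⟩
  obtain ⟨ρ, hρ, hloc⟩ := exists_local_transfer (hmodel Y hYalex hYdim).1 hη1 hmn hr₀R
    (hYpack.mono hr₀1) ((hmodel Y hYalex hYdim).2 F hF) hFdim hlam hlam1 hε₁' hηε
    (show 0 < 4 * R₁ by positivity) (fun L hL hLR => by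
      obtain ⟨ε₀, h1, h2⟩ := hrich p L hL hLR
      exact ⟨ε₀, (min_le_left _ _).trans h1, h2⟩) hc (hη'.pos m (by omega)) hηlt hσ hσr
  refine ⟨ρ, hρ, fun δ hδ => ?_⟩
  obtain ⟨ε₂, hε₂, hloc⟩ := hloc δ hδ
  filter_upwards [hε.eventually (gt_mem_nhds hε₂)] with i hi
  obtain ⟨⟨h, hh⟩, ⟨h', hh'⟩⟩ := hloc (X i) (E i) (g i) (hmodel (X i) (hXalex i) (hXdim i)).1
    ((hXpack i).mono hr₀1) ((hmodel (X i) (hXalex i) (hXdim i)).2 _ (hE i)) (hEdim i)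
    ((hg i).mono (le_of_lt hi))
  have hball : ∀ y ∈ ball p ρ, dist p y ≤ ρ := fun y hy => by
    rw [dist_comm]
    exact (mem_ball.1 hy).le
  refine ⟨⟨h, fun z hz hzU => ?_⟩, ⟨h', fun y hy hyU => ?_⟩⟩
  · obtain ⟨h1, h2, h3⟩ := hh z hz (hball _ hzU)
    exact ⟨h1, h2, fun z' hz' hzU' => hexp _ _ dist_nonneg dist_nonneg _ hηε1
      (h3 z' hz' (hball _ hzU'))⟩
  · obtain ⟨h1, h2, h3⟩ := hh' y hy (hball _ hyU)
    exact ⟨h1, h2, fun y' hy' hyU' => hexp _ _ dist_nonneg dist_nonneg _ hηε1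
      (h3 y' hy' (hball _ hyU'))⟩

/-- Convergence of extremal sets yields approximations of pairs. -/
theorem Approx.of_hausdorffDist {X Y : Type} [MetricSpace X] [MetricSpace Y] [CompactSpace Y]
    {ε ε' : ℝ} (hε : ε < ε') {g : X → Y} (h1 : ∀ a b, |dist (g a) (g b) - dist a b| ≤ ε)
    (h2 : ∀ y, ∃ a, dist (g a) y ≤ ε) {E : Set X} {F : Set Y} (hE : E.Nonempty) (hF : F.Nonempty)
    (hEF : hausdorffDist (g '' E) F ≤ ε) : Approx ε' g E F where
  isom a b := (h1 a b).trans hε.le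
  surj y := let ⟨a, ha⟩ := h2 y; ⟨a, ha.trans hε.le⟩
  fwd z hz := by
    obtain ⟨y, hy, hzy⟩ := exists_dist_lt_of_hausdorffDist_lt (mem_image_of_mem g hz)
      (hEF.trans_lt hε) (hausdorffEDist_ne_top_of_nonempty_of_bounded (hE.image g) hF
        (isCompact_univ.isBounded.subset (subset_univ _))
        (isCompact_univ.isBounded.subset (subset_univ _)))
    exact ⟨y, hy, hzy.le⟩
  bwd y hy := by
    obtain ⟨_, ⟨z, hz, rfl⟩, hzy⟩ := exists_dist_lt_of_hausdorffDist_lt' hy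
      (hEF.trans_lt hε) (hausdorffEDist_ne_top_of_nonempty_of_bounded (hE.image g) hF
        (isCompact_univ.isBounded.subset (subset_univ _))
        (isCompact_univ.isBounded.subset (subset_univ _)))
    exact ⟨z, hz, hzy.le⟩

theorem nonempty_of_dimH {X : Type} [MetricSpace X] {E : Set X} {m : ℕ} (hm : 1 ≤ m)
    (h : dimH E = m) : E.Nonempty := by
  by_contra hne
  rw [not_nonempty_iff_eq_empty.1 hne, dimH_empty] at h
  have : m = 0 := by exact_mod_cast h.symm
  omega

end LocalTransferMaps

/-- volume convergence of extremal subsets under noncollapsing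
Gromov–Hausdorff convergence (via `ε i`-approximations `g i` with `ε i → 0`). -/
theorem stmt17 (n m : ℕ) (κ D v : ℝ) (hv : 0 < v)
    (X : ℕ → Type) [instX : ∀ i, MetricSpace (X i)] [∀ i, CompactSpace (X i)]
    (Y : Type) [MetricSpace Y] [CompactSpace Y]
    (hXalex : ∀ i, IsAlexandrov (X i) κ) (hYalex : IsAlexandrov Y κ)
    (hXdim : ∀ i, dimH (Set.univ : Set (X i)) = n)
    (hYdim : dimH (Set.univ : Set Y) = n)
    (hXdiam : ∀ i, Metric.diam (Set.univ : Set (X i)) ≤ D)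
    (hXvol : ∀ i, ENNReal.ofReal v ≤
      hMeas (fun a b : X i => edist a b) (n : ℝ) (Set.univ : Set (X i)))
    (g : ∀ i, X i → Y) (ε : ℕ → ℝ) (hε0 : ∀ i, 0 ≤ ε i)
    (hε : Filter.Tendsto ε Filter.atTop (nhds 0))
    (happrox : ∀ i, (∀ a b : X i, |dist (g i a) (g i b) - dist a b| ≤ ε i) ∧
      ∀ y : Y, ∃ a : X i, dist (g i a) y ≤ ε i)
    (E : ∀ i, Set (X i)) (F : Set Y)
    (hEext : ∀ i, IsExtremal κ (E i)) (hFext : IsExtremal κ F)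
    (hEdim : ∀ i, dimH (E i) = m) (hFdim : dimH F = m)
    (hEF : ∀ i, Metric.hausdorffDist (g i '' E i) F ≤ ε i) :
    Filter.Tendsto (fun i => hMeas (fun a b : X i => edist a b) (m : ℝ) (E i))
      Filter.atTop (nhds (hMeas (fun a b : Y => edist a b) (m : ℝ) F)) := by
  classical
  rcases Nat.eq_zero_or_pos m with rfl | hm
  · simp only [hMeas_zero]
    exact tendsto_const_nhds
  have hmn : m ≤ n := by
    have h1 := dimH_mono (subset_univ F)
    rw [hFdim, hYdim] at h1
    exact_mod_cast h1
  have hFne := nonempty_of_dimH hm hFdim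
  have : Nonempty Y := hFne.nonempty
  let _ : MeasurableSpace Y := borel Y
  have : BorelSpace Y := ⟨rfl⟩
  let _ : ∀ i, MeasurableSpace (X i) := fun i => borel (X i)
  have : ∀ i, BorelSpace (X i) := fun i => ⟨rfl⟩
  simp only [hMeas_eq_hausdorffMeasure hm]
  have hεn : Filter.Tendsto (fun i : ℕ => ε i + 1 / ((i : ℝ) + 1)) Filter.atTop (nhds 0) := by
    have := hε.add (tendsto_one_div_add_atTop_nhds_zero_nat (𝕜 := ℝ))
    rwa [add_zero] at this
  have hg : ∀ i, Approx (ε i + 1 / ((i : ℝ) + 1)) (g i) (E i) F := fun i =>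
    Approx.of_hausdorffDist (lt_add_of_pos_right _ Nat.one_div_pos_of_nat) (happrox i).1
      (happrox i).2 (nonempty_of_dimH hm (hEdim i)) hFne (hEF i)
  obtain ⟨η, hη, hη1⟩ := exists_ladder n (b := 1 / (100 * ((n : ℝ) + 1))) (by positivity)
  obtain ⟨e, R, hR, hmodel⟩ := exists_model n κ hη hη1
  obtain ⟨C, hC, hpack⟩ := exists_pack n η hη
  obtain ⟨A, hA, hbound⟩ := exists_measure_bound n η hη C hC m hmn
  have hη0 := hη.pos 0 (by omega)
  have hYm := hmodel Y hYalex hYdim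
  have hXm := fun i => hmodel (X i) (hXalex i) (hXdim i)
  obtain ⟨r₀, hr₀⟩ : ∃ r₀, r₀ = R / (4 * 2 ^ (n + 1)) := ⟨_, rfl⟩
  have hr₀0 : 0 < r₀ := by
    rw [hr₀]
    positivity
  have hr₀1 : r₀ ≤ R / 2 ^ (n + 1) := by
    rw [hr₀]
    gcongr
    linarith [pow_pos (two_pos (α := ℝ)) (n + 1)]
  have hr₀R : 4 * r₀ ≤ R := by
    have h1 : R / 2 ^ (n + 1) ≤ R := div_le_self hR.le (one_le_pow₀ one_le_two)
    have h2 : 4 * r₀ = R / 2 ^ (n + 1) := by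
      rw [hr₀]
      field_simp
    linarith
  refine tendsto_hausdorffMeasure hm hεn hg (fun i => (hEext i).1) hFext.1 ?_ hA
    (show 0 < η 0 ^ 2 * r₀ / 4 by positivity) (fun i a r hr hr1 => ?_) fun K hK => ?_
  · exact measure_ne_top_of_ball _ (r := η 0 ^ 2 * r₀ / 4) (by positivity) fun p =>
      ne_top_of_le_ne_top ENNReal.ofReal_ne_top (hbound Y e R r₀ hYm.1
        ((hpack Y e R hYm.1).mono hr₀1) hr₀R F (fun p hp s hs hsr c =>
          hYm.1.not_strainer_of_dimH hη1 hmn (hYm.2 F hFext) hFdim hp hs (by linarith) c) p _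
        (by positivity) le_rfl)
  · exact hbound (X i) e R r₀ (hXm i).1 ((hpack (X i) e R (hXm i).1).mono hr₀1) hr₀R (E i)
      (fun p hp s hs hsr c => (hXm i).1.not_strainer_of_dimH hη1 hmn ((hXm i).2 _ (hEext i))
        (hEdim i) hp hs (by linarith) c) a r hr hr1
  · exact exists_null_transfer hm hmn hXalex hYalex hXdim hYdim hεn hEext hFext hEdim hFdim hg
      hYm.1.lalex hR hC hr₀0 (fun i => (hpack (X i) e R (hXm i).1).mono hr₀1)
      ((hpack Y e R hYm.1).mono hr₀1) hK
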